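/- Let S = sgp⟨A | u = v⟩ be the one-relator monoid presented by A = {a_1,…,a_n}, where u, v ∈ A^*, |v| ≤ |u| = 3 and u ≠ v. Then: (i) if the relation u = v is of the form aba = ba, aab = ba, or abb = bb for some distinct letters a, b ∈ A, then S is not automatic; (ii) if u = v is not of one of these forms, then S is prefix-automatic; (iii) if |v| = 0 or |v| = 3, then S is biautomatic. -/

import Mathlib

/-!  Common definitions, following the conventions of the paper
"Automaticity of one-relator semigroups with length less than or equal to three".

Words over an alphabet `α` are modelled as `List α`; the empty word is `[]`.
The padded alphabet `A(2,$)` is modelled inside `Option α × Option α`,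
where `none` plays the role of the padding symbol `$` (the pair `(none, none)`
never occurs in a padded convolution). -/

/-- A regular set of words: one accepted by a DFA with finitely many states. -/
abbrev IsReg {α : Type*} (L : Set (List α)) : Prop :=
  Language.IsRegular (L : Language α)

/-- Right-padded convolution `(x,y)δᴿ`: align the two words letter by letter
from the left and pad the shorter one on the right with the padding symbol. -/
def padR {α : Type*} (x y : List α) : List (Option α × Option α) :=
  (x.map some ++ List.replicate (y.length - x.length) none).zip
    (y.map some ++ List.replicate (x.length - y.length) none)

/-- Left-padded convolution `(x,y)δᴸ`: align the two words letter by letter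
from the right and pad the shorter one on the left with the padding symbol. -/
def padL {α : Type*} (x y : List α) : List (Option α × Option α) :=
  (List.replicate (y.length - x.length) none ++ x.map some).zip
    (List.replicate (x.length - y.length) none ++ y.map some)

/-- One elementary rewriting step: replace a factor `u` by `v`
for some defining relation `(u, v) ∈ R` (in either direction via `Relation.EqvGen`). -/
def OneStep {α : Type*} (R : Set (List α × List α)) (x y : List α) : Prop :=
  ∃ p u v s, (u, v) ∈ R ∧ x = p ++ u ++ s ∧ y = p ++ v ++ s

/-- Equality of two words in the semigroup `sgp⁺⟨α ∣ R⟩` (resp. the monoid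
`sgp⟨α ∣ R⟩`): the congruence on words generated by the relations `R`. -/
def WordEq {α : Type*} (R : Set (List α × List α)) : List α → List α → Prop :=
  Relation.EqvGen (OneStep R)

/-- Expansion of a word over an abstract generating set `β` into a word over the
presentation alphabet `α`, where `g b` is a word representing the generator `b`. -/
def expandW {α β : Type*} (g : β → List α) (w : List β) : List α :=
  (w.map g).flatten

/-- `(g, L)` is an automatic structure for the semigroup `sgp⁺⟨α ∣ R⟩` with
respect to the finite generating set indexed by `β`:  each generator `b` is the
element of the semigroup represented by the nonempty word `g b`, the language
`L ⊆ β⁺` is regular and maps onto the semigroup, and `L_ε^$` together with all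
`L_b^$` (right multiplication, right padding) are regular. -/
structure SgpAutoStruct {α β : Type*} (R : Set (List α × List α))
    (g : β → List α) (L : Set (List β)) : Prop where
  gen_ne : ∀ b, g b ≠ []
  reg : IsReg L
  ne : ∀ w ∈ L, w ≠ []
  onto : ∀ w : List α, w ≠ [] → ∃ x ∈ L, WordEq R (expandW g x) w
  eq_reg : IsReg {p | ∃ x ∈ L, ∃ y ∈ L,
      WordEq R (expandW g x) (expandW g y) ∧ p = padR x y}
  mul_reg : ∀ b : β, IsReg {p | ∃ x ∈ L, ∃ y ∈ L,
      WordEq R (expandW g x ++ g b) (expandW g y) ∧ p = padR x y}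

/-- A prefix-automatic structure for `sgp⁺⟨α ∣ R⟩`: an automatic structure for
which moreover `L'_= = {(x,y)δᴿ : x ∈ L, y ∈ Pref(L), x = y in S}` is regular. -/
structure SgpPrefixAutoStruct {α β : Type*} (R : Set (List α × List α))
    (g : β → List α) (L : Set (List β)) extends SgpAutoStruct R g L : Prop where
  pre_reg : IsReg {p | ∃ x ∈ L, ∃ y : List β, (∃ z ∈ L, y <+: z) ∧
      WordEq R (expandW g x) (expandW g y) ∧ p = padR x y}

/-- A biautomatic structure for the semigroup `sgp⁺⟨α ∣ R⟩`: the languages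
`L_b^$`, `_bL^$`, `^$L_b` and `_b^$L` are regular for every `b ∈ β ∪ {ε}`. -/
structure SgpBiautoStruct {α β : Type*} (R : Set (List α × List α))
    (g : β → List α) (L : Set (List β)) : Prop where
  gen_ne : ∀ b, g b ≠ []
  reg : IsReg L
  ne : ∀ w ∈ L, w ≠ []
  onto : ∀ w : List α, w ≠ [] → ∃ x ∈ L, WordEq R (expandW g x) w
  eqR_reg : IsReg {p | ∃ x ∈ L, ∃ y ∈ L,
      WordEq R (expandW g x) (expandW g y) ∧ p = padR x y}
  eqL_reg : IsReg {p | ∃ x ∈ L, ∃ y ∈ L,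
      WordEq R (expandW g x) (expandW g y) ∧ p = padL x y}
  mulRR_reg : ∀ b : β, IsReg {p | ∃ x ∈ L, ∃ y ∈ L,
      WordEq R (expandW g x ++ g b) (expandW g y) ∧ p = padR x y}
  mulLR_reg : ∀ b : β, IsReg {p | ∃ x ∈ L, ∃ y ∈ L,
      WordEq R (g b ++ expandW g x) (expandW g y) ∧ p = padR x y}
  mulRL_reg : ∀ b : β, IsReg {p | ∃ x ∈ L, ∃ y ∈ L,
      WordEq R (expandW g x ++ g b) (expandW g y) ∧ p = padL x y}
  mulLL_reg : ∀ b : β, IsReg {p | ∃ x ∈ L, ∃ y ∈ L,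
      WordEq R (g b ++ expandW g x) (expandW g y) ∧ p = padL x y}

/-- The semigroup `sgp⁺⟨α ∣ R⟩` is automatic: it admits an automatic structure
over some finite generating set. -/
def SgpAutomatic {α : Type*} (R : Set (List α × List α)) : Prop :=
  ∃ (β : Type) (_ : Fintype β) (g : β → List α) (L : Set (List β)),
    SgpAutoStruct R g L

/-- The semigroup `sgp⁺⟨α ∣ R⟩` is prefix-automatic. -/
def SgpPrefixAutomatic {α : Type*} (R : Set (List α × List α)) : Prop :=
  ∃ (β : Type) (_ : Fintype β) (g : β → List α) (L : Set (List β)),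
    SgpPrefixAutoStruct R g L

/-- The semigroup `sgp⁺⟨α ∣ R⟩` is biautomatic. -/
def SgpBiautomatic {α : Type*} (R : Set (List α × List α)) : Prop :=
  ∃ (β : Type) (_ : Fintype β) (g : β → List α) (L : Set (List β)),
    SgpBiautoStruct R g L

/-- `(g, L)` is an automatic structure for the monoid `sgp⟨α ∣ R⟩` with respect
to a finite generating set indexed by `β`; generators may represent any element
of the monoid (in particular the identity, represented by the empty word). -/
structure MonAutoStruct {α β : Type*} (R : Set (List α × List α))
    (g : β → List α) (L : Set (List β)) : Prop where
  reg : IsReg L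
  ne : ∀ w ∈ L, w ≠ []
  onto : ∀ w : List α, ∃ x ∈ L, WordEq R (expandW g x) w
  eq_reg : IsReg {p | ∃ x ∈ L, ∃ y ∈ L,
      WordEq R (expandW g x) (expandW g y) ∧ p = padR x y}
  mul_reg : ∀ b : β, IsReg {p | ∃ x ∈ L, ∃ y ∈ L,
      WordEq R (expandW g x ++ g b) (expandW g y) ∧ p = padR x y}

/-- A prefix-automatic structure for the monoid `sgp⟨α ∣ R⟩`. -/
structure MonPrefixAutoStruct {α β : Type*} (R : Set (List α × List α))
    (g : β → List α) (L : Set (List β)) extends MonAutoStruct R g L : Prop where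
  pre_reg : IsReg {p | ∃ x ∈ L, ∃ y : List β, (∃ z ∈ L, y <+: z) ∧
      WordEq R (expandW g x) (expandW g y) ∧ p = padR x y}

/-- A biautomatic structure for the monoid `sgp⟨α ∣ R⟩`. -/
structure MonBiautoStruct {α β : Type*} (R : Set (List α × List α))
    (g : β → List α) (L : Set (List β)) : Prop where
  reg : IsReg L
  ne : ∀ w ∈ L, w ≠ []
  onto : ∀ w : List α, ∃ x ∈ L, WordEq R (expandW g x) w
  eqR_reg : IsReg {p | ∃ x ∈ L, ∃ y ∈ L,
      WordEq R (expandW g x) (expandW g y) ∧ p = padR x y}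
  eqL_reg : IsReg {p | ∃ x ∈ L, ∃ y ∈ L,
      WordEq R (expandW g x) (expandW g y) ∧ p = padL x y}
  mulRR_reg : ∀ b : β, IsReg {p | ∃ x ∈ L, ∃ y ∈ L,
      WordEq R (expandW g x ++ g b) (expandW g y) ∧ p = padR x y}
  mulLR_reg : ∀ b : β, IsReg {p | ∃ x ∈ L, ∃ y ∈ L,
      WordEq R (g b ++ expandW g x) (expandW g y) ∧ p = padR x y}
  mulRL_reg : ∀ b : β, IsReg {p | ∃ x ∈ L, ∃ y ∈ L,
      WordEq R (expandW g x ++ g b) (expandW g y) ∧ p = padL x y}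
  mulLL_reg : ∀ b : β, IsReg {p | ∃ x ∈ L, ∃ y ∈ L,
      WordEq R (g b ++ expandW g x) (expandW g y) ∧ p = padL x y}

/-- The monoid `sgp⟨α ∣ R⟩` is automatic. -/
def MonAutomatic {α : Type*} (R : Set (List α × List α)) : Prop :=
  ∃ (β : Type) (_ : Fintype β) (g : β → List α) (L : Set (List β)),
    MonAutoStruct R g L

/-- The monoid `sgp⟨α ∣ R⟩` is prefix-automatic. -/
def MonPrefixAutomatic {α : Type*} (R : Set (List α × List α)) : Prop :=
  ∃ (β : Type) (_ : Fintype β) (g : β → List α) (L : Set (List β)),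
    MonPrefixAutoStruct R g L

/-- The monoid `sgp⟨α ∣ R⟩` is biautomatic. -/
def MonBiautomatic {α : Type*} (R : Set (List α × List α)) : Prop :=
  ∃ (β : Type) (_ : Fintype β) (g : β → List α) (L : Set (List β)),
    MonBiautoStruct R g L

/-- The defining relations of `S¹ = sgp⁺⟨α, e ∣ R, ea = ae = a, ee = e⟩`,
the monoid obtained from `S = sgp⁺⟨α ∣ R⟩` by adjoining an identity element,
presented as a semigroup over the alphabet `Option α` where `none` is the new
identity letter `e`. -/
def adjoinOne {α : Type*} (R : Set (List α × List α)) :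
    Set (List (Option α) × List (Option α)) :=
  {q | ∃ p ∈ R, q = (p.1.map some, p.2.map some)} ∪
    {q | ∃ a : α, q = ([none, some a], [some a])} ∪
    {q | ∃ a : α, q = ([some a, none], [some a])} ∪
    {([none, none], [none])}

/-! ### Regular languages, as predicates on words -/

/-- Regularity of a predicate on words. -/
def Reg {σ : Type} (P : List σ → Prop) : Prop := IsReg {w | P w}

theorem Reg.congr {σ : Type} {P Q : List σ → Prop} (h : Reg P) (e : ∀ w, P w ↔ Q w) : Reg Q := by
  have : P = Q := funext fun w => propext (e w)
  exact this ▸ h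

theorem Reg.exists_dfa {σ : Type} {P : List σ → Prop} (h : Reg P) :
    ∃ (τ : Type) (_ : Fintype τ) (M : DFA σ τ), ∀ w, w ∈ M.accepts ↔ P w := by
  obtain ⟨τ, i, M, hM⟩ := h
  exact ⟨τ, i, M, fun w => by rw [hM]; rfl⟩

theorem Reg.of_dfa {σ τ : Type} [Finite τ] (M : DFA σ τ) (s : τ) (P : List σ → Prop)
    (h : ∀ w, M.evalFrom s w ∈ M.accept ↔ P w) : Reg P := by
  have := Fintype.ofFinite τ
  refine ⟨τ, inferInstance, ⟨M.step, s, M.accept⟩, ?_⟩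
  ext w
  exact h w

theorem Reg.not {σ : Type} {P : List σ → Prop} (h : Reg P) : Reg (fun w => ¬ P w) :=
  Language.IsRegular.compl h

theorem Reg.and {σ : Type} {P Q : List σ → Prop} (h : Reg P) (h' : Reg Q) :
    Reg (fun w => P w ∧ Q w) :=
  Language.IsRegular.inf h h'

theorem Reg.or {σ : Type} {P Q : List σ → Prop} (h : Reg P) (h' : Reg Q) :
    Reg (fun w => P w ∨ Q w) :=
  Language.IsRegular.add h h'

theorem Reg.reverse {σ : Type} {P : List σ → Prop} (h : Reg P) : Reg (fun w => P w.reverse) :=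
  Language.IsRegular.reverse h

theorem Reg.comap {σ τ : Type} {P : List σ → Prop} (h : Reg P) (f : τ → σ) :
    Reg (fun w => P (w.map f)) := by
  obtain ⟨κ, i, M, hM⟩ := h
  refine ⟨κ, i, M.comap f, ?_⟩
  rw [DFA.accepts_comap, hM]; rfl

theorem Reg.const {σ : Type} (p : Prop) : Reg (fun _ : List σ => p) :=
  Reg.of_dfa (τ := Unit) ⟨fun _ _ => (), (), {_x | p}⟩ () _ (fun _ => Iff.rfl)

/-- Finite systems of right-linear equations have regular solutions. -/
theorem Reg.system {σ ι : Type} [Finite ι] (K : ι → List σ → Prop) (T : ι → σ → ι → Prop)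
    (h : ∀ i a w, K i (a :: w) ↔ ∃ j, T i a j ∧ K j w) (i : ι) : Reg (K i) := by
  classical
  have := Fintype.ofFinite ι
  let M : NFA σ ι := ⟨fun i a => {j | T i a j}, {i}, {j | K j []}⟩
  have key : ∀ (w : List σ) (S : Set ι), w ∈ M.acceptsFrom S ↔ ∃ j ∈ S, K j w := by
    intro w
    induction w with
    | nil => intro S; rw [NFA.nil_mem_acceptsFrom]; rfl
    | cons a w ih =>
      intro S
      rw [NFA.cons_mem_acceptsFrom, ih]
      constructor
      · rintro ⟨j, hj, hw⟩
        rw [NFA.mem_stepSet] at hj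
        obtain ⟨t, ht, hs⟩ := hj
        exact ⟨t, ht, (h t a w).2 ⟨j, hs, hw⟩⟩
      · rintro ⟨t, ht, hw⟩
        obtain ⟨j, hj, hw⟩ := (h t a w).1 hw
        exact ⟨j, NFA.mem_stepSet.2 ⟨t, ht, hj⟩, hw⟩
  refine ⟨Set ι, inferInstance, M.toDFA, ?_⟩
  rw [NFA.toDFA_correct]
  ext w
  rw [NFA.accepts_eq_acceptsFrom_start, key]
  show (∃ j ∈ ({i} : Set ι), K j w) ↔ K i w
  simp

theorem Reg.nil {σ : Type} : Reg (fun w : List σ => w = []) := by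
  refine (Reg.system (ι := Unit) (fun _ w => w = []) (fun _ _ _ => False) ?_ ()).congr ?_ <;> simp

/-- Words of `W` repeated, followed by a word of `K`. -/
inductive StarL {σ : Type} (W : List (List σ)) (K : List σ → Prop) : List σ → Prop
  | base {w} : K w → StarL W K w
  | step {w x} : w ∈ W → StarL W K x → StarL W K (w ++ x)

theorem StarL.cons_iff {σ : Type} {W : List (List σ)} {K : List σ → Prop}
    (hW : ∀ w ∈ W, w ≠ []) {a : σ} {x : List σ} :
    StarL W K (a :: x) ↔ K (a :: x) ∨ ∃ t, (a :: t) ∈ W ∧ ∃ y, x = t ++ y ∧ StarL W K y := by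
  constructor
  · intro h
    generalize hz : a :: x = z at h
    cases h with
    | base h => subst hz; exact Or.inl h
    | @step w y hw hy =>
      right
      cases w with
      | nil => exact absurd rfl (hW _ hw)
      | cons b t =>
        simp only [List.cons_append, List.cons.injEq] at hz
        obtain ⟨rfl, rfl⟩ := hz
        exact ⟨t, hw, y, rfl, hy⟩
  · rintro (h | ⟨t, ht, y, rfl, hy⟩)
    · exact .base h
    · exact .step (w := a :: t) ht hy

theorem Reg.star {σ : Type} {W : List (List σ)} {K : List σ → Prop} (hK : Reg K)
    (hW : ∀ w ∈ W, w ≠ []) : Reg (StarL W K) := by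
  obtain ⟨τ, i, M, hM⟩ := hK.exists_dfa
  let ι := Option ({s : List σ // s ∈ W.flatMap List.tails} ⊕ τ)
  have : Finite {s : List σ // s ∈ W.flatMap List.tails} :=
    (List.finite_toSet (W.flatMap List.tails)).to_subtype
  let KK : ι → List σ → Prop := fun i w => match i with
    | none => StarL W K w
    | some (.inl s) => ∃ y, w = s.1 ++ y ∧ StarL W K y
    | some (.inr t) => M.evalFrom t w ∈ M.accept
  have hK' : ∀ w, K w ↔ M.evalFrom M.start w ∈ M.accept := fun w => (hM w).symm
  let T0 : σ → ι → Prop := fun a j =>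
    j = some (.inr (M.step M.start a)) ∨
      ∃ s : {s : List σ // s ∈ W.flatMap List.tails}, (a :: s.1) ∈ W ∧ j = some (.inl s)
  have h0 : ∀ a w, StarL W K (a :: w) ↔ ∃ j, T0 a j ∧ KK j w := by
    intro a w
    rw [StarL.cons_iff hW, hK']
    constructor
    · rintro (h | ⟨t, ht, hy⟩)
      · exact ⟨_, Or.inl rfl, h⟩
      · refine ⟨some (.inl ⟨t, ?_⟩), Or.inr ⟨_, ht, rfl⟩, hy⟩
        simp only [List.mem_flatMap, List.mem_tails]
        exact ⟨_, ht, List.suffix_cons _ _⟩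
    · rintro ⟨j, (rfl | ⟨s, hs, rfl⟩), h⟩
      · exact Or.inl h
      · exact Or.inr ⟨s.1, hs, h⟩
  refine Reg.system KK (fun i a j => match i with
    | none => T0 a j
    | some (.inl ⟨[], _⟩) => T0 a j
    | some (.inl ⟨b :: s, hs⟩) => b = a ∧ ∃ hs', j = some (.inl ⟨s, hs'⟩)
    | some (.inr t) => j = some (.inr (M.step t a))) ?_ none
  rintro (_ | ⟨⟨_ | ⟨b, s⟩, hs⟩⟩ | t) a w
  · exact h0 a w
  · simpa [KK] using h0 a w
  · constructor
    · rintro ⟨y, hy, h⟩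
      simp only [List.cons_append, List.cons.injEq] at hy
      obtain ⟨rfl, rfl⟩ := hy
      refine ⟨_, ⟨rfl, ?_, rfl⟩, y, rfl, h⟩
      simp only [List.mem_flatMap, List.mem_tails] at hs ⊢
      obtain ⟨z, hz, hz'⟩ := hs
      exact ⟨z, hz, (List.suffix_cons _ _).trans hz'⟩
    · rintro ⟨j, ⟨rfl, hs', rfl⟩, y, rfl, h⟩
      exact ⟨y, rfl, h⟩
  · constructor
    · intro h; exact ⟨_, rfl, h⟩
    · rintro ⟨j, rfl, h⟩; exact h

theorem Reg.pre {σ : Type} {K : List σ → Prop} (hK : Reg K) (s : List σ) :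
    Reg (fun w => ∃ y, w = s ++ y ∧ K y) := by
  induction s with
  | nil => simpa using hK
  | cons a s ih =>
    obtain ⟨τ, i, M, hM⟩ := ih.exists_dfa
    refine (Reg.system (ι := Option τ)
      (fun i w => match i with
        | none => ∃ y, w = (a :: s) ++ y ∧ K y
        | some t => M.evalFrom t w ∈ M.accept)
      (fun i b j => match i with
        | none => b = a ∧ j = some M.start
        | some t => j = some (M.step t b)) ?_ none)
    rintro (_ | t) b w
    · constructor
      · rintro ⟨y, hy, h⟩
        simp only [List.cons_append, List.cons.injEq] at hy
        exact ⟨_, ⟨hy.1, rfl⟩, (hM w).2 ⟨y, hy.2, h⟩⟩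
      · rintro ⟨j, ⟨rfl, rfl⟩, h⟩
        obtain ⟨y, rfl, h'⟩ := (hM w).1 h
        exact ⟨y, rfl, h'⟩
    · constructor
      · intro h; exact ⟨_, rfl, h⟩
      · rintro ⟨j, rfl, h⟩; exact h

theorem Reg.single {σ : Type} (s : List σ) : Reg (fun w => w = s) :=
  (Reg.nil.pre s).congr (by simp)

theorem StarL.letters {σ : Type} [Fintype σ] (K : List σ → Prop) (w : List σ) :
    StarL ((Finset.univ : Finset σ).toList.map fun a => [a]) K w ↔ ∃ p y, w = p ++ y ∧ K y := by
  constructor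
  · intro h
    induction h with
    | base h => exact ⟨[], _, rfl, h⟩
    | @step w x hw _ ih =>
      obtain ⟨p, y, rfl, h⟩ := ih
      exact ⟨w ++ p, y, by simp, h⟩
  · rintro ⟨p, y, rfl, h⟩
    induction p with
    | nil => exact .base h
    | cons a p ih => exact .step (w := [a]) (by simp) ih

theorem Reg.anyPre {σ : Type} [Fintype σ] {K : List σ → Prop} (hK : Reg K) :
    Reg (fun w => ∃ p y, w = p ++ y ∧ K y) :=
  (hK.star (W := (Finset.univ : Finset σ).toList.map fun a => [a]) (by simp)).congr
    (StarL.letters K)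

/-- Avoiding a finite list of factors. -/
def Irr {σ : Type} (F : List (List σ)) (w : List σ) : Prop := ∀ f ∈ F, ¬ f <:+: w

theorem Reg.infix {σ : Type} [Fintype σ] (f : List σ) : Reg (fun w => f <:+: w) :=
  (((Reg.const True).pre f).anyPre).congr fun w => by
    constructor
    · rintro ⟨p, y, rfl, z, rfl, -⟩
      exact ⟨p, z, by simp⟩
    · rintro ⟨p, z, rfl⟩
      exact ⟨p, f ++ z, by simp, z, rfl, trivial⟩

theorem Reg.irr {σ : Type} [Fintype σ] (F : List (List σ)) : Reg (Irr F) := by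
  induction F with
  | nil => exact (Reg.const True).congr (by simp [Irr])
  | cons f F ih => exact ((Reg.infix f).not.and ih).congr (by simp [Irr])

theorem irr_cons {σ : Type} {F : List (List σ)} {c : σ} {r : List σ} :
    Irr F (c :: r) ↔ (∀ f ∈ F, ¬ f <+: c :: r) ∧ Irr F r := by
  simp only [Irr, List.infix_cons_iff, not_or]
  exact ⟨fun h => ⟨fun f hf => (h f hf).1, fun f hf => (h f hf).2⟩, fun h f hf => ⟨h.1 f hf, h.2 f hf⟩⟩

theorem irr_nil {σ : Type} {F : List (List σ)} (h : [] ∉ F) : Irr F ([] : List σ) := by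
  intro f hf hh
  simp only [List.infix_nil] at hh
  exact h (hh ▸ hf)

/-! ### Automatic relations -/

/-- Convolution of two words, padded to length `n`. -/
def cv {β : Type} : ℕ → List β → List β → List (Option β × Option β)
  | 0, _, _ => []
  | n + 1, x, y => (x.head?, y.head?) :: cv n x.tail y.tail

/-- Relations recognised by a finite automaton reading both words synchronously. -/
def Auto {β : Type} (E : List β → List β → Prop) : Prop :=
  ∃ K : List (Option β × Option β) → Prop, Reg K ∧
    ∀ n x y, x.length ≤ n → y.length ≤ n → (K (cv n x y) ↔ E x y)

theorem Auto.congr {β : Type} {E F : List β → List β → Prop} (h : Auto E)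
    (e : ∀ x y, E x y ↔ F x y) : Auto F := by
  have : E = F := funext fun x => funext fun y => propext (e x y)
  exact this ▸ h

theorem Auto.and {β : Type} {E F : List β → List β → Prop} (h : Auto E) (h' : Auto F) :
    Auto (fun x y => E x y ∧ F x y) := by
  obtain ⟨K, hK, e⟩ := h
  obtain ⟨K', hK', e'⟩ := h'
  exact ⟨_, hK.and hK', fun n x y hx hy => by rw [e n x y hx hy, e' n x y hx hy]⟩

theorem Auto.or {β : Type} {E F : List β → List β → Prop} (h : Auto E) (h' : Auto F) :
    Auto (fun x y => E x y ∨ F x y) := by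
  obtain ⟨K, hK, e⟩ := h
  obtain ⟨K', hK', e'⟩ := h'
  exact ⟨_, hK.or hK', fun n x y hx hy => by rw [e n x y hx hy, e' n x y hx hy]⟩

theorem Auto.const {β : Type} (p : Prop) : Auto (fun _ _ : List β => p) :=
  ⟨_, Reg.const p, fun _ _ _ _ _ => Iff.rfl⟩

theorem Auto.exList {β ι : Type} (T : List ι) (E : ι → List β → List β → Prop)
    (h : ∀ t ∈ T, Auto (E t)) : Auto (fun x y => ∃ t ∈ T, E t x y) := by
  induction T with
  | nil => exact (Auto.const False).congr (by simp)
  | cons t T ih =>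
    exact ((h t (by simp)).or (ih fun s hs => h s (by simp [hs]))).congr (by simp)

theorem cv_swap {β : Type} (n : ℕ) (x y : List β) : (cv n x y).map Prod.swap = cv n y x := by
  induction n generalizing x y with
  | zero => rfl
  | succ n ih => simp [cv, ih]

theorem Auto.swap {β : Type} {E : List β → List β → Prop} (h : Auto E) :
    Auto (fun x y => E y x) := by
  obtain ⟨K, hK, e⟩ := h
  exact ⟨_, hK.comap Prod.swap, fun n x y hx hy => by rw [cv_swap, e n y x hy hx]⟩

theorem Auto.fst {β : Type} {P : List β → Prop} (h : Reg P) : Auto (fun x _ => P x) := by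
  obtain ⟨τ, i, M, hM⟩ := h.exists_dfa
  let N : DFA (Option β × Option β) τ :=
    ⟨fun s p => match p.1 with | none => s | some a => M.step s a, M.start, M.accept⟩
  have key : ∀ n x y s, x.length ≤ n → N.evalFrom s (cv n x y) = M.evalFrom s x := by
    intro n
    induction n with
    | zero =>
      intro x y s hx
      obtain rfl : x = [] := List.eq_nil_of_length_eq_zero (by omega)
      rfl
    | succ n ih =>
      intro x y s hx
      cases x with
      | nil =>
        have := ih [] y.tail s (by simp)
        exact this
      | cons a x =>
        have := ih x y.tail (M.step s a) (by simpa using hx)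
        exact this
  refine ⟨_, Reg.of_dfa N M.start _ (fun w => Iff.rfl), fun n x y hx _ => ?_⟩
  rw [key n x y _ hx]
  exact hM x

theorem Auto.snd {β : Type} {P : List β → Prop} (h : Reg P) : Auto (fun _ y => P y) :=
  (Auto.fst h).swap

theorem Auto.nil {β : Type} : Auto (fun x y : List β => x = [] ∧ y = []) :=
  (Auto.fst Reg.nil).and (Auto.snd Reg.nil)

/-- First track of a word `w`, paired with `y`. -/
def tr1 {β : Type} : List (Option β × Option β) → List β → List (Option β × Option β)
  | [], y => y.map fun b => (none, some b)
  | p :: w, y => (p.1, y.head?) :: tr1 w y.tail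

/-- Second track of a word `w`, paired with `y`. -/
def tr2 {β : Type} : List (Option β × Option β) → List β → List (Option β × Option β)
  | [], y => y.map fun b => (some b, none)
  | p :: w, y => (y.head?, p.2) :: tr2 w y.tail

theorem cv_nil_left {β : Type} (y : List β) :
    cv y.length [] y = y.map fun b => (none, some b) := by
  induction y with
  | nil => rfl
  | cons a y ih => simp [cv, ih]

theorem cv_nil_right {β : Type} (y : List β) :
    cv y.length y [] = y.map fun b => (some b, none) := by
  induction y with
  | nil => rfl
  | cons a y ih => simp [cv, ih]

theorem tr1_cv {β : Type} (n : ℕ) (x y z : List β) (hx : x.length ≤ n) :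
    tr1 (cv n x z) y = cv (max n y.length) x y := by
  induction n generalizing x y z with
  | zero =>
    obtain rfl : x = [] := List.eq_nil_of_length_eq_zero (by omega)
    simp [cv, tr1, cv_nil_left]
  | succ n ih =>
    have : max (n + 1) y.length = max n y.tail.length + 1 := by
      cases y <;> simp
    rw [this]
    simp only [cv, tr1]
    rw [ih _ _ _ (by simp; omega)]

theorem tr2_cv {β : Type} (n : ℕ) (x y z : List β) (hx : z.length ≤ n) :
    tr2 (cv n x z) y = cv (max n y.length) y z := by
  induction n generalizing x y z with
  | zero =>
    obtain rfl : z = [] := List.eq_nil_of_length_eq_zero (by omega)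
    simp [cv, tr2, cv_nil_right]
  | succ n ih =>
    have : max (n + 1) y.length = max n y.tail.length + 1 := by
      cases y <;> simp
    rw [this]
    simp only [cv, tr2]
    rw [ih _ _ _ (by simp; omega)]

theorem Auto.comp {β : Type} {E F : List β → List β → Prop} (h : Auto E) (h' : Auto F) :
    Auto (fun x z => ∃ y, E x y ∧ F y z) := by
  obtain ⟨K, hK, e⟩ := h
  obtain ⟨K', hK', e'⟩ := h'
  obtain ⟨τ, i, M, hM⟩ := hK.exists_dfa
  obtain ⟨τ', i', M', hM'⟩ := hK'.exists_dfa
  let KK : (τ × τ' × Bool) → List (Option β × Option β) → Prop := fun s w =>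
    ∃ y : List β, (s.2.2 = true → y = []) ∧ M.evalFrom s.1 (tr1 w y) ∈ M.accept ∧
      M'.evalFrom s.2.1 (tr2 w y) ∈ M'.accept
  have hr := Reg.system KK (fun s p t =>
      (s.2.2 = false ∧ ∃ a : β, t = (M.step s.1 (p.1, some a), M'.step s.2.1 (some a, p.2), false)) ∨
      t = (M.step s.1 (p.1, none), M'.step s.2.1 (none, p.2), true)) (by
    rintro ⟨s, s', b⟩ ⟨p, q⟩ w
    constructor
    · rintro ⟨y, hb, h1, h2⟩
      cases y with
      | nil => exact ⟨_, Or.inr rfl, [], fun _ => rfl, h1, h2⟩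
      | cons a y =>
        refine ⟨_, Or.inl ⟨?_, a, rfl⟩, y, by simp, h1, h2⟩
        cases b with
        | false => rfl
        | true => simp at hb
    · rintro ⟨t, ⟨hb, a, rfl⟩ | rfl, y, hy, h1, h2⟩
      · exact ⟨a :: y, by simp at hb; simp [hb], h1, h2⟩
      · have := hy rfl
        subst this
        exact ⟨[], fun _ => rfl, h1, h2⟩) (M.start, M'.start, false)
  refine ⟨_, hr, fun n x z hx hz => ?_⟩
  simp only [KK]
  refine exists_congr fun y => ?_
  have h1 := hM (tr1 (cv n x z) y)
  have h2 := hM' (tr2 (cv n x z) y)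
  rw [tr1_cv _ _ _ _ hx, e _ _ _ (by omega) (by omega)] at h1
  rw [tr2_cv _ _ _ _ hz, e' _ _ _ (by omega) (by omega)] at h2
  rw [← h1, ← h2, ← tr1_cv _ _ _ z hx, ← tr2_cv _ x _ _ hz]
  simp; rfl

theorem Auto.shift {β : Type} [Finite β] (a : β) : Auto (fun x y : List β => y = a :: x) := by
  classical
  let N : DFA (Option β × Option β) (Option (Option β)) :=
    ⟨fun s p => match s with | none => none | some m => if p.2 = m then some p.1 else none,
      none, {some none}⟩
  have dead : ∀ w, N.evalFrom none w = none := by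
    intro w
    induction w with
    | nil => rfl
    | cons p w ih => exact ih
  have key : ∀ n x y m, x.length ≤ n → y.length ≤ n →
      (N.evalFrom (some m) (cv n x y) ∈ N.accept ↔
        match m with | some a => y = a :: x | none => x = [] ∧ y = []) := by
    intro n
    induction n with
    | zero =>
      intro x y m hx hy
      obtain rfl : x = [] := List.eq_nil_of_length_eq_zero (by omega)
      obtain rfl : y = [] := List.eq_nil_of_length_eq_zero (by omega)
      show (some m ∈ ({some none} : Set _)) ↔ _
      cases m <;> simp
    | succ n ih =>
      intro x y m hx hy
      show N.evalFrom (if y.head? = m then some x.head? else none) (cv n x.tail y.tail) ∈ N.accept ↔ _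
      split_ifs with hm
      · rw [ih _ _ _ (by simp; omega) (by simp; omega)]
        subst hm
        rcases x with _ | ⟨b, x⟩ <;> rcases y with _ | ⟨c, y⟩ <;> simp
      · rw [dead]
        constructor
        · intro h
          exact absurd (show none = some none from h) (by simp)
        · intro h
          exfalso
          apply hm
          cases m with
          | none => simp [h.2]
          | some a => simp only at h; simp [h]
  exact ⟨_, Reg.of_dfa N (some (some a)) _ (fun w => Iff.rfl), fun n x y hx hy => key n x y _ hx hy⟩

/-- Prefixing the components of a relation. -/
theorem Auto.pre {β : Type} [Finite β] {E : List β → List β → Prop} (h : Auto E) (s t : List β) :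
    Auto (fun x y => ∃ x' y', x = s ++ x' ∧ y = t ++ y' ∧ E x' y') := by
  have h1 : Auto (fun x y => ∃ y', y = t ++ y' ∧ E x y') := by
    induction t with
    | nil => simpa using h
    | cons a t ih =>
      refine (ih.comp (Auto.shift a)).congr fun x y => ?_
      constructor
      · rintro ⟨_, ⟨y', rfl, hE⟩, rfl⟩
        exact ⟨y', rfl, hE⟩
      · rintro ⟨y', rfl, hE⟩
        exact ⟨_, ⟨y', rfl, hE⟩, rfl⟩
  induction s with
  | nil => simpa using h1
  | cons a s ih =>
    refine ((Auto.shift a).swap.comp ih).congr fun x y => ?_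
    constructor
    · rintro ⟨_, rfl, x', y', rfl, rfl, hE⟩
      exact ⟨x', y', rfl, rfl, hE⟩
    · rintro ⟨x', y', rfl, rfl, hE⟩
      exact ⟨_, rfl, x', y', rfl, rfl, hE⟩

/-- Pairs of words obtained by concatenating pairs in `P`. -/
inductive PS {β : Type} (P : List (List β × List β)) : List β → List β → Prop
  | nil : PS P [] []
  | step {p q x y} : (p, q) ∈ P → PS P x y → PS P (p ++ x) (q ++ y)

theorem PS.append {β : Type} {P : List (List β × List β)} {x y x' y' : List β}
    (h : PS P x y) (h' : PS P x' y') : PS P (x ++ x') (y ++ y') := by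
  induction h with
  | nil => exact h'
  | step hp _ ih => simp only [List.append_assoc]; exact .step hp ih

/-- Reverse both components of all pairs. -/
def revP {β : Type} (P : List (List β × List β)) : List (List β × List β) :=
  P.map fun p => (p.1.reverse, p.2.reverse)

theorem mem_revP {β : Type} {P : List (List β × List β)} {p q : List β} :
    (p, q) ∈ revP P ↔ (p.reverse, q.reverse) ∈ P := by
  simp only [revP, List.mem_map, Prod.mk.injEq, Prod.exists]
  constructor
  · rintro ⟨a, b, h, rfl, rfl⟩; simpa using h
  · intro h; exact ⟨_, _, h, by simp, by simp⟩

theorem revP_revP {β : Type} (P : List (List β × List β)) : revP (revP P) = P := by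
  simp [revP, Function.comp_def]

theorem PS.rev {β : Type} {P : List (List β × List β)} {x y : List β} (h : PS P x y) :
    PS (revP P) x.reverse y.reverse := by
  induction h with
  | nil => exact .nil
  | @step p q x y hp _ ih =>
    simp only [List.reverse_append]
    refine ih.append ?_
    have : PS (revP P) (p.reverse ++ []) (q.reverse ++ []) := .step (by simpa [mem_revP] using hp) .nil
    simpa using this

theorem cv_append {β : Type} (p q : List β) (h : p.length = q.length) (x y : List β) (n : ℕ) :
    cv (p.length + n) (p ++ x) (q ++ y) = (p.zip q).map (fun c => (some c.1, some c.2)) ++ cv n x y := by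
  induction p generalizing q with
  | nil =>
    obtain rfl : q = [] := List.eq_nil_of_length_eq_zero (by simpa using h.symm)
    simp
  | cons a p ih =>
    cases q with
    | nil => simp at h
    | cons b q =>
      have : (a :: p).length + n = (p.length + n) + 1 := by simp; omega
      rw [this]
      simp only [cv, List.cons_append, List.head?_cons, List.tail_cons, List.zip_cons_cons, List.map_cons]
      rw [ih q (by simpa using h)]

theorem cv_eq_append {β : Type} (p q : List β) (h : p.length = q.length) (x y : List β) (n : ℕ)
    (w : List (Option β × Option β))
    (e : cv n x y = (p.zip q).map (fun c => (some c.1, some c.2)) ++ w) :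
    ∃ x' y' m, x = p ++ x' ∧ y = q ++ y' ∧ n = p.length + m ∧ w = cv m x' y' := by
  induction p generalizing q x y n with
  | nil =>
    obtain rfl : q = [] := List.eq_nil_of_length_eq_zero (by simpa using h.symm)
    exact ⟨x, y, n, rfl, rfl, by simp, by simpa using e.symm⟩
  | cons a p ih =>
    cases q with
    | nil => simp at h
    | cons b q =>
      cases n with
      | zero => simp [cv] at e
      | succ n =>
        cases x with
        | nil => simp [cv] at e
        | cons c x =>
          cases y with
          | nil => simp [cv] at e
          | cons d y =>
            simp only [cv, List.head?_cons, List.tail_cons, List.zip_cons_cons, List.map_cons,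
              List.cons_append, List.cons.injEq, Prod.mk.injEq, Option.some.injEq] at e
            obtain ⟨⟨rfl, rfl⟩, e⟩ := e
            obtain ⟨x', y', m, rfl, rfl, rfl, hw⟩ := ih q (by simpa using h) x y n e
            exact ⟨x', y', m, rfl, rfl, by simp; omega, hw⟩

theorem Auto.star {β : Type} {E : List β → List β → Prop} (h : Auto E)
    (P : List (List β × List β)) (hP : ∀ p ∈ P, p.1.length = p.2.length ∧ p.1 ≠ []) :
    Auto (fun x y => ∃ p q x' y', PS P p q ∧ x = p ++ x' ∧ y = q ++ y' ∧ E x' y') := by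
  obtain ⟨K, hK, e⟩ := h
  let W : List (List (Option β × Option β)) :=
    P.map fun p => (p.1.zip p.2).map (fun c => (some c.1, some c.2))
  refine ⟨_, hK.star (W := W) ?_, fun n x y hx hy => ?_⟩
  · intro w hw
    simp only [W, List.mem_map] at hw
    obtain ⟨⟨p, q⟩, hp, rfl⟩ := hw
    obtain ⟨h1, h2⟩ := hP _ hp
    cases p with
    | nil => simp at h2
    | cons a p => cases q with
      | nil => simp at h1
      | cons b q => simp
  · constructor
    · intro hs
      generalize hw : cv n x y = w at hs
      induction hs generalizing n x y with
      | base hk => subst hw; exact ⟨[], [], x, y, .nil, rfl, rfl, (e n x y hx hy).1 hk⟩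
      | step hw' _ ih =>
        simp only [W, List.mem_map] at hw'
        obtain ⟨⟨p, q⟩, hp, rfl⟩ := hw'
        obtain ⟨x', y', m, rfl, rfl, rfl, rfl⟩ := cv_eq_append p q (hP _ hp).1 _ _ _ _ hw
        have hpq := (hP _ hp).1
        simp only [List.length_append] at hx hy hpq
        obtain ⟨p', q', x'', y'', hps, rfl, rfl, hE⟩ := ih m x' y' (by omega) (by omega) rfl
        exact ⟨p ++ p', q ++ q', x'', y'', .step hp hps, by simp, by simp, hE⟩
    · rintro ⟨p, q, x', y', hps, rfl, rfl, hE⟩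
      induction hps generalizing n with
      | nil => exact .base ((e _ _ _ (by simpa using hx) (by simpa using hy)).2 hE)
      | @step p q x y hp _ ih =>
        have hpq := (hP _ hp).1
        simp only [List.length_append] at hx hy hpq
        obtain ⟨m, rfl⟩ : ∃ m, n = p.length + m := ⟨n - p.length, by omega⟩
        simp only [List.append_assoc]
        rw [cv_append _ _ hpq]
        refine .step ?_ (ih m (by simp; omega) (by simp; omega))
        simp only [W, List.mem_map]
        exact ⟨_, hp, rfl⟩

/-- The diagonal pairs of letters. -/
noncomputable def diagP (β : Type) [Fintype β] : List (List β × List β) :=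
  (Finset.univ : Finset β).toList.map fun a => ([a], [a])

theorem ps_diag {β : Type} [Fintype β] {x y : List β} : PS (diagP β) x y ↔ x = y := by
  constructor
  · intro h
    induction h with
    | nil => rfl
    | step hp _ ih =>
      simp only [diagP, List.mem_map, Prod.mk.injEq] at hp
      obtain ⟨a, -, rfl, rfl⟩ := hp
      rw [ih]
  · rintro rfl
    induction x with
    | nil => exact .nil
    | cons a x ih => exact .step (p := [a]) (q := [a]) (by simp [diagP]) ih

/-- Common prefixes. -/
theorem Auto.diag {β : Type} [Fintype β] {E : List β → List β → Prop} (h : Auto E) :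
    Auto (fun x y => ∃ z x' y', x = z ++ x' ∧ y = z ++ y' ∧ E x' y') := by
  refine (h.star (diagP β) ?_).congr fun x y => ?_
  · simp only [diagP, List.mem_map]
    rintro p ⟨a, -, rfl⟩
    simp
  · constructor
    · rintro ⟨p, q, x', y', h, rfl, rfl, hE⟩
      obtain rfl := ps_diag.1 h
      exact ⟨p, x', y', rfl, rfl, hE⟩
    · rintro ⟨z, x', y', rfl, rfl, hE⟩
      exact ⟨z, z, x', y', ps_diag.2 rfl, rfl, rfl, hE⟩

theorem Auto.eq {β : Type} [Fintype β] : Auto (fun x y : List β => x = y) :=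
  (Auto.nil.diag).congr fun x y => by
    constructor
    · rintro ⟨z, _, _, rfl, rfl, rfl, rfl⟩; rfl
    · rintro rfl; exact ⟨x, [], [], by simp, by simp, rfl, rfl⟩

/-- The cascade families of pairs: a top in `T`, repeated middle parts in `P`,
a bottom in `B`, and a common rest. -/
def Fam {β : Type} (T P B : List (List β × List β)) (x y : List β) : Prop :=
  ∃ s t p q b c z, (s, t) ∈ T ∧ PS P p q ∧ (b, c) ∈ B ∧
    x = s ++ (p ++ (b ++ z)) ∧ y = t ++ (q ++ (c ++ z))

theorem Auto.preList {β : Type} [Finite β] {E : List β → List β → Prop} (h : Auto E)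
    (T : List (List β × List β)) :
    Auto (fun x y => ∃ t ∈ T, ∃ x' y', x = t.1 ++ x' ∧ y = t.2 ++ y' ∧ E x' y') :=
  Auto.exList T _ fun t _ => h.pre t.1 t.2

theorem Auto.fam {β : Type} [Fintype β] (T P B : List (List β × List β))
    (hP : ∀ p ∈ P, p.1.length = p.2.length ∧ p.1 ≠ []) : Auto (Fam T P B) := by
  refine (((Auto.eq.preList B).star P hP).preList T).congr fun x y => ?_
  constructor
  · rintro ⟨⟨s, t⟩, ht, _, _, rfl, rfl, p, q, _, _, hps, rfl, rfl, ⟨b, c⟩, hb, z, _, rfl, rfl, rfl⟩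
    exact ⟨s, t, p, q, b, c, z, ht, hps, hb, rfl, rfl⟩
  · rintro ⟨s, t, p, q, b, c, z, ht, hps, hb, rfl, rfl⟩
    exact ⟨(s, t), ht, _, _, rfl, rfl, p, q, _, _, hps, rfl, rfl, (b, c), hb, z, z, rfl, rfl, rfl⟩

theorem Auto.famRev {β : Type} [Fintype β] (T P B : List (List β × List β))
    (hP : ∀ p ∈ P, p.1.length = p.2.length ∧ p.1 ≠ []) :
    Auto (fun x y => Fam T P B x.reverse y.reverse) := by
  refine ((((Auto.nil.preList (revP T)).star (revP P) ?_).preList (revP B)).diag).congr fun x y => ?_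
  · rintro ⟨p, q⟩ h
    rw [mem_revP] at h
    simpa using hP _ h
  constructor
  · rintro ⟨z, _, _, rfl, rfl, ⟨b, c⟩, hb, _, _, rfl, rfl, p, q, _, _, hps, rfl, rfl, ⟨s, t⟩, ht,
      _, _, rfl, rfl, rfl, rfl⟩
    rw [mem_revP] at hb ht
    have := hps.rev
    rw [revP_revP] at this
    exact ⟨_, _, _, _, _, _, z.reverse, ht, this, hb, by simp, by simp⟩
  · rintro ⟨s, t, p, q, b, c, z, ht, hps, hb, hx, hy⟩
    rw [List.reverse_eq_iff] at hx hy
    subst hx hy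
    refine ⟨z.reverse, _, _, by simp; rfl, by simp; rfl, (b.reverse, c.reverse), ?_, _, _, rfl, rfl,
      p.reverse, q.reverse, _, _, hps.rev, rfl, rfl, (s.reverse, t.reverse), ?_, [], [],
      by simp, by simp, rfl, rfl⟩
    · simpa [mem_revP] using hb
    · simpa [mem_revP] using ht

/-- The cascade families where the middle parts are erased. -/
theorem Auto.famRev' {β : Type} [Fintype β] (T P B : List (List β × List β))
    (hP : ∀ p ∈ P, p.2 = [] ∧ p.1 ≠ []) :
    Auto (fun x y => Fam T P B x.reverse y.reverse) := by
  have key : ∀ s t : List β, Auto (fun x y => ∃ p q, PS (revP P) p q ∧ x = p ++ s ∧ y = q ++ t) := by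
    intro s t
    refine ((Auto.fst ((Reg.single s).star (W := (revP P).map Prod.fst) ?_)).and
      (Auto.snd (Reg.single t))).congr fun x y => ?_
    · simp only [revP, List.map_map, List.mem_map]
      rintro _ ⟨p, hp, rfl⟩
      simpa using (hP _ hp).2
    · constructor
      · rintro ⟨h, rfl⟩
        induction h with
        | base h => exact ⟨[], [], .nil, by simpa using h, by simp⟩
        | step hw _ ih =>
          obtain ⟨p, q, hps, rfl, hq⟩ := ih
          simp only [List.mem_map, Prod.exists] at hw
          obtain ⟨p', q', hpq, rfl⟩ := hw
          have h0 := mem_revP.1 hpq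
          have h1 : q' = [] := by simpa using (hP _ h0).1
          subst h1
          exact ⟨p' ++ p, q, .step (q := []) hpq hps, by simp, hq⟩
      · rintro ⟨p, q, hps, rfl, rfl⟩
        induction hps with
        | nil => exact ⟨.base (by simp), by simp⟩
        | @step p q x y hpq _ ih =>
          have h0 := mem_revP.1 hpq
          have h1 : q = [] := by simpa using (hP _ h0).1
          subst h1
          refine ⟨?_, by simpa using ih.2⟩
          rw [List.append_assoc]
          exact .step (List.mem_map.2 ⟨_, hpq, rfl⟩) ih.1
  refine (((Auto.exList (revP T) _ fun t _ => key t.1 t.2).preList (revP B)).diag).congr fun x y => ?_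
  constructor
  · rintro ⟨z, _, _, rfl, rfl, ⟨b, c⟩, hb, _, _, rfl, rfl, ⟨s, t⟩, ht, p, q, hps, rfl, rfl⟩
    rw [mem_revP] at hb ht
    have := hps.rev
    rw [revP_revP] at this
    exact ⟨_, _, _, _, _, _, z.reverse, ht, this, hb, by simp, by simp⟩
  · rintro ⟨s, t, p, q, b, c, z, ht, hps, hb, hx, hy⟩
    rw [List.reverse_eq_iff] at hx hy
    subst hx hy
    refine ⟨z.reverse, _, _, by simp; rfl, by simp; rfl, (b.reverse, c.reverse), ?_, _, _, rfl, rfl,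
      (s.reverse, t.reverse), ?_, p.reverse, q.reverse, hps.rev, by simp, by simp⟩
    · simpa [mem_revP] using hb
    · simpa [mem_revP] using ht

/-! ### Padded convolutions -/

theorem padR_eq_cv {β : Type} (x y : List β) : padR x y = cv (max x.length y.length) x y := by
  induction x generalizing y with
  | nil =>
    simp only [padR, List.length_nil]
    rw [Nat.max_eq_right (by omega), cv_nil_left]
    induction y with
    | nil => rfl
    | cons b y ih => simpa [List.replicate_succ] using ih
  | cons a x ih =>
    cases y with
    | nil =>
      rw [Nat.max_eq_left (by simp), cv_nil_right]
      clear ih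
      simp only [padR]
      induction (a :: x) with
      | nil => rfl
      | cons b y ih => simpa [List.replicate_succ] using ih
    | cons b y =>
      have h : max (a :: x).length (b :: y).length = max x.length y.length + 1 := by
        simp
      rw [h]
      simp only [cv, List.head?_cons, List.tail_cons]
      rw [← ih y]
      simp [padR]

theorem padL_eq {β : Type} (x y : List β) : padL x y = (padR x.reverse y.reverse).reverse := by
  simp only [padL, padR]
  unfold List.zip
  rw [List.reverse_zipWith]
  · simp
  · simp; omega

theorem reg_valid {β : Type} : Reg (fun p => ∃ x y : List β, p = padR x y) := by
  have hl : ∀ (a : β) x, padR (a :: x) [] = (some a, none) :: padR x [] := by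
    intro a x; simp [padR, List.replicate_succ]
  have hr : ∀ (a : β) x, padR [] (a :: x) = (none, some a) :: padR [] x := by
    intro a x; simp [padR, List.replicate_succ]
  have hb : ∀ (a b : β) x y, padR (a :: x) (b :: y) = (some a, some b) :: padR x y := by
    intro a b x y; simp [padR]
  let K : Fin 3 → List (Option β × Option β) → Prop := fun i w => match i with
    | 0 => ∃ x y : List β, w = padR x y
    | 1 => ∃ x : List β, w = padR x []
    | 2 => ∃ x : List β, w = padR [] x
  refine Reg.system K (fun i p j =>
    (i = 0 ∧ j = 0 ∧ ∃ a b, p = (some a, some b)) ∨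
    (i ≠ 2 ∧ j = 1 ∧ ∃ a, p = (some a, none)) ∨
    (i ≠ 1 ∧ j = 2 ∧ ∃ a, p = (none, some a))) ?_ 0
  intro i p w
  constructor
  · intro h
    match i, h with
    | 0, h =>
      obtain ⟨x, y, h⟩ := h
      rcases x with _ | ⟨a, x⟩ <;> rcases y with _ | ⟨b, y⟩
      · simp [padR] at h
      · rw [hr, List.cons.injEq] at h
        exact ⟨2, Or.inr (Or.inr ⟨by simp, rfl, b, h.1⟩), y, h.2⟩
      · rw [hl, List.cons.injEq] at h
        exact ⟨1, Or.inr (Or.inl ⟨by simp, rfl, a, h.1⟩), x, h.2⟩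
      · rw [hb, List.cons.injEq] at h
        exact ⟨0, Or.inl ⟨rfl, rfl, a, b, h.1⟩, x, y, h.2⟩
    | 1, h =>
      obtain ⟨x, h⟩ := h
      rcases x with _ | ⟨a, x⟩
      · simp [padR] at h
      · rw [hl, List.cons.injEq] at h
        exact ⟨1, Or.inr (Or.inl ⟨by simp, rfl, a, h.1⟩), x, h.2⟩
    | 2, h =>
      obtain ⟨y, h⟩ := h
      rcases y with _ | ⟨b, y⟩
      · simp [padR] at h
      · rw [hr, List.cons.injEq] at h
        exact ⟨2, Or.inr (Or.inr ⟨by simp, rfl, b, h.1⟩), y, h.2⟩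
  · rintro ⟨j, ⟨rfl, rfl, a, b, rfl⟩ | ⟨hi, rfl, a, rfl⟩ | ⟨hi, rfl, a, rfl⟩, h⟩
    · obtain ⟨x, y, rfl⟩ := h
      exact ⟨a :: x, b :: y, (hb _ _ _ _).symm⟩
    · obtain ⟨x, rfl⟩ := h
      match i, hi with
      | 0, _ => exact ⟨a :: x, [], (hl _ _).symm⟩
      | 1, _ => exact ⟨a :: x, (hl _ _).symm⟩
      | 2, h => exact absurd rfl h
    · obtain ⟨x, rfl⟩ := h
      match i, hi with
      | 0, _ => exact ⟨[], a :: x, (hr _ _).symm⟩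
      | 1, h => exact absurd rfl h
      | 2, _ => exact ⟨a :: x, (hr _ _).symm⟩

theorem Auto.padR {β : Type} {E : List β → List β → Prop} (h : Auto E) :
    IsReg {p | ∃ x y, E x y ∧ p = padR x y} := by
  obtain ⟨K, hK, e⟩ := h
  refine (reg_valid.and hK).congr fun p => ?_
  constructor
  · rintro ⟨⟨x, y, rfl⟩, h⟩
    refine ⟨x, y, ?_, rfl⟩
    rw [padR_eq_cv] at h
    exact (e _ x y (by omega) (by omega)).1 h
  · rintro ⟨x, y, h, rfl⟩
    refine ⟨⟨x, y, rfl⟩, ?_⟩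
    rw [padR_eq_cv]
    exact (e _ x y (by omega) (by omega)).2 h

theorem Auto.padL {β : Type} {E : List β → List β → Prop}
    (h : Auto (fun x y => E x.reverse y.reverse)) :
    IsReg {p | ∃ x y, E x y ∧ p = padL x y} := by
  refine (Reg.reverse h.padR).congr fun p => ?_
  constructor
  · rintro ⟨x, y, h, h'⟩
    refine ⟨_, _, h, ?_⟩
    rw [padL_eq, List.reverse_reverse, List.reverse_reverse, ← h', List.reverse_reverse]
  · rintro ⟨x, y, h, rfl⟩
    refine ⟨x.reverse, y.reverse, by simpa using h, ?_⟩
    rw [padL_eq, List.reverse_reverse]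

/-- Automatic in both reading directions. -/
def Auto2 {β : Type} (E : List β → List β → Prop) : Prop :=
  Auto E ∧ Auto (fun x y => E x.reverse y.reverse)

theorem Auto2.comp {β : Type} {E F : List β → List β → Prop} (h : Auto2 E) (h' : Auto2 F) :
    Auto2 (fun x z => ∃ y, E x y ∧ F y z) :=
  ⟨h.1.comp h'.1, (h.2.comp h'.2).congr fun x y =>
    ⟨fun ⟨z, hz⟩ => ⟨z.reverse, hz⟩, fun ⟨z, hz⟩ => ⟨z.reverse, by simpa using hz⟩⟩⟩

theorem Auto2.or {β : Type} {E F : List β → List β → Prop} (h : Auto2 E) (h' : Auto2 F) :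
    Auto2 (fun x y => E x y ∨ F x y) := ⟨h.1.or h'.1, h.2.or h'.2⟩

theorem Auto2.eq {β : Type} [Fintype β] : Auto2 (fun x y : List β => x = y) :=
  ⟨Auto.eq, Auto.eq.congr fun x y => by simp⟩

theorem Auto2.fam {β : Type} [Fintype β] (T P B : List (List β × List β))
    (hP : ∀ p ∈ P, p.1.length = p.2.length ∧ p.1 ≠ []) : Auto2 (Fam T P B) :=
  ⟨Auto.fam T P B hP, Auto.famRev T P B hP⟩

theorem Auto2.rev {β : Type} {E : List β → List β → Prop} (h : Auto2 E) :
    Auto2 (fun x y => E x.reverse y.reverse) :=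
  ⟨h.2, h.1.congr fun x y => by simp⟩

theorem Auto2.restrict {β : Type} {E : List β → List β → Prop} (h : Auto2 E)
    {L : List β → Prop} (hL : Reg L) : Auto2 (fun x y => E x y ∧ L x ∧ L y) :=
  ⟨h.1.and ((Auto.fst hL).and (Auto.snd hL)),
    h.2.and ((Auto.fst hL.reverse).and (Auto.snd hL.reverse))⟩

/-! ### Adding an identity letter in front of words -/

/-- A word with an additional letter `none` in front. -/
def lft {β : Type} (x : List β) : List (Option β) := none :: x.map some

theorem lft_inj {β : Type} {x y : List β} (h : lft x = lft y) : x = y := by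
  simp only [lft, List.cons.injEq, true_and] at h
  exact (List.map_injective_iff.2 (Option.some_injective β)) h

/-- Remove `none` letters. -/
def unl {β : Type} (x : List (Option β)) : List β := x.reduceOption

theorem unl_map {β : Type} (x : List β) : unl (x.map some) = x := by
  induction x with
  | nil => rfl
  | cons a x ih => simpa [unl] using ih

theorem exists_map_some {β : Type} {x : List (Option β)} (h : none ∉ x) : ∃ y : List β, x = y.map some := by
  induction x with
  | nil => exact ⟨[], rfl⟩
  | cons a x ih =>
    simp only [List.mem_cons, not_or] at h
    obtain ⟨y, rfl⟩ := ih h.2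
    cases a with
    | none => simp at h
    | some a => exact ⟨a :: y, rfl⟩

theorem cv_map_some {β : Type} (n : ℕ) (x y : List β) :
    (cv n (x.map some) (y.map some)).map (fun p => (p.1.join, p.2.join)) = cv n x y := by
  induction n generalizing x y with
  | zero => rfl
  | succ n ih =>
    simp only [cv, List.map_cons, ← List.map_tail, ih]
    cases x <;> cases y <;> rfl

theorem reg_no_none {β : Type} : Reg (fun x : List (Option β) => none ∉ x) := by
  refine Reg.system (ι := Unit) (fun _ x => none ∉ x) (fun _ a _ => a ≠ none) ?_ ()
  intro _ a w
  simp [eq_comm]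

theorem Auto.map_some {β : Type} {E : List β → List β → Prop} (h : Auto E) :
    Auto (fun x' y' : List (Option β) => ∃ x y, x' = x.map some ∧ y' = y.map some ∧ E x y) := by
  have h1 : Auto (fun x' y' : List (Option β) => (none ∉ x' ∧ none ∉ y') →
      ∃ x y, x' = x.map some ∧ y' = y.map some ∧ E x y) := by
    obtain ⟨K, hK, e⟩ := h
    have ha : Auto (fun x' y' : List (Option β) => none ∉ x' ∧ none ∉ y') :=
      (Auto.fst reg_no_none).and (Auto.snd reg_no_none)
    obtain ⟨K', hK', e'⟩ := ha
    refine ⟨_, hK'.not.or (hK.comap fun p : Option (Option β) × Option (Option β) =>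
      (p.1.join, p.2.join)), fun n x y hx hy => ?_⟩
    rw [e' n x y hx hy]
    by_cases hn : none ∉ x ∧ none ∉ y
    · obtain ⟨x, rfl⟩ := exists_map_some hn.1
      obtain ⟨y, rfl⟩ := exists_map_some hn.2
      rw [cv_map_some, e n x y (by simpa using hx) (by simpa using hy)]
      constructor
      · rintro (h | h) _
        · exact absurd hn h
        · exact ⟨x, y, rfl, rfl, h⟩
      · intro h
        obtain ⟨x1, y1, hx1, hy1, hE⟩ := h hn
        have i := List.map_injective_iff.2 (Option.some_injective β)
        rw [i hx1, i hy1]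
        exact Or.inr hE
    · simp only [hn, not_false_eq_true, true_or, false_imp_iff]
  refine (h1.and ((Auto.fst reg_no_none).and (Auto.snd reg_no_none))).congr fun x y => ?_
  constructor
  · rintro ⟨h, h'⟩; exact h h'
  · rintro ⟨x, y, rfl, rfl, h⟩
    exact ⟨fun _ => ⟨x, y, rfl, rfl, h⟩, by simp⟩

theorem Auto.lft {β : Type} [Fintype β] {E : List β → List β → Prop} (h : Auto E) :
    Auto (fun x' y' : List (Option β) => ∃ x y, x' = lft x ∧ y' = lft y ∧ E x y) := by
  refine (h.map_some.pre [none] [none]).congr fun x' y' => ?_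
  constructor
  · rintro ⟨_, _, rfl, rfl, x, y, rfl, rfl, h⟩
    exact ⟨x, y, rfl, rfl, h⟩
  · rintro ⟨x, y, rfl, rfl, h⟩
    exact ⟨_, _, rfl, rfl, x, y, rfl, rfl, h⟩

theorem Auto.snoc {β : Type} [Fintype β] (a : β) : Auto (fun x y => y = x ++ [a]) := by
  refine ((Auto.nil.pre [] [a]).diag).congr fun x y => ?_
  constructor
  · rintro ⟨z, _, _, rfl, rfl, _, _, rfl, rfl, rfl, rfl⟩
    simp
  · rintro rfl
    exact ⟨x, [], [a], by simp, rfl, [], [], rfl, rfl, rfl, rfl⟩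

theorem Auto2.lft {β : Type} [Fintype β] {E : List β → List β → Prop} (h : Auto2 E) :
    Auto2 (fun x' y' : List (Option β) => ∃ x y, x' = lft x ∧ y' = lft y ∧ E x y) := by
  refine ⟨h.1.lft, ((Auto.snoc none).swap.comp (h.2.map_some.comp (Auto.snoc none))).congr
    fun x' y' => ?_⟩
  constructor
  · rintro ⟨_, rfl, _, ⟨x, y, rfl, rfl, h⟩, rfl⟩
    exact ⟨_, _, by simp [_root_.lft], by simp [_root_.lft], h⟩
  · rintro ⟨x, y, hx, hy, h⟩
    rw [List.reverse_eq_iff] at hx hy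
    subst hx hy
    exact ⟨x.reverse.map some, by simp [_root_.lft], y.reverse.map some,
      ⟨x.reverse, y.reverse, rfl, rfl, by simpa using h⟩, by simp [_root_.lft]⟩

/-! ### Equality of words -/

theorem WordEq.refl {α : Type} {R : Set (List α × List α)} (x : List α) : WordEq R x x :=
  Relation.EqvGen.refl x

theorem WordEq.symm {α : Type} {R : Set (List α × List α)} {x y : List α} (h : WordEq R x y) :
    WordEq R y x := Relation.EqvGen.symm _ _ h

theorem WordEq.trans {α : Type} {R : Set (List α × List α)} {x y z : List α} (h : WordEq R x y)
    (h' : WordEq R y z) : WordEq R x z := Relation.EqvGen.trans _ _ _ h h'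

theorem WordEq.ctx {α : Type} {R : Set (List α × List α)} {x y : List α} (h : WordEq R x y)
    (p s : List α) : WordEq R (p ++ x ++ s) (p ++ y ++ s) := by
  induction h with
  | rel x y h =>
    obtain ⟨p', u, v, s', hR, rfl, rfl⟩ := h
    exact Relation.EqvGen.rel _ _ ⟨p ++ p', u, v, s' ++ s, hR, by simp, by simp⟩
  | refl => exact .refl _
  | symm _ _ _ ih => exact .symm ih
  | trans _ _ _ _ _ ih ih' => exact .trans ih ih'

theorem WordEq.append {α : Type} {R : Set (List α × List α)} {x y x' y' : List α}
    (h : WordEq R x y) (h' : WordEq R x' y') : WordEq R (x ++ x') (y ++ y') := by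
  have h1 := h.ctx [] x'
  have h2 := h'.ctx y []
  simp only [List.nil_append, List.append_nil] at h1 h2
  exact h1.trans h2

theorem WordEq.of_mem {α : Type} {R : Set (List α × List α)} {x y : List α} (h : (x, y) ∈ R) :
    WordEq R x y := Relation.EqvGen.rel _ _ ⟨[], x, y, [], h, by simp, by simp⟩

/-- `WordEq` maps into any relation that respects the rewriting steps. -/
theorem WordEq.lift {α : Type} {γ : Type*} {R : Set (List α × List α)} (f : List α → γ)
    (hf : ∀ p s u v, (u, v) ∈ R → f (p ++ u ++ s) = f (p ++ v ++ s)) {x y : List α}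
    (h : WordEq R x y) : f x = f y := by
  induction h with
  | rel x y h =>
    obtain ⟨p, u, v, s, hR, rfl, rfl⟩ := h
    exact hf p s u v hR
  | refl => rfl
  | symm _ _ _ ih => exact ih.symm
  | trans _ _ _ _ _ ih ih' => exact ih.trans ih'

/-! ### Criteria for prefix-automaticity and biautomaticity -/

/-- `E` computes the map `f` on words of `L`. -/
structure Good {α β : Type} (R : Set (List α × List α)) (g : β → List α) (L : List β → Prop)
    (f : List α → List α) (E : List β → List β → Prop) : Prop where
  sound : ∀ x y, E x y → WordEq R (f (expandW g x)) (expandW g y)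
  cover : ∀ x, L x → ∃ y, L y ∧ E x y

theorem Good.eq {α β : Type} {R : Set (List α × List α)} {g : β → List α} {L : List β → Prop} :
    Good R g L id (fun x y => x = y) :=
  ⟨fun _ _ h => h ▸ .refl _, fun x hx => ⟨x, hx, rfl⟩⟩

theorem Good.comp {α β : Type} {R : Set (List α × List α)} {g : β → List α} {L : List β → Prop}
    {f f' : List α → List α} {E E' : List β → List β → Prop} (h : Good R g L f E)
    (h' : Good R g L f' E') (hf : ∀ x y, WordEq R x y → WordEq R (f' x) (f' y)) :
    Good R g L (fun x => f' (f x)) (fun x z => ∃ y, E x y ∧ E' y z) := by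
  refine ⟨?_, ?_⟩
  · rintro x z ⟨y, h1, h2⟩
    exact (hf _ _ (h.sound _ _ h1)).trans (h'.sound _ _ h2)
  · intro x hx
    obtain ⟨y, hy, h1⟩ := h.cover x hx
    obtain ⟨z, hz, h2⟩ := h'.cover y hy
    exact ⟨z, hz, y, h1, h2⟩

theorem good_right_word {α β : Type} {R : Set (List α × List α)} {g : β → List α}
    {L : List β → Prop} {Q : (List β → List β → Prop) → Prop} (hQ0 : Q (fun x y => x = y))
    (hQc : ∀ E F, Q E → Q F → Q (fun x z => ∃ y, E x y ∧ F y z))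
    (h : ∀ a : α, ∃ E, Q E ∧ Good R g L (fun x => x ++ [a]) E) (w : List α) :
    ∃ E, Q E ∧ Good R g L (fun x => x ++ w) E := by
  induction w using List.reverseRecOn with
  | nil => exact ⟨_, hQ0, by simp only [List.append_nil, List.nil_append]; exact Good.eq⟩
  | append_singleton w a ih =>
    obtain ⟨E, hE, gE⟩ := ih
    obtain ⟨F, hF, gF⟩ := h a
    exact ⟨_, hQc _ _ hE hF, by simpa using gE.comp gF fun x y h => h.append (.refl _)⟩

theorem good_left_word {α β : Type} {R : Set (List α × List α)} {g : β → List α}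
    {L : List β → Prop} {Q : (List β → List β → Prop) → Prop} (hQ0 : Q (fun x y => x = y))
    (hQc : ∀ E F, Q E → Q F → Q (fun x z => ∃ y, E x y ∧ F y z))
    (h : ∀ a : α, ∃ E, Q E ∧ Good R g L (fun x => a :: x) E) (w : List α) :
    ∃ E, Q E ∧ Good R g L (fun x => w ++ x) E := by
  induction w with
  | nil => exact ⟨_, hQ0, by simp only [List.append_nil, List.nil_append]; exact Good.eq⟩
  | cons a w ih =>
    obtain ⟨E, hE, gE⟩ := ih
    obtain ⟨F, hF, gF⟩ := h a
    exact ⟨_, hQc _ _ hE hF, by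
      simpa using gE.comp gF fun x y h => WordEq.append (x := [a]) (y := [a]) (.refl _) h⟩

/-- Unique normal forms. -/
structure UNF {α β : Type} (R : Set (List α × List α)) (g : β → List α) (L : List β → Prop) :
    Prop where
  reg : Reg L
  nil : L []
  pre : ∀ x y, L (x ++ y) → L x
  uniq : ∀ x y, L x → L y → WordEq R (expandW g x) (expandW g y) → x = y
  onto : ∀ w : List α, ∃ x, L x ∧ WordEq R (expandW g x) w

/-- The generators together with an identity generator. -/
def gO {α β : Type} (g : β → List α) : Option β → List α
  | none => []
  | some b => g b

theorem expand_lft {α β : Type} (g : β → List α) (x : List β) :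
    expandW (gO g) (lft x) = expandW g x := by
  simp [expandW, lft, gO, Function.comp_def]

theorem UNF.char {α β : Type} {R : Set (List α × List α)} {g : β → List α}
    {L : List β → Prop} (hU : UNF R g L) {f : List α → List α} {E : List β → List β → Prop}
    (h : Good R g L f E) (D : List (Option β) → List (Option β) → List (Option (Option β) × Option (Option β))) :
    {p | ∃ x ∈ {z | ∃ w, L w ∧ z = lft w}, ∃ y ∈ {z | ∃ w, L w ∧ z = lft w},
      WordEq R (f (expandW (gO g) x)) (expandW (gO g) y) ∧ p = D x y} =
    {p | ∃ x' y', (∃ x y, x' = lft x ∧ y' = lft y ∧ E x y ∧ L x ∧ L y) ∧ p = D x' y'} := by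
  ext p
  constructor
  · rintro ⟨_, ⟨x, hx, rfl⟩, _, ⟨y, hy, rfl⟩, h1, rfl⟩
    refine ⟨_, _, ⟨x, y, rfl, rfl, ?_, hx, hy⟩, rfl⟩
    rw [expand_lft, expand_lft] at h1
    obtain ⟨z, hz, hE⟩ := h.cover x hx
    obtain rfl := hU.uniq z y hz hy ((h.sound _ _ hE).symm.trans h1)
    exact hE
  · rintro ⟨_, _, ⟨x, y, rfl, rfl, hE, hx, hy⟩, rfl⟩
    refine ⟨_, ⟨x, hx, rfl⟩, _, ⟨y, hy, rfl⟩, ?_, rfl⟩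
    rw [expand_lft, expand_lft]
    exact h.sound _ _ hE

theorem reg_lft {β : Type} [Fintype β] {L : List β → Prop} (h : Reg L) :
    Reg (fun z => ∃ w, L w ∧ z = lft w) := by
  have h1 : Reg (fun z : List (Option β) => L (unl z)) := by
    obtain ⟨τ, i, M, hM⟩ := h.exists_dfa
    let N : DFA (Option β) τ :=
      ⟨fun s p => match p with | none => s | some a => M.step s a, M.start, M.accept⟩
    refine Reg.of_dfa N M.start _ fun w => ?_
    rw [← hM]
    have : ∀ w s, N.evalFrom s w = M.evalFrom s (unl w) := by
      intro w
      induction w with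
      | nil => intro s; rfl
      | cons a w ih =>
        intro s
        cases a with
        | none => exact ih s
        | some a => exact ih (M.step s a)
    rw [this]; rfl
  refine ((h1.and reg_no_none).pre [none]).congr fun z => ?_
  constructor
  · rintro ⟨y, rfl, h, hn⟩
    obtain ⟨x, rfl⟩ := exists_map_some hn
    rw [unl_map] at h
    exact ⟨x, h, rfl⟩
  · rintro ⟨w, hw, rfl⟩
    exact ⟨w.map some, rfl, by rwa [unl_map], by simp⟩

theorem UNF.prefixAutomatic {α β : Type} [Fintype β] {R : Set (List α × List α)} {g : β → List α}
    {L : List β → Prop} (hU : UNF R g L)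
    (hr : ∀ a : α, ∃ E, Auto E ∧ Good R g L (fun x => x ++ [a]) E) : MonPrefixAutomatic R := by
  have hr' := good_right_word (Q := Auto) (R := R) (g := g) (L := L) Auto.eq
    (fun _ _ h h' => h.comp h') hr
  have hLL : Auto (fun x y => L x ∧ L y) := (Auto.fst hU.reg).and (Auto.snd hU.reg)
  have eqr : IsReg {p | ∃ x ∈ {z | ∃ w, L w ∧ z = lft w}, ∃ y ∈ {z | ∃ w, L w ∧ z = lft w},
      WordEq R (expandW (gO g) x) (expandW (gO g) y) ∧ p = padR x y} := by
    have := hU.char Good.eq padR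
    simp only [id] at this
    rw [this]
    exact (Auto.eq.and hLL).lft.padR
  refine ⟨Option β, inferInstance, gO g, {z | ∃ w, L w ∧ z = lft w}, ⟨⟨?_, ?_, ?_, eqr, ?_⟩, ?_⟩⟩
  · exact reg_lft hU.reg
  · rintro _ ⟨w, _, rfl⟩; simp [lft]
  · intro w
    obtain ⟨x, hx, h⟩ := hU.onto w
    exact ⟨lft x, ⟨x, hx, rfl⟩, by rwa [expand_lft]⟩
  · intro b
    obtain ⟨E, hE, gE⟩ := hr' (gO g b)
    rw [hU.char gE padR]
    exact (hE.and hLL).lft.padR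
  · have h2 : IsReg {p | p = padR (lft ([] : List β)) []} := Reg.single _
    refine (Reg.or eqr h2).congr fun p => ?_
    constructor
    · rintro (⟨x, hx, y, hy, h⟩ | rfl)
      · exact ⟨x, hx, y, ⟨y, hy, List.prefix_rfl⟩, h⟩
      · refine ⟨lft [], ⟨[], hU.nil, rfl⟩, [], ⟨lft [], ⟨[], hU.nil, rfl⟩, List.nil_prefix⟩, ?_, rfl⟩
        rw [expand_lft]
        exact .refl _
    · rintro ⟨x, hx, y, ⟨_, ⟨z, hz, rfl⟩, hy⟩, h, rfl⟩
      cases y with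
      | nil =>
        right
        obtain ⟨x, hx, rfl⟩ := hx
        rw [expand_lft] at h
        obtain rfl := hU.uniq x [] hx hU.nil h
        rfl
      | cons a y =>
        left
        refine ⟨x, hx, a :: y, ?_, h, rfl⟩
        obtain ⟨t, ht⟩ := hy
        simp only [List.cons_append, lft, List.cons.injEq] at ht
        obtain ⟨rfl, ht⟩ := ht
        obtain ⟨z1, z2, rfl, rfl, rfl⟩ := List.map_eq_append_iff.1 ht.symm
        exact ⟨z1, hU.pre _ _ hz, rfl⟩

theorem UNF.biautomatic {α β : Type} [Fintype β] {R : Set (List α × List α)} {g : β → List α}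
    {L : List β → Prop} (hU : UNF R g L)
    (hr : ∀ a : α, ∃ E, Auto2 E ∧ Good R g L (fun x => x ++ [a]) E)
    (hl : ∀ a : α, ∃ E, Auto2 E ∧ Good R g L (fun x => a :: x) E) : MonBiautomatic R := by
  have hr' := good_right_word (Q := Auto2) (R := R) (g := g) (L := L) Auto2.eq
    (fun _ _ h h' => h.comp h') hr
  have hl' := good_left_word (Q := Auto2) (R := R) (g := g) (L := L) Auto2.eq
    (fun _ _ h h' => h.comp h') hl
  have h0 := hU.char Good.eq
  simp only [id] at h0
  refine ⟨Option β, inferInstance, gO g, {z | ∃ w, L w ∧ z = lft w}, ⟨?_, ?_, ?_, ?_, ?_, ?_, ?_, ?_, ?_⟩⟩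
  · exact reg_lft hU.reg
  · rintro _ ⟨w, _, rfl⟩; simp [lft]
  · intro w
    obtain ⟨x, hx, h⟩ := hU.onto w
    exact ⟨lft x, ⟨x, hx, rfl⟩, by rwa [expand_lft]⟩
  · rw [h0]
    exact (Auto2.eq.restrict hU.reg).lft.1.padR
  · rw [h0]
    exact Auto.padL (Auto2.eq.restrict hU.reg).lft.2
  · intro b
    obtain ⟨E, hE, gE⟩ := hr' (gO g b)
    rw [hU.char gE padR]
    exact (hE.restrict hU.reg).lft.1.padR
  · intro b
    obtain ⟨E, hE, gE⟩ := hl' (gO g b)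
    rw [hU.char gE padR]
    exact (hE.restrict hU.reg).lft.1.padR
  · intro b
    obtain ⟨E, hE, gE⟩ := hr' (gO g b)
    rw [hU.char gE padL]
    exact Auto.padL (hE.restrict hU.reg).lft.2
  · intro b
    obtain ⟨E, hE, gE⟩ := hl' (gO g b)
    rw [hU.char gE padL]
    exact Auto.padL (hE.restrict hU.reg).lft.2

/-! ### Normal forms given by a right action -/

/-- Value of a word that is stored in reverse. -/
def ev {α β : Type} (g : β → List α) (r : List β) : List α := expandW g r.reverse

theorem expandW_nil {α β : Type} (g : β → List α) : expandW g [] = [] := rfl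

theorem expandW_cons {α β : Type} (g : β → List α) (c : β) (r : List β) :
    expandW g (c :: r) = g c ++ expandW g r := by simp [expandW]

theorem expandW_append {α β : Type} (g : β → List α) (s r : List β) :
    expandW g (s ++ r) = expandW g s ++ expandW g r := by simp [expandW]

theorem ev_nil {α β : Type} (g : β → List α) : ev g [] = [] := rfl

theorem ev_cons {α β : Type} (g : β → List α) (c : β) (r : List β) :
    ev g (c :: r) = ev g r ++ g c := by simp [ev, expandW]

theorem ev_append {α β : Type} (g : β → List α) (s r : List β) :
    ev g (s ++ r) = ev g r ++ ev g s := by simp [ev, expandW]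

/-- Action of a word. -/
def actW {α β : Type} (act : α → List β → List β) (w : List α) (r : List β) : List β :=
  w.foldl (fun r a => act a r) r

theorem actW_append {α β : Type} (act : α → List β → List β) (w w' : List α) (r : List β) :
    actW act (w ++ w') r = actW act w' (actW act w r) := by simp [actW]

/-- Description of normal forms (stored in reverse) by a right action. -/
structure NF {α β : Type} (R : Set (List α × List α)) (g : β → List α) (I : List β → Prop)
    (act : α → List β → List β) : Prop where
  reg : Reg I
  nil : I []
  tail : ∀ c r, I (c :: r) → I r
  pres : ∀ a r, I r → I (act a r)
  rel : ∀ u v, (u, v) ∈ R → ∀ r, I r → actW act u r = actW act v r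
  push : ∀ c r, I (c :: r) → actW act (g c) r = c :: r

theorem NF.presW {α β : Type} {R : Set (List α × List α)} {g : β → List α} {I : List β → Prop}
    {act : α → List β → List β} (h : NF R g I act) (w : List α) :
    ∀ r, I r → I (actW act w r) := by
  induction w with
  | nil => intro r hr; exact hr
  | cons a w ih => intro r hr; exact ih _ (h.pres a r hr)

theorem NF.actEq {α β : Type} {R : Set (List α × List α)} {g : β → List α} {I : List β → Prop}
    {act : α → List β → List β} (h : NF R g I act) {x y : List α} (e : WordEq R x y) :
    actW act x [] = actW act y [] := by
  refine e.lift (fun x => actW act x []) fun p s u v hR => ?_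
  simp only [actW_append]
  rw [h.rel u v hR _ (h.presW p _ h.nil)]

theorem NF.act_ev {α β : Type} {R : Set (List α × List α)} {g : β → List α} {I : List β → Prop}
    {act : α → List β → List β} (h : NF R g I act) (r : List β) (hr : I r) :
    actW act (ev g r) [] = r := by
  induction r with
  | nil => rfl
  | cons c r ih =>
    rw [ev_cons, actW_append, ih (h.tail _ _ hr), h.push _ _ hr]

theorem NF.unf {α β : Type} {R : Set (List α × List α)} {g : β → List α} {I : List β → Prop}
    {act : α → List β → List β} (h : NF R g I act)
    (hs : ∀ a r, I r → WordEq R (ev g r ++ [a]) (ev g (act a r))) :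
    UNF R g (fun x => I x.reverse) := by
  refine ⟨h.reg.reverse, h.nil, ?_, ?_, ?_⟩
  · intro x y hxy
    rw [List.reverse_append] at hxy
    generalize y.reverse = z at hxy
    induction z with
    | nil => exact hxy
    | cons c r ih => exact ih (h.tail _ _ hxy)
  · intro x y hx hy e
    have h1 := h.act_ev _ hx
    have h2 := h.act_ev _ hy
    simp only [ev, List.reverse_reverse] at h1 h2
    rw [h.actEq e, h2] at h1
    exact (List.reverse_injective h1).symm
  · intro w
    have : ∀ (w : List α), I (actW act w []) ∧ WordEq R (ev g (actW act w [])) w := by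
      intro w
      induction w using List.reverseRecOn with
      | nil => exact ⟨h.nil, .refl _⟩
      | append_singleton w a ih =>
        rw [actW_append]
        refine ⟨h.pres _ _ ih.1, ?_⟩
        exact (hs a _ ih.1).symm.trans (ih.2.append (.refl _))
    exact ⟨(actW act w []).reverse, by simpa using (this w).1, (this w).2⟩

/-- A cascade family. -/
structure Fm (β : Type) where
  /-- tops -/
  T : List (List β × List β)
  /-- middle parts -/
  P : List (List β × List β)
  /-- bottoms -/
  B : List (List β × List β)

/-- The relation of a cascade family. -/
def Fm.rel {β : Type} (f : Fm β) : List β → List β → Prop := Fam f.T f.P f.B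

/-- All middle parts preserve the length. -/
def Fm.Bi {β : Type} (f : Fm β) : Prop := ∀ p ∈ f.P, p.1.length = p.2.length ∧ p.1 ≠ []

/-- All middle parts preserve the length, or all are erased. -/
def Fm.Uni {β : Type} (f : Fm β) : Prop := f.Bi ∨ ∀ p ∈ f.P, p.2 = [] ∧ p.1 ≠ []

/-- The family computes right multiplication by `a`. -/
def Fm.Ok {α β : Type} (R : Set (List α × List α)) (g : β → List α) (a : α) (f : Fm β) : Prop :=
  ∃ X : List α, (∀ p ∈ f.T, WordEq R (ev g p.1 ++ [a]) (X ++ ev g p.2)) ∧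
    (∀ p ∈ f.P, WordEq R (ev g p.1 ++ X) (X ++ ev g p.2)) ∧
    (∀ p ∈ f.B, WordEq R (ev g p.1 ++ X) (ev g p.2))

/-- The family computes left multiplication by `a`. -/
def Fm.OkL {α β : Type} (R : Set (List α × List α)) (g : β → List α) (a : α) (f : Fm β) : Prop :=
  ∃ X : List α, (∀ p ∈ f.T, WordEq R (a :: expandW g p.1) (expandW g p.2 ++ X)) ∧
    (∀ p ∈ f.P, WordEq R (X ++ expandW g p.1) (expandW g p.2 ++ X)) ∧
    (∀ p ∈ f.B, WordEq R (X ++ expandW g p.1) (expandW g p.2))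

theorem Fm.Ok.sound {α β : Type} {R : Set (List α × List α)} {g : β → List α} {a : α} {f : Fm β}
    (h : f.Ok R g a) {r r' : List β} (hr : f.rel r r') : WordEq R (ev g r ++ [a]) (ev g r') := by
  obtain ⟨X, hT, hP, hB⟩ := h
  obtain ⟨s, t, p, q, b, c, z, ht, hps, hb, rfl, rfl⟩ := hr
  have h1 : WordEq R (ev g p ++ X) (X ++ ev g q) := by
    clear ht hb
    induction hps with
    | nil => simp only [ev_nil, List.nil_append, List.append_nil]; exact .refl _
    | @step p q x y hp _ ih =>
      rw [ev_append, ev_append]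
      have e1 := (WordEq.refl (R := R) (ev g x)).append (hP _ hp)
      have e2 := ih.append (WordEq.refl (R := R) (ev g q))
      simp only [List.append_assoc] at e1 e2 ⊢
      exact e1.trans e2
  have h0 := hT _ ht
  have h2 := hB _ hb
  simp only [ev_append, List.append_assoc]
  refine (WordEq.refl (ev g z)).append ?_
  have e1 := (WordEq.refl (R := R) (ev g b ++ ev g p)).append h0
  have e2 := ((WordEq.refl (R := R) (ev g b)).append h1).append (WordEq.refl (ev g t))
  have e3 := h2.append (WordEq.refl (R := R) (ev g q ++ ev g t))
  simp only [List.append_assoc] at e1 e2 e3 ⊢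
  exact (e1.trans e2).trans e3

theorem Fm.OkL.sound {α β : Type} {R : Set (List α × List α)} {g : β → List α} {a : α} {f : Fm β}
    (h : f.OkL R g a) {x y : List β} (hr : f.rel x y) :
    WordEq R (a :: expandW g x) (expandW g y) := by
  obtain ⟨X, hT, hP, hB⟩ := h
  obtain ⟨s, t, p, q, b, c, z, ht, hps, hb, rfl, rfl⟩ := hr
  have h1 : WordEq R (X ++ expandW g p) (expandW g q ++ X) := by
    clear ht hb
    induction hps with
    | nil => simp only [expandW_nil, List.nil_append, List.append_nil]; exact .refl _
    | @step p q x y hp _ ih =>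
      rw [expandW_append, expandW_append]
      have e1 := (hP _ hp).append (WordEq.refl (R := R) (expandW g x))
      have e2 := (WordEq.refl (R := R) (expandW g q)).append ih
      simp only [List.append_assoc] at e1 e2 ⊢
      exact e1.trans e2
  have h0 := hT _ ht
  have h2 := hB _ hb
  simp only [expandW_append]
  have e1 := h0.append (WordEq.refl (R := R) (expandW g p ++ (expandW g b ++ expandW g z)))
  have e2 := (WordEq.refl (R := R) (expandW g t)).append
    (h1.append (WordEq.refl (expandW g b ++ expandW g z)))
  have e3 := (WordEq.refl (R := R) (expandW g t ++ expandW g q)).append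
    (h2.append (WordEq.refl (expandW g z)))
  simp only [List.append_assoc, List.cons_append] at e1 e2 e3 ⊢
  exact (e1.trans e2).trans e3

theorem Fm.Uni.auto {β : Type} [Fintype β] {f : Fm β} (h : f.Uni) :
    Auto (fun x y => f.rel x.reverse y.reverse) := by
  rcases h with h | h
  · exact Auto.famRev _ _ _ h
  · exact Auto.famRev' _ _ _ h

/-- Right multiplication is described by families. -/
structure RD {α β : Type} (R : Set (List α × List α)) (g : β → List α) (I : List β → Prop)
    (act : α → List β → List β) (F : α → List (Fm β)) : Prop where
  ok : ∀ a, ∀ f ∈ F a, f.Ok R g a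
  cover : ∀ a r, I r → ∃ f ∈ F a, f.rel r (act a r)

theorem RD.unf {α β : Type} {R : Set (List α × List α)} {g : β → List α} {I : List β → Prop}
    {act : α → List β → List β} {F : α → List (Fm β)} (h : NF R g I act) (hF : RD R g I act F) :
    UNF R g (fun x => I x.reverse) :=
  h.unf fun a r hr => by
    obtain ⟨f, hf, hr⟩ := hF.cover a r hr
    exact (hF.ok a f hf).sound hr

theorem RD.good {α β : Type} {R : Set (List α × List α)} {g : β → List α} {I : List β → Prop}
    {act : α → List β → List β} {F : α → List (Fm β)} (h : NF R g I act) (hF : RD R g I act F)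
    (a : α) : Good R g (fun x => I x.reverse) (fun x => x ++ [a])
      (fun x y => ∃ f ∈ F a, f.rel x.reverse y.reverse) := by
  refine ⟨?_, ?_⟩
  · rintro x y ⟨f, hf, hr⟩
    simpa [ev] using (hF.ok a f hf).sound hr
  · intro x hx
    obtain ⟨f, hf, hr⟩ := hF.cover a _ hx
    exact ⟨(act a x.reverse).reverse, by simpa using h.pres a _ hx, f, hf, by simpa using hr⟩

theorem RD.prefixAutomatic {α β : Type} [Fintype β] {R : Set (List α × List α)} {g : β → List α}
    {I : List β → Prop} {act : α → List β → List β} {F : α → List (Fm β)} (h : NF R g I act)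
    (hF : RD R g I act F) (hu : ∀ a, ∀ f ∈ F a, f.Uni) : MonPrefixAutomatic R :=
  (hF.unf h).prefixAutomatic fun a => ⟨_, Auto.exList _ _ fun f hf => (hu a f hf).auto, hF.good h a⟩

theorem Auto2.exList {β ι : Type} (T : List ι) (E : ι → List β → List β → Prop)
    (h : ∀ t ∈ T, Auto2 (E t)) : Auto2 (fun x y => ∃ t ∈ T, E t x y) :=
  ⟨Auto.exList _ _ fun t ht => (h t ht).1, Auto.exList _ _ fun t ht => (h t ht).2⟩

theorem RD.biautomatic' {α β : Type} [Fintype β] {R : Set (List α × List α)} {g : β → List α}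
    {I : List β → Prop} {act : α → List β → List β} {F : α → List (Fm β)} (h : NF R g I act)
    (hF : RD R g I act F) (hu : ∀ a, ∀ f ∈ F a, f.Bi)
    (hl : ∀ a : α, ∃ E, Auto2 E ∧ Good R g (fun x => I x.reverse) (fun x => a :: x) E) :
    MonBiautomatic R :=
  (hF.unf h).biautomatic
    (fun a => ⟨_, Auto2.exList _ _ fun f hf => (Auto2.fam _ _ _ (hu a f hf)).rev, hF.good h a⟩) hl

theorem RD.biautomatic {α β : Type} [Fintype β] {R : Set (List α × List α)} {g : β → List α}
    {I : List β → Prop} {act : α → List β → List β} {F G : α → List (Fm β)} (h : NF R g I act)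
    (hF : RD R g I act F) (hu : ∀ a, ∀ f ∈ F a, f.Bi) (lact : α → List β → List β)
    (hI : ∀ a x, I x.reverse → I (lact a x).reverse)
    (hG : ∀ a, ∀ f ∈ G a, f.OkL R g a ∧ f.Bi)
    (hc : ∀ a x, I x.reverse → ∃ f ∈ G a, f.rel x (lact a x)) :
    MonBiautomatic R := by
  refine hF.biautomatic' h hu fun a => ⟨_, Auto2.exList (G a) (fun f => f.rel)
    fun f hf => Auto2.fam _ _ _ (hG a f hf).2, ?_, ?_⟩
  · rintro x y ⟨f, hf, hr⟩
    exact (hG a f hf).1.sound hr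
  · intro x hx
    exact ⟨_, hI a x hx, hc a x hx⟩

/-- The reversed relations. -/
def revR {α : Type} (R : Set (List α × List α)) : Set (List α × List α) :=
  {p | (p.1.reverse, p.2.reverse) ∈ R}

theorem WordEq.rev {α : Type} {R : Set (List α × List α)} {x y : List α} (h : WordEq (revR R) x y) :
    WordEq R x.reverse y.reverse := by
  induction h with
  | rel x y h =>
    obtain ⟨p, u, v, s, hR, rfl, rfl⟩ := h
    have := (WordEq.of_mem (R := R) hR).ctx s.reverse p.reverse
    simpa using this
  | refl => exact .refl _
  | symm _ _ _ ih => exact .symm ih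
  | trans _ _ _ _ _ ih ih' => exact .trans ih ih'

theorem expandW_rev {α β : Type} (g g' : β → List α) (hg : ∀ c, g' c = (g c).reverse) (r : List β) :
    (ev g' r).reverse = expandW g r := by
  induction r with
  | nil => rfl
  | cons c r ih => rw [ev_cons, expandW_cons, List.reverse_append, ih, hg, List.reverse_reverse]

theorem RD.biautomatic_rev {α β : Type} [Fintype β] {R : Set (List α × List α)} {g g' : β → List α}
    {I I' : List β → Prop} {act act' : α → List β → List β} {F F' : α → List (Fm β)}
    (h : NF R g I act) (hF : RD R g I act F) (hu : ∀ a, ∀ f ∈ F a, f.Bi)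
    (h' : NF (revR R) g' I' act') (hF' : RD (revR R) g' I' act' F') (hu' : ∀ a, ∀ f ∈ F' a, f.Bi)
    (hg : ∀ c, g' c = (g c).reverse) (hI : ∀ r, I' r ↔ I r.reverse) : MonBiautomatic R := by
  refine hF.biautomatic' h hu fun a => ⟨_, Auto2.exList (F' a) (fun f => f.rel)
    fun f hf => Auto2.fam _ _ _ (hu' a f hf), ?_, ?_⟩
  · rintro x y ⟨f, hf, hr⟩
    have := ((hF'.ok a f hf).sound hr).rev
    simpa [expandW_rev g g' hg] using this
  · intro x hx
    exact ⟨act' a x, (hI _).1 (h'.pres a x ((hI x).2 hx)), hF'.cover a x ((hI x).2 hx)⟩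

theorem WordEq.congrR {α : Type} {u v : List α} : WordEq {(u, v)} = WordEq {(v, u)} := by
  have key : ∀ (u v x y : List α), WordEq {(u, v)} x y → WordEq {(v, u)} x y := by
    intro u v x y h
    induction h with
    | rel x y h =>
      obtain ⟨p, u', v', s, hR, rfl, rfl⟩ := h
      simp only [Set.mem_singleton_iff, Prod.mk.injEq] at hR
      obtain ⟨rfl, rfl⟩ := hR
      exact ((WordEq.of_mem (R := {(v', u')}) rfl).symm).ctx p s
    | refl => exact .refl _
    | symm _ _ _ ih => exact .symm ih
    | trans _ _ _ _ _ ih ih' => exact .trans ih ih'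
  funext x y
  exact propext ⟨key _ _ _ _, key _ _ _ _⟩

theorem prefixAutomatic_swap {α : Type} {u v : List α} (h : MonPrefixAutomatic {(v, u)}) :
    MonPrefixAutomatic {(u, v)} := by
  obtain ⟨β, i, g, L, hL⟩ := h
  refine ⟨β, i, g, L, ?_⟩
  obtain ⟨⟨h1, h2, h3, h4, h5⟩, h6⟩ := hL
  rw [WordEq.congrR] at *
  exact ⟨⟨h1, h2, h3, h4, h5⟩, h6⟩

theorem biautomatic_swap {α : Type} {u v : List α} (h : MonBiautomatic {(v, u)}) :
    MonBiautomatic {(u, v)} := by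
  obtain ⟨β, i, g, L, hL⟩ := h
  refine ⟨β, i, g, L, ?_⟩
  obtain ⟨h1, h2, h3, h4, h5, h6, h7, h8, h9⟩ := hL
  rw [WordEq.congrR] at *
  exact ⟨h1, h2, h3, h4, h5, h6, h7, h8, h9⟩

/-- To prove equality of words one may compute in an arbitrary monoid. -/
theorem WordEq.of_monoid {α : Type} {u v : List α} {x y : List α}
    (h : ∀ (M : Type) [Monoid M] (f : α → M), (u.map f).prod = (v.map f).prod →
      (x.map f).prod = (y.map f).prod) : WordEq {(u, v)} x y := by
  let c : Con (FreeMonoid α) :=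
    { r := fun x y => WordEq {(u, v)} x.toList y.toList
      iseqv := ⟨fun _ => .refl _, .symm, .trans⟩
      mul' := fun h h' => by
        rw [FreeMonoid.toList_mul, FreeMonoid.toList_mul]
        exact h.append h' }
  have key : ∀ w : List α, (w.map fun a => (c.mk' (FreeMonoid.of a))).prod =
      c.mk' (FreeMonoid.ofList w) := by
    intro w
    induction w with
    | nil => rfl
    | cons a w ih => rw [List.map_cons, List.prod_cons, ih, ← map_mul]; rfl
  have := h c.Quotient (fun a => c.mk' (FreeMonoid.of a)) (by
    rw [key, key]
    exact (Con.eq c).2 (WordEq.of_mem rfl))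
  rw [key, key] at this
  exact (Con.eq c).1 this

theorem Fam.mk {β : Type} {T P B : List (List β × List β)} {x y : List β} (s t p q b c z : List β)
    (h1 : (s, t) ∈ T) (h2 : PS P p q) (h3 : (b, c) ∈ B) (hx : x = s ++ (p ++ (b ++ z)))
    (hy : y = t ++ (q ++ (c ++ z))) : Fam T P B x y := ⟨s, t, p, q, b, c, z, h1, h2, h3, hx, hy⟩

/-- one step family -/
theorem Fm.rel_base {β : Type} {T P B : List (List β × List β)} {x y : List β} (s t b c z : List β)
    (h1 : (s, t) ∈ T) (h3 : (b, c) ∈ B) (hx : x = s ++ (b ++ z))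
    (hy : y = t ++ (c ++ z)) : Fm.rel ⟨T, P, B⟩ x y :=
  ⟨s, t, [], [], b, c, z, h1, .nil, h3, by simpa using hx, by simpa using hy⟩

theorem Fm.rel_step {β : Type} {P B : List (List β × List β)} {x y : List β} (p q : List β)
    (h1 : (p, q) ∈ P) (h : Fm.rel ⟨[([], [])], P, B⟩ x y) :
    Fm.rel ⟨[([], [])], P, B⟩ (p ++ x) (q ++ y) := by
  obtain ⟨s, t, p', q', b, c, z, h1, h2, h3, rfl, rfl⟩ := h
  simp only [List.mem_singleton, Prod.mk.injEq] at h1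
  obtain ⟨rfl, rfl⟩ := h1
  exact ⟨[], [], p ++ p', q ++ q', b, c, z, by simp, .step (by assumption) h2, h3, by simp, by simp⟩


theorem mkNF {α β : Type} [Fintype β] {u v : List α} {g : β → List α} {K : List (List β)}
    {act : α → List β → List β} (h0 : [] ∉ K)
    (h1 : ∀ a r, Irr K r → Irr K (act a r))
    (h2 : ∀ r, Irr K r → actW act u r = actW act v r)
    (h3 : ∀ c r, Irr K (c :: r) → actW act (g c) r = c :: r) : NF {(u, v)} g (Irr K) act := by
  refine ⟨Reg.irr _, irr_nil h0, fun c r h => (irr_cons.1 h).2, h1, ?_, h3⟩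
  rintro u v h r hr
  simp only [Set.mem_singleton_iff, Prod.mk.injEq] at h
  obtain ⟨rfl, rfl⟩ := h
  exact h2 r hr

/-- The family that just adds a letter. -/
def pushF {β : Type} (c : β) : Fm β := ⟨[([], [])], [], [([], [c])]⟩

theorem pushF_ok {α β : Type} {R : Set (List α × List α)} {g : β → List α} {a : α} {c : β}
    (h : g c = [a]) : (pushF c).Ok R g a :=
  ⟨[a], by simp [pushF, ev_nil, ev_cons, WordEq.refl, h]⟩

theorem pushF_rel {β : Type} (c : β) (r : List β) : (pushF c).rel r (c :: r) :=
  Fm.rel_base [] [] [] [c] _ (by simp) (by simp) rfl rfl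

theorem pushF_bi {β : Type} (c : β) : (pushF c).Bi := by simp [Fm.Bi, pushF]

theorem pushF_uni {β : Type} (c : β) : (pushF c).Uni := .inl (pushF_bi c)

open Classical in
/-- Reduction of `r·v` for the relation `pqc = v`. -/
noncomputable def n1R {α : Type} (p q c : α) (v : List α) : List α → List α
  | y :: x :: r =>
    if v.head? = some c ∧ y = q ∧ x = p then v.tail.reverse ++ n1R p q c v r
    else if v.head? = some q ∧ v.tail.head? = some c ∧ y = p then
      v.tail.tail.reverse ++ n1R p q c v (x :: r)
    else v.reverse ++ y :: x :: r
  | [y] =>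
    if v.head? = some q ∧ v.tail.head? = some c ∧ y = p then v.tail.tail.reverse ++ v.reverse
    else v.reverse ++ [y]
  | [] => v.reverse

open Classical in
noncomputable def n1 {α : Type} (p q c : α) (v : List α) (d : α) : List α → List α
  | y :: x :: r => if d = c ∧ y = q ∧ x = p then n1R p q c v r else d :: y :: x :: r
  | [y] => [d, y]
  | [] => [d]

theorem n1_irr {α : Type} (p q c : α) (v : List α) (hpc : p ≠ c) (hv : v.length ≤ 3)
    (huv : v ≠ [p, q, c]) (h2 : ∀ x y, v = [x, y] → x ≠ c) (r : List α) (hr : Irr [[c, q, p]] r) :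
    Irr [[c, q, p]] (n1R p q c v r) := by
  rcases v with _ | ⟨v1, _ | ⟨v2, _ | ⟨v3, _ | ⟨_, v⟩⟩⟩⟩
  · fun_induction n1R p q c [] r <;> simp_all [irr_cons]
  · fun_induction n1R p q c [v1] r <;> simp_all [irr_cons]  <;> grind
  · fun_induction n1R p q c [v1, v2] r <;> simp_all [irr_cons]  <;> grind
  · suffices h : Irr [[c, q, p]] (n1R p q c [v1, v2, v3] r) ∧
      ∃ x y s, n1R p q c [v1, v2, v3] r = v3 :: x :: y :: s ∧ (x = v2 ∨ x = v3 ∧ v1 = q) ∧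
        (v1 = c → v2 = c → v3 = c → y = c) from h.1
    fun_induction n1R p q c [v1, v2, v3] r with
    | case1 y x r h ih =>
      obtain ⟨h1, x', y', s, e, h3, h4⟩ := ih (by simp_all [irr_cons])
      rw [e] at h1 ⊢
      simp [irr_cons] at h1 ⊢
      grind
    | case2 y x r h h' ih =>
      obtain ⟨h1, x', y', s, e, h3, h4⟩ := ih (by simp_all [irr_cons])
      rw [e] at h1 ⊢
      simp [irr_cons] at h1 h' ⊢
      grind
    | case3 => simp_all [irr_cons]; grind
    | case4 => simp_all [irr_cons]; grind
    | case5 => simp_all [irr_cons]; grind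
    | case6 => simp_all [irr_cons]; grind
  · simp at hv; omega

theorem n1_nf {α : Type} [Fintype α] (p q c : α) (v : List α) (hpc : p ≠ c) (hv : v.length ≤ 3)
    (huv : v ≠ [p, q, c]) (h2 : ∀ x y, v = [x, y] → x ≠ c) :
    NF {([p, q, c], v)} (fun c => [c]) (Irr [[c, q, p]]) (n1 p q c v) := by
  have hI := n1_irr p q c v hpc hv huv h2
  have hP : ∀ d r, Irr [[c, q, p]] (d :: r) → n1 p q c v d r = d :: r := by
    intro d r
    fun_cases n1 p q c v d r <;> simp [irr_cons] <;> grind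
  refine mkNF (by simp) ?_ ?_ ?_
  · intro d r
    fun_cases n1 p q c v d r <;> simp [irr_cons] <;> grind
  · intro r hr
    have e1 : actW (n1 p q c v) [p, q, c] r = n1R p q c v r := by
      have e1 : n1 p q c v p r = p :: r := by fun_cases n1 p q c v p r <;> grind
      have e2 : n1 p q c v q (p :: r) = q :: p :: r := by
        rcases r with _ | ⟨x, r⟩ <;> simp [n1]; grind
      simp [actW, e1, e2]
      simp [n1]
    rw [e1]
    rcases v with _ | ⟨v1, _ | ⟨v2, _ | ⟨v3, _ | ⟨_, v⟩⟩⟩⟩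
    · fun_cases n1R p q c [] r <;> simp_all [actW]
    · fun_cases n1R p q c [v1] r <;> simp_all [actW, n1]
    · fun_cases n1R p q c [v1, v2] r <;> simp_all [actW, n1]
      simp [n1R]
    · have h3 := hI r hr
      have hT : ∀ r, n1 p q c [v1, v2, v3] c (q :: p :: r) = n1R p q c [v1, v2, v3] r := by simp [n1]
      have hQ : ∀ r, n1 p q c [v1, v2, v3] q (p :: r) = q :: p :: r := by
        intro r
        rcases r with _ | ⟨x, r⟩ <;> simp [n1]; grind
      change _ = n1 p q c _ v3 (n1 p q c _ v2 (n1 p q c _ v1 r))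
      fun_cases n1R p q c [v1, v2, v3] r with
      | case1 y x r h =>
        rw [n1R, if_pos h] at h3
        simp only [List.reverse_cons, List.reverse_nil, List.tail_cons, List.nil_append,
          List.cons_append] at h3
        simp only [List.head?_cons, Option.some.injEq] at h
        obtain ⟨rfl, rfl, rfl⟩ := h
        rw [hT, hP _ _ (irr_cons.1 h3).2, hP _ _ h3]
        rfl
      | case2 y x r h h' =>
        rw [n1R, if_neg h, if_pos h'] at h3
        simp only [List.reverse_cons, List.reverse_nil, List.tail_cons, List.nil_append,
          List.cons_append] at h3
        simp only [List.head?_cons, List.tail_cons, Option.some.injEq] at h'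
        obtain ⟨rfl, rfl, rfl⟩ := h'
        rw [hQ, hT, hP _ _ h3]
        rfl
      | case3 y x r h h' =>
        rw [n1R, if_neg h, if_neg h'] at h3
        simp only [List.reverse_cons, List.reverse_nil, List.tail_cons, List.nil_append,
          List.cons_append] at h3
        rw [hP _ _ (irr_cons.1 (irr_cons.1 h3).2).2, hP _ _ (irr_cons.1 h3).2, hP _ _ h3]
        rfl
      | case4 y h =>
        rw [n1R, if_pos h] at h3
        simp only [List.reverse_cons, List.reverse_nil, List.tail_cons, List.nil_append,
          List.cons_append] at h3
        simp only [List.head?_cons, List.tail_cons, Option.some.injEq] at h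
        obtain ⟨rfl, rfl, rfl⟩ := h
        rw [hQ, hT, n1R]
        exact (hP _ _ h3).symm
      | case5 y h =>
        rw [n1R, if_neg h] at h3
        simp only [List.reverse_cons, List.reverse_nil, List.tail_cons, List.nil_append,
          List.cons_append] at h3
        rw [hP _ _ (irr_cons.1 (irr_cons.1 h3).2).2, hP _ _ (irr_cons.1 h3).2, hP _ _ h3]
        rfl
      | case6 =>
        rw [n1R] at h3
        simp only [List.reverse_cons, List.reverse_nil, List.tail_cons, List.nil_append,
          List.cons_append] at h3
        rw [hP _ _ (irr_cons.1 (irr_cons.1 h3).2).2, hP _ _ (irr_cons.1 h3).2, hP _ _ h3]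
        rfl
    · simp at hv; omega
  · intro d r h
    simp [actW, hP d r h]

open Classical in
noncomputable def n1P {α : Type} (p q c : α) (v : List α) : List (List α × List α) :=
  (if v.head? = some c then [([q, p], v.tail.reverse)] else []) ++
  (if v.head? = some q ∧ v.tail.head? = some c then [([p], v.tail.tail.reverse)] else [])

open Classical in
noncomputable def n1F {α : Type} (p q c : α) (v : List α) (d : α) : List (Fm α) :=
  pushF d :: if d = c then [⟨[([q, p], [])], n1P p q c v, [([], v.reverse)]⟩] else []

theorem Fm.rel_step' {β : Type} {P B : List (List β × List β)} {x y t : List β} (p q : List β)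
    (h1 : (p, q) ∈ P) (h : Fm.rel ⟨[(t, [])], P, B⟩ (t ++ x) y) :
    Fm.rel ⟨[(t, [])], P, B⟩ (t ++ (p ++ x)) (q ++ y) := by
  obtain ⟨s, t', p', q', b, c, z, h1, h2, h3, h4, rfl⟩ := h
  simp only [List.mem_singleton, Prod.mk.injEq] at h1
  obtain ⟨rfl, rfl⟩ := h1
  exact ⟨s, [], p ++ p', q ++ q', b, c, z, by simp, .step (by assumption) h2, h3,
    by simp [List.append_cancel_left h4], by simp⟩

theorem ev_rev {α : Type} (v : List α) : ev (fun c => [c]) v.reverse = v := by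
  rw [ev, List.reverse_reverse]
  induction v with
  | nil => rfl
  | cons a v ih => rw [expandW_cons, ih]; rfl

theorem ev_single {α : Type} (v : List α) : ev (fun c => [c]) v = v.reverse := by
  conv_lhs => rw [← List.reverse_reverse v]
  exact ev_rev _

theorem n1_rd {α : Type} [Fintype α] (p q c : α) (v : List α) :
    RD {([p, q, c], v)} (fun c => [c]) (Irr [[c, q, p]]) (n1 p q c v) (n1F p q c v) := by
  refine ⟨?_, ?_⟩
  · intro d f hf
    simp only [n1F, List.mem_cons] at hf
    rcases hf with rfl | hf
    · exact pushF_ok rfl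
    split_ifs at hf with h1
    · simp only [List.mem_singleton] at hf
      subst hf h1
      refine ⟨v, ?_, ?_, ?_⟩
      · simp [ev_nil, ev_cons]
        exact .of_mem rfl
      · intro e he
        simp only [n1P, List.mem_append] at he
        rcases he with he | he
        · split_ifs at he with h
          · rcases v with _ | ⟨v1, v⟩ <;> simp at he h
            subst he h
            simp only [ev_cons, ev_rev, ev_nil, List.nil_append]
            exact (WordEq.of_mem (R := {([p, q, v1], v1 :: v)}) rfl).ctx [] v
          · simp at he
        · split_ifs at he with h
          · rcases v with _ | ⟨v1, _ | ⟨v2, v⟩⟩ <;> simp at he h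
            obtain ⟨rfl, rfl⟩ := h
            subst he
            simp only [ev_cons, ev_rev, ev_nil, List.nil_append]
            exact (WordEq.of_mem (R := {([p, v1, v2], v1 :: v2 :: v)}) rfl).ctx [] v
          · simp at he
      · simp [ev_rev, ev_nil, WordEq.refl]
    · simp at hf
  · intro d r h
    clear h
    simp only [n1F]
    fun_cases n1 p q c v d r with
    | case1 y x r h =>
      obtain ⟨rfl, rfl, rfl⟩ := h
      refine ⟨_, List.mem_cons_of_mem _ (by simp; rfl), ?_⟩
      fun_induction n1R x y d v r with
      | case1 y' x' r h ih =>
        obtain ⟨h, rfl, rfl⟩ := h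
        exact Fm.rel_step' (t := [y', x']) [y', x'] _ (by simp [n1P, h]) ih
      | case2 y' x' r h h' ih =>
        obtain ⟨h1, h2, rfl⟩ := h'
        exact Fm.rel_step' (t := [y, y']) [y'] _ (by simp [n1P, h1, h2]) ih
      | case4 y' h' =>
        obtain ⟨h1, h2, rfl⟩ := h'
        refine Fm.rel_step' (t := [y, y']) [y'] _ (by simp [n1P, h1, h2]) ?_
        exact Fm.rel_base [y, y'] [] [] v.reverse _ (by simp) (by simp) rfl (by simp)
      | case3 => exact Fm.rel_base [y, x] [] [] v.reverse _ (by simp) (by simp) rfl (by simp)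
      | case5 => exact Fm.rel_base [y, x] [] [] v.reverse _ (by simp) (by simp) rfl (by simp)
      | case6 => exact Fm.rel_base [y, x] [] [] v.reverse _ (by simp) (by simp) rfl (by simp)
    | _ => exact ⟨_, List.mem_cons_self, pushF_rel _ _⟩

theorem n1_bi {α : Type} (p q c : α) (v : List α) (hv : v.length = 0 ∨ v.length = 3) :
    ∀ a, ∀ f ∈ n1F p q c v a, f.Bi := by
  intro d f hf
  simp only [n1F, List.mem_cons] at hf
  rcases hf with rfl | hf
  · exact pushF_bi _
  split_ifs at hf with h1 <;> simp at hf
  subst hf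
  intro e
  simp only [n1P, List.mem_append]
  rintro (he | he)
  · split_ifs at he with h <;> simp at he
    subst he
    rcases v with _ | ⟨v1, v⟩ <;> simp at h hv ⊢
    omega
  · split_ifs at he with h <;> simp at he
    subst he
    rcases v with _ | ⟨v1, _ | ⟨v2, v⟩⟩ <;> simp at h hv ⊢
    omega

theorem n1_uni {α : Type} (p q c : α) (v : List α) (hpc : p ≠ c) (hv : v.length ≤ 3)
    (h2 : ∀ x y, v = [x, y] → x ≠ c) :
    ∀ a, ∀ f ∈ n1F p q c v a, f.Uni := by
  by_cases h03 : v.length = 0 ∨ v.length = 3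
  · exact fun a f hf => .inl (n1_bi p q c v h03 a f hf)
  intro d f hf
  simp only [n1F, List.mem_cons] at hf
  rcases hf with rfl | hf
  · exact pushF_uni _
  split_ifs at hf with h1 <;> simp at hf
  subst hf
  right
  intro e
  simp only [n1P, List.mem_append]
  rcases v with _ | ⟨v1, _ | ⟨v2, _ | ⟨v3, v⟩⟩⟩ <;> simp at h03 hv
  · rintro (he | he)
    · split_ifs at he with h <;> simp at he
      subst he; simp
    · simp at he
  · have := h2 _ _ rfl
    rintro (he | he)
    · simp [this] at he
    · split_ifs at he with h <;> simp at he
      subst he; simp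
  · exact absurd (List.length_eq_zero_iff.1 (by omega)) h03

theorem n1_pa {α : Type} [Fintype α] (p q c : α) (v : List α) (hpc : p ≠ c) (hv : v.length ≤ 3)
    (huv : v ≠ [p, q, c]) (h2 : ∀ x y, v = [x, y] → x ≠ c) : MonPrefixAutomatic {([p, q, c], v)} :=
  (n1_rd p q c v).prefixAutomatic (n1_nf p q c v hpc hv huv h2) (n1_uni p q c v hpc hv h2)

theorem irr_rev {α : Type} (w r : List α) : Irr [w.reverse] r ↔ Irr [w] r.reverse := by
  simp only [Irr, List.mem_singleton, forall_eq]
  rw [← List.reverse_infix, List.reverse_reverse]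

theorem revR_single {α : Type} (u v : List α) : revR {(u, v)} = {(u.reverse, v.reverse)} := by
  ext ⟨x, y⟩
  simp only [revR, Set.mem_ofPred_eq, Set.mem_singleton_iff, Prod.mk.injEq]
  grind [List.reverse_reverse]

theorem n1_ba {α : Type} [Fintype α] (p q c : α) (v : List α) (hpc : p ≠ c)
    (hv : v.length = 0 ∨ v.length = 3)
    (huv : v ≠ [p, q, c]) : MonBiautomatic {([p, q, c], v)} := by
  refine (n1_rd p q c v).biautomatic_rev (I' := Irr [[p, q, c]]) (g' := fun c => [c])
    (act' := n1 c q p v.reverse) (F' := n1F c q p v.reverse)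
    (n1_nf p q c v hpc (by omega) huv ?_) (n1_bi p q c v hv) ?_ ?_ (n1_bi _ _ _ _ (by simpa using hv))
    (by simp) (fun r => irr_rev [c, q, p] r)
  · rintro x y rfl; simp at hv
  · rw [revR_single]
    refine n1_nf c q p v.reverse hpc.symm (by simp; omega) ?_ ?_
    · intro h; apply huv; rw [← List.reverse_reverse v, h]; rfl
    · intro x y h
      have := congrArg List.length h
      simp at this; omega
  · rw [revR_single]
    exact n1_rd c q p v.reverse

open Classical in
/-- Single rule, applied on the top. -/
noncomputable def n2 {α : Type} (c : α) (l w : List α) (d : α) (r : List α) : List α :=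
  if d = c ∧ l <+: r then w ++ r.drop l.length else d :: r

theorem n2_top {α : Type} (c : α) (l w r : List α) : n2 c l w c (l ++ r) = w ++ r := by
  simp [n2]

theorem n2_push {α : Type} (c : α) (l w : List α) (d : α) (r : List α)
    (h : Irr [c :: l] (d :: r)) : n2 c l w d r = d :: r := by
  simp [irr_cons, List.cons_prefix_cons] at h
  unfold n2
  grind

theorem n2_pushW {α : Type} (c : α) (l w : List α) (x r : List α)
    (h : Irr [c :: l] (x ++ r)) : actW (n2 c l w) x.reverse r = x ++ r := by
  induction x with
  | nil => rfl
  | cons d x ih =>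
    rw [List.reverse_cons, actW_append, ih (irr_cons.1 h).2]
    exact n2_push c l w d _ h

/-- Conditions on the rule. -/
structure N2 {α : Type} (c : α) (l w : List α) : Prop where
  pres : ∀ r, Irr [c :: l] (l ++ r) → Irr [c :: l] (w ++ r)
  rel : ∀ r, Irr [c :: l] r → ¬ Irr [c :: l] (l ++ r) →
    actW (n2 c l w) (l.reverse ++ [c]) r = actW (n2 c l w) w.reverse r

theorem N2.nf {α : Type} [Fintype α] {c : α} {l w : List α} (h : N2 c l w) :
    NF {(l.reverse ++ [c], w.reverse)} (fun c => [c]) (Irr [c :: l]) (n2 c l w) := by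
  refine mkNF (by simp) ?_ ?_ ?_
  · intro d r hr
    by_cases hd : d = c ∧ l <+: r
    · obtain ⟨rfl, r', rfl⟩ := hd
      rw [n2_top]
      exact h.pres _ hr
    · rw [n2, if_neg hd]
      simp only [irr_cons, hr, List.mem_singleton, List.cons_prefix_cons, forall_eq]
      grind
  · intro r hr
    by_cases hl : Irr [c :: l] (l ++ r)
    · rw [n2_pushW c l w w r (h.pres r hl), actW_append, n2_pushW c l w l r hl]
      exact n2_top c l w r
    · exact h.rel r hr hl
  · intro d r hr
    exact n2_push c l w d r hr

open Classical in
noncomputable def n2F {α : Type} (c : α) (l w : List α) (d : α) : List (Fm α) :=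
  pushF d :: if d = c then [⟨[(l, w)], [], [([], [])]⟩] else []

theorem n2_rd {α : Type} (c : α) (l w : List α) :
    RD {(l.reverse ++ [c], w.reverse)} (fun c => [c]) (Irr [c :: l]) (n2 c l w) (n2F c l w) := by
  refine ⟨?_, ?_⟩
  · intro d f hf
    simp only [n2F, List.mem_cons] at hf
    rcases hf with rfl | hf
    · exact pushF_ok rfl
    split_ifs at hf with h1 <;> simp at hf
    subst hf h1
    refine ⟨[], ?_, by simp, by simp [ev_nil, WordEq.refl]⟩
    simp [ev_single]
    exact .of_mem rfl
  · intro d r _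
    by_cases hd : d = c ∧ l <+: r
    · obtain ⟨rfl, r', rfl⟩ := hd
      rw [n2_top]
      refine ⟨_, List.mem_cons_of_mem _ (by simp; rfl), ?_⟩
      exact Fm.rel_base l w [] [] r' (by simp) (by simp) rfl rfl
    · rw [n2, if_neg hd]
      exact ⟨_, List.mem_cons_self, pushF_rel _ _⟩

theorem n2_bi {α : Type} (c : α) (l w : List α) : ∀ a, ∀ f ∈ n2F c l w a, f.Bi := by
  intro d f hf
  simp only [n2F, List.mem_cons] at hf
  rcases hf with rfl | hf
  · exact pushF_bi _
  split_ifs at hf with h1 <;> simp at hf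
  subst hf
  simp [Fm.Bi]

theorem N2.pa {α : Type} [Fintype α] {c : α} {l w : List α} (h : N2 c l w) :
    MonPrefixAutomatic {(l.reverse ++ [c], w.reverse)} :=
  (n2_rd c l w).prefixAutomatic h.nf fun a f hf => .inl (n2_bi c l w a f hf)

theorem N2.ba {α : Type} [Fintype α] {c : α} {l w : List α} (h : N2 c l w)
    (h1 : c :: l = l.reverse ++ [c]) (h2 : w.reverse = w) :
    MonBiautomatic {(l.reverse ++ [c], w.reverse)} := by
  have e : revR {(l.reverse ++ [c], w.reverse)} = {(l.reverse ++ [c], w.reverse)} := by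
    rw [revR_single, h2, h2, ← h1]; simp [h1]
  have h3 := (n2_rd c l w)
  have h4 := h.nf
  refine (n2_rd c l w).biautomatic_rev (I' := Irr [c :: l]) (g' := fun c => [c])
    (act' := n2 c l w) (F' := n2F c l w) h.nf (n2_bi c l w) (by rw [e]; exact h4) (by rw [e]; exact h3)
    (n2_bi c l w) (by simp) ?_
  intro r
  have := irr_rev (c :: l) r
  rwa [List.reverse_cons, ← h1] at this

/-- `v = d`, `d` does not occur in `u`. -/
theorem n2_one {α : Type} [Fintype α] (d : α) (u : List α) (h : d ∉ u) :
    MonPrefixAutomatic {(u, [d])} := by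
  apply prefixAutomatic_swap
  have : N2 d [] u.reverse := by
    refine ⟨?_, ?_⟩
    · intro r hr
      have h' : d ∉ u.reverse := by simpa using h
      generalize u.reverse = w at h'
      induction w with
      | nil => exact hr
      | cons a w ih =>
        simp at h'
        simp [irr_cons, ih h'.2, h'.1]
    · intro r hr h; exact absurd hr h
  simpa using this.pa

theorem n2_two {α : Type} [Fintype α] (p q c v1 v2 : α) (h1 : v1 ≠ v2) (h2 : p ≠ v2)
    (h3 : ¬ (p = v1 ∧ q = v2)) (h4 : ¬ (q = v1 ∧ c = v2)) :
    MonPrefixAutomatic {([p, q, c], [v1, v2])} := by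
  apply prefixAutomatic_swap
  have : N2 v2 [v1] [c, q, p] := by
    refine ⟨?_, ?_⟩
    · intro r hr
      simp [irr_cons] at hr ⊢
      grind
    · intro r hr
      simp [irr_cons]
      grind
  exact this.pa

theorem n2_xyx_x {α : Type} [Fintype α] (x y : α) : MonPrefixAutomatic {([x, y, x], [x])} := by
  have : N2 x [y, x] [x] := by
    refine ⟨?_, ?_⟩
    · intro r hr
      simp [irr_cons] at hr ⊢
      grind
    · intro r hr
      rcases r with _ | ⟨r1, _ | ⟨r2, r⟩⟩ <;> simp [irr_cons, actW, n2] at hr ⊢ <;> grind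
  exact this.pa

theorem n2_xyx_xx {α : Type} [Fintype α] (x y : α) : MonPrefixAutomatic {([x, y, x], [x, x])} := by
  have : N2 x [y, x] [x, x] := by
    refine ⟨?_, ?_⟩
    · intro r hr
      simp [irr_cons] at hr ⊢
      grind
    · intro r hr
      rcases r with _ | ⟨r1, _ | ⟨r2, r⟩⟩ <;> simp [irr_cons, actW, n2] at hr ⊢ <;> grind
  exact this.pa

theorem n2_xtx {α : Type} (x t y : α) (h1 : t ≠ x) (h2 : t ≠ y) : N2 x [t, x] [x, y, x] := by
  refine ⟨?_, ?_⟩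
  · intro r hr
    simp [irr_cons] at hr ⊢
    grind
  · intro r hr
    rcases r with _ | ⟨r1, _ | ⟨r2, r⟩⟩ <;> simp [irr_cons, actW, n2] at hr ⊢ <;> grind

theorem n2_aaa {α : Type} (x : α) : N2 x [x, x] [] := by
  refine ⟨?_, ?_⟩
  · intro r hr
    simp [irr_cons] at hr ⊢
    grind
  · intro r hr
    rcases r with _ | ⟨r1, _ | ⟨r2, r⟩⟩ <;> simp [irr_cons, actW, n2] at hr ⊢ <;> grind

/-- Adding one extra generator for the word `w`. -/
def gE {α : Type} (w : List α) : Option α → List α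
  | some c => [c]
  | none => w

open Classical in
/-- Families assembled from a list. -/
noncomputable def FF {α β : Type} (L : List (α × Fm β)) (i : α → β) (c : α) : List (Fm β) :=
  pushF (i c) :: (L.filter fun p => p.1 = c).map Prod.snd

theorem FF_mem {α β : Type} {L : List (α × Fm β)} {i : α → β} {c : α} {f : Fm β}
    (h : f ∈ FF L i c) : f = pushF (i c) ∨ (c, f) ∈ L := by
  simp only [FF, List.mem_cons, List.mem_map, List.mem_filter] at h
  rcases h with h | ⟨⟨d, f'⟩, ⟨h1, h2⟩, h3⟩
  · exact .inl h
  · simp at h2 h3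
    subst h2 h3
    exact .inr h1

theorem FF_cover {α β : Type} {L : List (α × Fm β)} {i : α → β} {c : α} {r s : List β}
    (h : s = i c :: r ∨ ∃ f, (c, f) ∈ L ∧ f.rel r s) : ∃ f ∈ FF L i c, f.rel r s := by
  rcases h with rfl | ⟨f, hf, h⟩
  · exact ⟨_, List.mem_cons_self, pushF_rel _ _⟩
  · refine ⟨f, List.mem_cons_of_mem _ ?_, h⟩
    simp only [List.mem_map, List.mem_filter]
    exact ⟨(c, f), ⟨hf, by simp⟩, rfl⟩

theorem FF_rd {α β : Type} {R : Set (List α × List α)} {g : β → List α}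
    {I : List β → Prop} {act : α → List β → List β} {i : α → β} {L : List (α × Fm β)}
    (hi : ∀ c, g (i c) = [c])
    (hok : ∀ p ∈ L, p.2.Ok R g p.1)
    (hc : ∀ c r, I r → act c r = i c :: r ∨ ∃ f, (c, f) ∈ L ∧ f.rel r (act c r)) :
    RD R g I act (FF L i) := by
  refine ⟨?_, fun c r hr => FF_cover (hc c r hr)⟩
  intro c f hf
  rcases FF_mem hf with rfl | hf
  · exact pushF_ok (hi c)
  · exact hok _ hf

theorem mkPA {α β : Type} [Fintype β] {R : Set (List α × List α)} {g : β → List α}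
    {I : List β → Prop} {act : α → List β → List β} (i : α → β) (L : List (α × Fm β))
    (h : NF R g I act) (hi : ∀ c, g (i c) = [c])
    (hok : ∀ p ∈ L, p.2.Ok R g p.1) (hu : ∀ p ∈ L, p.2.Uni)
    (hc : ∀ c r, I r → act c r = i c :: r ∨ ∃ f, (c, f) ∈ L ∧ f.rel r (act c r)) :
    MonPrefixAutomatic R := by
  refine (FF_rd hi hok hc).prefixAutomatic h ?_
  intro c f hf
  rcases FF_mem hf with rfl | hf
  · exact pushF_uni _
  · exact hu _ hf

theorem pushF_okL {α β : Type} {R : Set (List α × List α)} {g : β → List α} {a : α} {c : β}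
    (h : g c = [a]) : (pushF c).OkL R g a :=
  ⟨[a], by simp [pushF, expandW_nil, expandW_cons, WordEq.refl, h]⟩

theorem irr_revL {β : Type} (K : List (List β)) (x : List β) :
    Irr K x.reverse ↔ Irr (K.map List.reverse) x := by
  simp only [Irr, List.mem_map, forall_exists_index, and_imp, forall_apply_eq_imp_iff₂]
  refine forall₂_congr fun f _ => ?_
  rw [← List.reverse_infix, List.reverse_reverse]

theorem mkBA {α β : Type} [Fintype β] {R : Set (List α × List α)} {g : β → List α}
    {K : List (List β)} {act : α → List β → List β} (i : α → β) (L L' : List (α × Fm β))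
    (lact : α → List β → List β)
    (h : NF R g (Irr K) act) (hi : ∀ c, g (i c) = [c])
    (hok : ∀ p ∈ L, p.2.Ok R g p.1) (hu : ∀ p ∈ L, p.2.Bi)
    (hc : ∀ c r, Irr K r → act c r = i c :: r ∨ ∃ f, (c, f) ∈ L ∧ f.rel r (act c r))
    (hI : ∀ a x, Irr (K.map List.reverse) x → Irr (K.map List.reverse) (lact a x))
    (hok' : ∀ p ∈ L', p.2.OkL R g p.1) (hu' : ∀ p ∈ L', p.2.Bi)
    (hc' : ∀ c r, Irr (K.map List.reverse) r →
      lact c r = i c :: r ∨ ∃ f, (c, f) ∈ L' ∧ f.rel r (lact c r)) :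
    MonPrefixAutomatic R ∧ MonBiautomatic R := by
  refine ⟨mkPA i L h hi hok (fun p hp => .inl (hu p hp)) hc, ?_⟩
  refine (FF_rd hi hok hc).biautomatic h (G := FF L' i) ?_ lact ?_ ?_ ?_
  · intro c f hf
    rcases FF_mem hf with rfl | hf
    · exact pushF_bi _
    · exact hu _ hf
  · simpa only [irr_revL] using hI
  · intro c f hf
    rcases FF_mem hf with rfl | hf
    · exact ⟨pushF_okL (hi c), pushF_bi _⟩
    · exact ⟨hok' _ hf, hu' _ hf⟩
  · intro c x hx
    exact FF_cover (hc' c x ((irr_revL _ _).1 hx))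

/-! ### `aba = b` -/

open Classical in
noncomputable def n8A {α : Type} (a b : α) : List α → List α
  | x :: y :: r =>
    if x = b then (if y = b then b :: b :: n8A a b r else if y = a then b :: r else a :: x :: y :: r)
    else a :: x :: y :: r
  | [x] => [a, x]
  | [] => [a]

open Classical in
noncomputable def n8 {α : Type} (a b c : α) (r : List α) : List α :=
  if c = a then n8A a b r else c :: r

theorem n8_nf {α : Type} [Fintype α] (a b : α) (hab : a ≠ b) :
    NF {([a, b, a], [b])} (fun c => [c]) (Irr [[a, b, a], [a, b, b]]) (n8 a b) := by
  have hA : ∀ r, Irr [[a, b, a], [a, b, b]] r → Irr [[a, b, a], [a, b, b]] (n8A a b r) := by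
    intro r
    fun_induction n8A a b r <;> simp [irr_cons, irr_nil] <;> grind
  have hP : ∀ r, Irr [[a, b, a], [a, b, b]] (a :: r) → n8A a b r = a :: r := by
    intro r
    fun_cases n8A a b r <;> simp_all [irr_cons]
  refine mkNF (by simp) ?_ ?_ ?_
  · intro c r h
    unfold n8
    split_ifs with hc
    · exact hA r h
    · simp [irr_cons, h]; grind
  · intro r hr
    simp [actW, n8, hab.symm]
    fun_induction n8A a b r <;> grind [n8A, irr_cons]
  · intro c r h
    simp [actW, n8]
    grind

theorem n8_pa {α : Type} [Fintype α] (a b : α) (hab : a ≠ b) :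
    MonPrefixAutomatic {([a, b, a], [b])} := by
  refine mkPA id [(a, ⟨[([], [])], [([b, b], [b, b])], [([], [a]), ([b, a], [b])]⟩)]
    (n8_nf a b hab) (by simp) ?_ ?_ ?_
  · simp only [List.mem_singleton, forall_eq]
    refine ⟨[a], ?_⟩
    simp [ev_nil, ev_cons]
    refine ⟨.refl _, ?_, .refl _, ?_⟩ <;> apply WordEq.of_monoid <;> simp <;> intros <;> grind [mul_assoc]
  · simp [Fm.Uni, Fm.Bi]
  · intro c r h
    unfold n8
    split_ifs with hc
    · right
      simp [hc]
      fun_induction n8A a b r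
      · exact Fm.rel_step [b, b] [b, b] (by simp) (by grind [irr_cons])
      · exact Fm.rel_base [] [] [b, a] [b] _ (by simp) (by simp) rfl rfl
      all_goals exact Fm.rel_base [] [] [] [a] _ (by simp) (by simp) rfl rfl
    · simp

/-! ### `pqc = cd` -/

open Classical in
noncomputable def n3C {α : Type} (c d : α) : List (Option α) → List (Option α)
  | none :: r => some d :: n3C c d r
  | some x :: r => some c :: some x :: r
  | [] => [some c]

open Classical in
noncomputable def n3Q {α : Type} (p q : α) : List (Option α) → List (Option α)
  | x :: r => if x = some p then none :: r else some q :: x :: r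
  | [] => [some q]

open Classical in
noncomputable def n3 {α : Type} (p q c d x : α) (r : List (Option α)) : List (Option α) :=
  if x = c then n3C c d r else if x = q then n3Q p q r else some x :: r

theorem n3_nf {α : Type} [Fintype α] (p q c d : α) (h1 : p ≠ q) (h2 : p ≠ c) (h3 : q ≠ c)
    (hd : d = c ∨ d = p) :
    NF {([p, q, c], [c, d])} (gE [p, q]) (Irr [[some q, some p], [some c, none]]) (n3 p q c d) := by
  have hC : ∀ r, Irr [[some q, some p], [some c, none]] r →
      Irr [[some q, some p], [some c, none]] (n3C c d r) ∧
      (d = c → ∃ s, n3C c d r = some c :: s) := by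
    intro r
    fun_induction n3C c d r <;> simp [irr_cons, irr_nil] <;> grind [List.cons_prefix_cons]
  refine mkNF (by simp) ?_ ?_ ?_
  · intro x r h
    unfold n3
    split_ifs with hc hq
    · exact (hC r h).1
    · fun_cases n3Q p q r <;> simp_all [irr_cons, irr_nil]
      grind
    · simp [irr_cons, h]; grind
  · intro r hr
    have := hC r hr
    simp [actW, n3, h3, h1, h2, n3Q, n3C]
    rcases hd with rfl | rfl
    · obtain ⟨s, e⟩ := this.2 rfl
      simp [e, n3C]
    · simp [h1, h2]
  · intro x r h
    rcases x with _ | x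
    · simp [gE, actW, n3, h3, h1, h2, n3Q]
    · simp [actW, n3, gE]
      split_ifs with hc hq
      · fun_cases n3C c d r <;> simp_all [irr_cons]
      · fun_cases n3Q p q r <;> simp_all [irr_cons]
      · rfl

theorem n3_pa {α : Type} [Fintype α] (p q c d : α) (h1 : p ≠ q) (h2 : p ≠ c) (h3 : q ≠ c)
    (hd : d = c ∨ d = p) : MonPrefixAutomatic {([p, q, c], [c, d])} := by
  refine mkPA some [(c, ⟨[([], [])], [([none], [some d])], [([], [some c])]⟩),
      (q, ⟨[([], [])], [], [([], [some q]), ([some p], [none])]⟩)]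
    (n3_nf p q c d h1 h2 h3 hd) (by simp [gE]) ?_ ?_ ?_
  · simp only [List.mem_cons, forall_eq_or_imp, List.not_mem_nil, false_imp_iff, implies_true,
      and_true]
    refine ⟨⟨[c], ?_⟩, ⟨[q], ?_⟩⟩
    · simp [ev_nil, ev_cons, gE, WordEq.refl]
      exact .of_mem rfl
    · simp [ev_nil, ev_cons, gE, WordEq.refl]
  · simp [Fm.Uni, Fm.Bi]
  · intro x r h
    unfold n3
    split_ifs with hc hq
    · right
      refine ⟨_, by simp [hc]; exact .inl rfl, ?_⟩
      fun_induction n3C c d r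
      · exact Fm.rel_step [none] [some d] (by simp) (by grind [irr_cons])
      all_goals exact Fm.rel_base [] [] [] [some c] _ (by simp) (by simp) rfl rfl
    · right
      refine ⟨_, by simp [hq]; exact .inr rfl, ?_⟩
      fun_cases n3Q p q r
      · exact Fm.rel_base [] [] [some p] [none] _ (by simp) (by simp) rfl rfl
      all_goals exact Fm.rel_base [] [] [] [some q] _ (by simp) (by simp) rfl rfl
    · simp

/-! ### `pcc = cp` -/

open Classical in
noncomputable def n3bC {α : Type} (p c : α) : List (Option α) → List (Option α)
  | none :: r => some p :: n3bC p c r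
  | some x :: r => if x = p then none :: r else some c :: some x :: r
  | [] => [some c]

open Classical in
noncomputable def n3b {α : Type} (p c x : α) (r : List (Option α)) : List (Option α) :=
  if x = c then n3bC p c r else some x :: r

theorem n3b_nf {α : Type} [Fintype α] (p c : α) (h2 : p ≠ c) :
    NF {([p, c, c], [c, p])} (gE [p, c]) (Irr [[some c, some p], [some c, none]]) (n3b p c) := by
  have hC : ∀ r, Irr [[some c, some p], [some c, none]] r →
      Irr [[some c, some p], [some c, none]] (n3bC p c r) := by
    intro r
    fun_induction n3bC p c r <;> simp [irr_cons, irr_nil] <;> grind [List.cons_prefix_cons]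
  refine mkNF (by simp) ?_ ?_ ?_
  · intro x r h
    unfold n3b
    split_ifs with hc
    · exact hC r h
    · simp [irr_cons, h]; grind
  · intro r hr
    simp [actW, n3b, h2, n3bC]
  · intro x r h
    rcases x with _ | x
    · simp [gE, actW, n3b, h2, n3bC]
    · simp [actW, n3b, gE]
      intro hc
      fun_cases n3bC p c r <;> simp_all [irr_cons]

theorem n3b_pa {α : Type} [Fintype α] (p c : α) (h2 : p ≠ c) :
    MonPrefixAutomatic {([p, c, c], [c, p])} := by
  refine mkPA some [(c, ⟨[([], [])], [([none], [some p])], [([], [some c]), ([some p], [none])]⟩)]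
    (n3b_nf p c h2) (by simp [gE]) ?_ ?_ ?_
  · simp only [List.mem_singleton, forall_eq]
    refine ⟨[c], ?_⟩
    simp [ev_nil, ev_cons, gE, WordEq.refl]
    exact .of_mem rfl
  · simp [Fm.Uni, Fm.Bi]
  · intro x r h
    unfold n3b
    split_ifs with hc
    · right
      refine ⟨_, by simp [hc]; exact rfl, ?_⟩
      fun_induction n3bC p c r
      · exact Fm.rel_step [none] [some p] (by simp) (by grind [irr_cons])
      · exact Fm.rel_base [] [] [some p] [none] _ (by simp) (by simp) rfl rfl
      all_goals exact Fm.rel_base [] [] [] [some c] _ (by simp) (by simp) rfl rfl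
    · simp

/-! ### `aab = bb` -/

open Classical in
noncomputable def n4A {α : Type} (a : α) : List (Option α) → List (Option α)
  | none :: r => none :: n4A a r
  | some x :: r => if x = a then none :: r else some a :: some x :: r
  | [] => [some a]

open Classical in
noncomputable def n4 {α : Type} (a b x : α) (r : List (Option α)) : List (Option α) :=
  if x = a then n4A a r else if x = b then n3C b b r else some x :: r

theorem n4_nf {α : Type} [Fintype α] (a b : α) (h1 : a ≠ b) :
    NF {([a, a, b], [b, b])} (gE [a, a]) (Irr [[some a, some a], [some a, none], [some b, none]])
      (n4 a b) := by
  have hA : ∀ r, Irr [[some a, some a], [some a, none], [some b, none]] r →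
      Irr [[some a, some a], [some a, none], [some b, none]] (n4A a r) := by
    intro r
    fun_induction n4A a r <;> simp [irr_cons, irr_nil] <;> grind [List.cons_prefix_cons]
  have hP : ∀ r, Irr [[some a, some a], [some a, none], [some b, none]] (some a :: r) →
      n4A a r = some a :: r := by
    intro r
    fun_cases n4A a r <;> simp_all [irr_cons]
  have hAA : ∀ r, Irr [[some a, some a], [some a, none], [some b, none]] r →
      n4A a (n4A a r) = none :: r := by
    intro r
    fun_induction n4A a r <;> grind [irr_cons, n4A]
  have hB : ∀ r, Irr [[some a, some a], [some a, none], [some b, none]] r →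
      Irr [[some a, some a], [some a, none], [some b, none]] (n3C b b r) ∧
      (∃ s, n3C b b r = some b :: s) := by
    intro r
    fun_induction n3C b b r <;> simp [irr_cons, irr_nil] <;> grind [List.cons_prefix_cons]
  refine mkNF (by simp) ?_ ?_ ?_
  · intro x r h
    unfold n4
    split_ifs with hc hq
    · exact hA r h
    · exact (hB r h).1
    · simp [irr_cons, h]; grind
  · intro r hr
    obtain ⟨s, e⟩ := (hB r hr).2
    simp [actW, n4, h1.symm, hAA r hr]
    simp [e, n3C]
  · intro x r h
    rcases x with _ | x
    · simp [gE, actW, n4, hAA r (irr_cons.1 h).2]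
    · simp [actW, n4, gE]
      split_ifs with hc hq
      · subst hc; exact hP r h
      · fun_cases n3C b b r <;> simp_all [irr_cons]
      · rfl

theorem n4_pa {α : Type} [Fintype α] (a b : α) (h1 : a ≠ b) :
    MonPrefixAutomatic {([a, a, b], [b, b])} := by
  refine mkPA some [(a, ⟨[([], [])], [([none], [none])], [([], [some a]), ([some a], [none])]⟩),
      (b, ⟨[([], [])], [([none], [some b])], [([], [some b])]⟩)]
    (n4_nf a b h1) (by simp [gE]) ?_ ?_ ?_
  · simp only [List.mem_cons, forall_eq_or_imp, List.not_mem_nil, false_imp_iff, implies_true,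
      and_true]
    refine ⟨⟨[a], ?_⟩, ⟨[b], ?_⟩⟩
    · simp [ev_nil, ev_cons, gE, WordEq.refl]
    · simp [ev_nil, ev_cons, gE, WordEq.refl]
      exact .of_mem rfl
  · simp [Fm.Uni, Fm.Bi]
  · intro x r h
    unfold n4
    split_ifs with hc hq
    · right
      refine ⟨_, by simp [hc]; exact .inl rfl, ?_⟩
      fun_induction n4A a r
      · exact Fm.rel_step [none] [none] (by simp) (by grind [irr_cons])
      · exact Fm.rel_base [] [] [some a] [none] _ (by simp) (by simp) rfl rfl
      all_goals exact Fm.rel_base [] [] [] [some a] _ (by simp) (by simp) rfl rfl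
    · right
      refine ⟨_, by simp [hq]; exact .inr rfl, ?_⟩
      fun_induction n3C b b r
      · exact Fm.rel_step [none] [some b] (by simp) (by grind [irr_cons])
      all_goals exact Fm.rel_base [] [] [] [some b] _ (by simp) (by simp) rfl rfl
    · simp

/-! ### `cpc = dc` -/

open Classical in
noncomputable def n10C {α : Type} (c p d : α) : List (Option α) → List (Option α)
  | some x :: r =>
    if x = d then none :: n10C c p d r else if x = p then none :: r else some c :: some x :: r
  | none :: r => some c :: none :: r
  | [] => [some c]

open Classical in
noncomputable def n10 {α : Type} (c p d x : α) (r : List (Option α)) : List (Option α) :=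
  if x = c then n10C c p d r else some x :: r

theorem n10_nf {α : Type} [Fintype α] (c p d : α) (h1 : p ≠ c) (h2 : d ≠ c) (h3 : d ≠ p) :
    NF {([c, p, c], [d, c])} (gE [p, c]) (Irr [[some c, some p], [some c, some d]])
      (n10 c p d) := by
  have hC : ∀ r, Irr [[some c, some p], [some c, some d]] r →
      Irr [[some c, some p], [some c, some d]] (n10C c p d r) := by
    intro r
    fun_induction n10C c p d r <;> simp [irr_cons, irr_nil] <;> grind [List.cons_prefix_cons]
  refine mkNF (by simp) ?_ ?_ ?_
  · intro x r h
    unfold n10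
    split_ifs with hc
    · exact hC r h
    · simp [irr_cons, h]; grind
  · intro r hr
    simp [actW, n10, h1, h2, n10C, h3.symm]
  · intro x r h
    rcases x with _ | x
    · simp [gE, actW, n10, h1, n10C, h3.symm]
    · simp [actW, n10, gE]
      intro hc
      fun_cases n10C c p d r <;> simp_all [irr_cons]

theorem n10_pa {α : Type} [Fintype α] (c p d : α) (h1 : p ≠ c) (h2 : d ≠ c) (h3 : d ≠ p) :
    MonPrefixAutomatic {([c, p, c], [d, c])} := by
  refine mkPA some [(c, ⟨[([], [])], [([some d], [none])], [([], [some c]), ([some p], [none])]⟩)]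
    (n10_nf c p d h1 h2 h3) (by simp [gE]) ?_ ?_ ?_
  · simp only [List.mem_singleton, forall_eq]
    refine ⟨[c], ?_⟩
    simp [ev_nil, ev_cons, gE, WordEq.refl]
    exact .symm (.of_mem rfl)
  · simp [Fm.Uni, Fm.Bi]
  · intro x r h
    unfold n10
    split_ifs with hc
    · right
      refine ⟨_, by simp [hc]; exact rfl, ?_⟩
      fun_induction n10C c p d r
      · exact Fm.rel_step [some d] [none] (by simp) (by grind [irr_cons])
      · exact Fm.rel_base [] [] [some p] [none] _ (by simp) (by simp) rfl rfl
      all_goals exact Fm.rel_base [] [] [] [some c] _ (by simp) (by simp) rfl rfl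
    · simp

/-! ### `xyx = dd` -/

open Classical in
noncomputable def n11D {α : Type} (x y d : α) : List α → List α
  | s :: t :: s' :: r =>
    if s = d then x :: y :: x :: t :: s' :: r
    else if s = x ∧ t = y ∧ s' = x then x :: y :: x :: n11D x y d r else d :: s :: t :: s' :: r
  | [s, t] => if s = d then [x, y, x, t] else [d, s, t]
  | [s] => if s = d then [x, y, x] else [d, s]
  | [] => [d]

open Classical in
noncomputable def n11 {α : Type} (x y d s : α) (r : List α) : List α :=
  if s = d then n11D x y d r else s :: r

theorem n11_nf {α : Type} [Fintype α] (x y d : α) (h1 : d ≠ x) (h2 : d ≠ y) :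
    NF {([x, y, x], [d, d])} (fun c => [c]) (Irr [[d, d], [d, x, y, x]]) (n11 x y d) := by
  have hA : ∀ r, Irr [[d, d], [d, x, y, x]] r → Irr [[d, d], [d, x, y, x]] (n11D x y d r) := by
    intro r
    fun_induction n11D x y d r <;> simp [irr_cons, irr_nil] <;> grind
  have hP : ∀ r, Irr [[d, d], [d, x, y, x]] (d :: r) → n11D x y d r = d :: r := by
    intro r
    fun_cases n11D x y d r <;> simp_all [irr_cons]
  have hDD : ∀ r, Irr [[d, d], [d, x, y, x]] r → n11D x y d (n11D x y d r) = x :: y :: x :: r := by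
    intro r
    fun_induction n11D x y d r <;> grind [irr_cons, n11D]
  refine mkNF (by simp) ?_ ?_ ?_
  · intro c r h
    unfold n11
    split_ifs with hc
    · exact hA r h
    · simp [irr_cons, h]; grind
  · intro r hr
    simp [actW, n11, h1.symm, h2.symm, hDD r hr]
  · intro c r h
    simp [actW, n11]
    grind

theorem n11_pa {α : Type} [Fintype α] (x y d : α) (h1 : d ≠ x) (h2 : d ≠ y) :
    MonPrefixAutomatic {([x, y, x], [d, d])} := by
  refine mkPA id [(d, ⟨[([], [])], [([x, y, x], [x, y, x])], [([], [d]), ([d], [x, y, x])]⟩)]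
    (n11_nf x y d h1 h2) (by simp) ?_ ?_ ?_
  · simp only [List.mem_singleton, forall_eq]
    refine ⟨[d], ?_⟩
    simp [ev_nil, ev_cons]
    refine ⟨.refl _, ?_, .refl _, ?_⟩ <;> apply WordEq.of_monoid <;> simp <;> intros <;> grind [mul_assoc]
  · simp [Fm.Uni, Fm.Bi]
  · intro c r h
    unfold n11
    split_ifs with hc
    · right
      simp [hc]
      fun_induction n11D x y d r
      · exact Fm.rel_base [] [] [d] [x, y, x] _ (by simp) (by simp) rfl rfl
      · next s t s' r hn hh ih =>
        obtain ⟨rfl, rfl, rfl⟩ := hh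
        exact Fm.rel_step [_, _, _] [_, _, _] (by simp) (by grind [irr_cons])
      · exact Fm.rel_base [] [] [] [d] _ (by simp) (by simp) rfl rfl
      · exact Fm.rel_base [] [] [d] [x, y, x] _ (by simp) (by simp) rfl rfl
      · exact Fm.rel_base [] [] [] [d] _ (by simp) (by simp) rfl rfl
      · exact Fm.rel_base [] [] [d] [x, y, x] _ (by simp) (by simp) rfl rfl
      all_goals exact Fm.rel_base [] [] [] [d] _ (by simp) (by simp) rfl rfl
    · simp

/-! ### `aba = bb` -/

open Classical in
noncomputable def n13B {α : Type} (b : α) : List (Option α) → List (Option α)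
  | none :: r => none :: n13B b r
  | some x :: some y :: r =>
    if x = b ∧ y = b then none :: r else some b :: some x :: some y :: r
  | some x :: none :: r => some b :: some x :: none :: r
  | [some x] => [some b, some x]
  | [] => [some b]

open Classical in
noncomputable def n13A {α : Type} (a b : α) : List (Option α) → List (Option α)
  | none :: r => none :: n13A a b r
  | some x :: some y :: r =>
    if x = b ∧ y = a then n13B b (n13B b r) else some a :: some x :: some y :: r
  | some x :: none :: r => some a :: some x :: none :: r
  | [some x] => [some a, some x]
  | [] => [some a]

open Classical in
noncomputable def n13 {α : Type} (a b x : α) (r : List (Option α)) : List (Option α) :=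
  if x = a then n13A a b r else if x = b then n13B b r else some x :: r

theorem n13_nf {α : Type} [Fintype α] (a b : α) (h1 : a ≠ b) :
    NF {([a, b, a], [b, b])} (gE [b, b, b]) (Irr [[some a, some b, some a], [some b, some b, some b],
      [some a, none], [some b, none]])
      (n13 a b) := by
  generalize hK : [[some a, some b, some a], [some b, some b, some b],
      [some a, none], [some b, none]] = K
  have hB : ∀ r, Irr K r → Irr K (n13B b r) := by
    intro r
    subst hK
    fun_induction n13B b r <;> simp [irr_cons, irr_nil] <;> grind [List.cons_prefix_cons]
  have hPB : ∀ r, Irr K (some b :: r) → n13B b r = some b :: r := by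
    intro r
    subst hK
    fun_cases n13B b r <;> simp_all [irr_cons]
  have hA : ∀ r, Irr K r → Irr K (n13A a b r) := by
    intro r
    fun_induction n13A a b r <;> subst hK <;> simp [irr_cons, irr_nil] <;>
      grind [List.cons_prefix_cons]
  have hPA : ∀ r, Irr K (some a :: r) → n13A a b r = some a :: r := by
    intro r
    subst hK
    fun_cases n13A a b r <;> simp_all [irr_cons]
  have hS : ∀ y r, y ≠ b → n13B b (some y :: r) = some b :: some y :: r := by
    intro y r hy
    rcases r with _ | ⟨_ | z, r⟩ <;> simp [n13B, hy]
  have hBBB : ∀ r, Irr K r → n13B b (n13B b (n13B b r)) = none :: r := by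
    intro r
    fun_induction n13B b r
    case case3 x y r h =>
      intro _
      by_cases hx : x = b
      · subst hx
        have hy : y ≠ x := by grind
        simp [n13B, hS y r hy]
      · simp [n13B, hx, hS]
    all_goals grind [irr_cons, n13B]
  have hR : ∀ r, Irr K r → n13A a b (n13B b (n13A a b r)) = n13B b (n13B b r) := by
    intro r
    fun_induction n13A a b r <;> grind [irr_cons, n13B, n13A]
  refine mkNF (by simp [← hK]) ?_ ?_ ?_
  · intro x r h
    unfold n13
    split_ifs with hc hq
    · exact hA r h
    · exact hB r h
    · simp [irr_cons, h]; subst hK; simp; grind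
  · intro r hr
    simp [actW, n13, h1.symm, hR r hr]
  · intro x r h
    rcases x with _ | x
    · simp [gE, actW, n13, h1.symm, hBBB r (irr_cons.1 h).2]
    · simp [actW, n13, gE]
      split_ifs with hc hq
      · subst hc; exact hPA r h
      · subst hq; exact hPB r h
      · rfl

theorem n13_pa {α : Type} [Fintype α] (a b : α) (h1 : a ≠ b) :
    MonPrefixAutomatic {([a, b, a], [b, b])} := by
  refine mkPA some [(a, ⟨[([], [])], [([none], [none])], [([], [some a]),
        ([some b, some a, some b, some b], [none, some b]),
        ([some b, some a, some b], [none]), ([some b, some a], [some b, some b])]⟩),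
      (b, ⟨[([], [])], [([none], [none])], [([], [some b]), ([some b, some b], [none])]⟩)]
    (n13_nf a b h1) (by simp [gE]) ?_ ?_ ?_
  · simp only [List.mem_cons, forall_eq_or_imp, List.not_mem_nil, false_imp_iff, implies_true,
      and_true]
    refine ⟨⟨[a], ?_⟩, ⟨[b], ?_⟩⟩
    · simp [ev_nil, ev_cons, gE, WordEq.refl]
      refine ⟨?_, ?_, ?_, ?_⟩
      · apply WordEq.of_monoid
        simp
        intro M _ f h
        have e1 := congrArg (· * (f b * f a)) h
        have e2 := congrArg (f a * f b * ·) h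
        simp only [mul_assoc] at e1 e2
        rw [← e1, e2]
      all_goals apply WordEq.of_monoid <;> simp <;> intros <;> grind [mul_assoc]
    · simp [ev_nil, ev_cons, gE, WordEq.refl]
  · simp [Fm.Uni, Fm.Bi]
  · intro x r h
    unfold n13
    split_ifs with hc hq
    · right
      refine ⟨_, by simp [hc]; exact .inl rfl, ?_⟩
      fun_induction n13A a b r
      · exact Fm.rel_step [none] [none] (by simp) (by grind [irr_cons])
      · next x y r hh =>
        obtain ⟨rfl, rfl⟩ := hh
        match r, h with
        | [], h => exact Fm.rel_base [] [] [some x, some y] [some x, some x] _ (by simp) (by simp) rfl rfl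
        | none :: r, h => simp [irr_cons] at h
        | [some z], h =>
          by_cases hz : z = x
          · subst hz
            exact Fm.rel_base [] [] [some z, some y, some z] [none] [] (by simp) (by simp) (by simp)
              (by simp [n13B])
          · exact Fm.rel_base [] [] [some x, some y] [some x, some x] [some z] (by simp) (by simp)
              (by simp) (by simp [n13B, hz])
        | some z :: none :: r, h =>
          by_cases hz : z = x
          · subst hz
            simp [irr_cons] at h
          · exact Fm.rel_base [] [] [some x, some y] [some x, some x] (some z :: none :: r) (by simp)
              (by simp) (by simp) (by simp [n13B, hz])
        | some z :: some w :: r, h =>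
          by_cases hz : z = x
          · subst hz
            by_cases hw : w = z
            · subst hw
              refine Fm.rel_base [] [] [some w, some y, some w, some w] [none, some w] r (by simp)
                (by simp) (by simp) ?_
              rcases r with _ | ⟨_ | v, _ | ⟨_ | t, r⟩⟩ <;> simp [n13B] <;> simp_all [irr_cons] <;> grind
            · exact Fm.rel_base [] [] [some z, some y, some z] [none] (some w :: r) (by simp) (by simp)
                (by simp) (by simp [n13B, hw])
          · exact Fm.rel_base [] [] [some x, some y] [some x, some x] (some z :: some w :: r) (by simp)
              (by simp) (by simp) (by simp [n13B, hz])
      all_goals exact Fm.rel_base [] [] [] [some a] _ (by simp) (by simp) rfl rfl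
    · right
      refine ⟨_, by simp [hq]; exact .inr rfl, ?_⟩
      fun_induction n13B b r
      · exact Fm.rel_step [none] [none] (by simp) (by grind [irr_cons])
      · next x y r hh =>
        obtain ⟨rfl, rfl⟩ := hh
        exact Fm.rel_base [] [] [some _, some _] [none] _ (by simp) (by simp) rfl rfl
      all_goals exact Fm.rel_base [] [] [] [some b] _ (by simp) (by simp) rfl rfl
    · simp

/-- The word starts with `m ^ n x`. -/
def tB {α : Type} (x m : α) : List α → Prop
  | [] => False
  | y :: r => y = x ∨ (y = m ∧ tB x m r)

/-- There is no factor `x m ^ n x` with `n ≥ 1`. -/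
def IB {α : Type} (x m : α) : List α → Prop
  | [] => True
  | y :: r => IB x m r ∧ ¬ (y = x ∧ tB x m r ∧ r.head? ≠ some x)

theorem reg_tB {α : Type} (x m : α) : Reg (tB x m) := by
  refine Reg.system (ι := Bool) (fun i w => if i then True else tB x m w)
    (fun i a j => i = true ∧ j = true ∨ i = false ∧ (a = x ∧ j = true ∨ a = m ∧ j = false)) ?_ false
  rintro (_ | _) a w <;> simp [tB, or_comm]

theorem reg_IB {α : Type} [Fintype α] (x m : α) (h : m ≠ x) : Reg (IB x m) := by
  refine (((reg_tB x m).pre [x, m]).anyPre).not.congr fun w => ?_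
  rw [not_iff_comm]
  induction w with
  | nil => simp [IB]
  | cons a w ih =>
    rw [IB, not_and_or, ih]
    constructor
    · rintro (⟨p, y, h1, h2⟩ | h1)
      · exact ⟨a :: p, y, by simp [h1], h2⟩
      · simp only [not_not] at h1
        obtain ⟨rfl, h1, h2⟩ := h1
        rcases w with _ | ⟨z, w⟩
        · simp [tB] at h1
        · simp [tB] at h1 h2
          simp [h2] at h1
          exact ⟨[], _, rfl, w, by simp [h1], h1.2⟩
    · rintro ⟨_ | ⟨b, p⟩, y, h1, y', h2, h3⟩
      · right
        simp at h1 h2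
        grind [tB]
      · left
        simp at h1
        exact ⟨p, y, h1.2, y', h2, h3⟩

/-- Variant of the builder with a direct soundness hypothesis. -/
theorem mkPA' {α β : Type} [Fintype β] {R : Set (List α × List α)} {g : β → List α}
    {I : List β → Prop} {act : α → List β → List β} (i : α → β) (L : List (α × Fm β))
    (h : NF R g I act) (hi : ∀ c, g (i c) = [c])
    (hok : ∀ p ∈ L, ∀ r r', p.2.rel r r' → WordEq R (ev g r ++ [p.1]) (ev g r')) (hu : ∀ p ∈ L, p.2.Uni)
    (hc : ∀ c r, I r → act c r = i c :: r ∨ ∃ f, (c, f) ∈ L ∧ f.rel r (act c r)) :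
    MonPrefixAutomatic R := by
  have hs : ∀ c, ∀ f ∈ FF L i c, ∀ r r', f.rel r r' → WordEq R (ev g r ++ [c]) (ev g r') := by
    intro c f hf r r' hr
    rcases FF_mem hf with rfl | hf
    · exact (pushF_ok (hi c)).sound hr
    · exact hok _ hf r r' hr
  have hcv : ∀ c r, I r → ∃ f ∈ FF L i c, f.rel r (act c r) := fun c r hr => FF_cover (hc c r hr)
  have hunf : UNF R g (fun x => I x.reverse) := h.unf fun a r hr => by
    obtain ⟨f, hf, hr⟩ := hcv a r hr
    exact hs a f hf _ _ hr
  refine hunf.prefixAutomatic fun a => ⟨(fun x y => ∃ f ∈ FF L i a, f.rel x.reverse y.reverse),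
    Auto.exList _ _ fun f hf => ?_, ?_⟩
  · rcases FF_mem hf with rfl | hf
    · exact (pushF_uni _).auto
    · exact (hu _ hf).auto
  · refine ⟨?_, ?_⟩
    · rintro x y ⟨f, hf, hr⟩
      simpa [ev] using hs a f hf _ _ hr
    · intro x hx
      obtain ⟨f, hf, hr⟩ := hcv a x.reverse hx
      refine ⟨(act a x.reverse).reverse, by simpa using h.pres a _ hx, f, hf, by simpa using hr⟩

theorem PS.single {β : Type} {m : β} {p q : List β} (h : PS [([m], [m])] p q) :
    ∃ n, p = List.replicate n m ∧ q = List.replicate n m := by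
  induction h with
  | nil => exact ⟨0, rfl, rfl⟩
  | step h1 h2 ih =>
    obtain ⟨n, rfl, rfl⟩ := ih
    simp at h1
    exact ⟨n + 1, by simp [h1, List.replicate_succ], by simp [h1, List.replicate_succ]⟩

theorem ev_replicate {α : Type} (m : α) (n : ℕ) :
    ev (fun c => [c]) (List.replicate n m) = List.replicate n m := by
  induction n with
  | zero => rfl
  | succ n ih => rw [List.replicate_succ, ev_cons, ih, ← List.replicate_succ', List.replicate_succ]

theorem tB_split {α : Type} {x m : α} {r : List α} (h : tB x m r) :
    ∃ n z, r = List.replicate n m ++ x :: z := by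
  induction r with
  | nil => exact h.elim
  | cons a r ih =>
    rcases h with rfl | ⟨rfl, h⟩
    · exact ⟨0, r, rfl⟩
    · obtain ⟨n, z, rfl⟩ := ih h
      exact ⟨n + 1, z, rfl⟩

/-- Middle parts `m ^ n`. -/
theorem Fm.rel_rep {β : Type} {T B : List (List β × List β)} {x y : List β} (m : β) (n : ℕ)
    (s t b c z : List β) (h1 : (s, t) ∈ T) (h3 : (b, c) ∈ B)
    (hx : x = s ++ (List.replicate n m ++ (b ++ z)))
    (hy : y = t ++ (List.replicate n m ++ (c ++ z))) : Fm.rel ⟨T, [([m], [m])], B⟩ x y := by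
  refine ⟨s, t, _, _, b, c, z, h1, ?_, h3, hx, hy⟩
  clear hx hy
  induction n with
  | zero => exact .nil
  | succ n ih => exact .step (p := [m]) (q := [m]) (by simp) ih

/-! ### `aba = ab` -/

open Classical in
noncomputable def n12 {α : Type} (a b c : α) (r : List α) : List α :=
  if c = a ∧ tB a b r ∧ r.head? ≠ some a then r else c :: r

theorem n12_pa {α : Type} [Fintype α] (a b : α) (h1 : b ≠ a) :
    MonPrefixAutomatic {([a, b, a], [a, b])} := by
  have nf : NF {([a, b, a], [a, b])} (fun c => [c]) (IB a b) (n12 a b) := by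
    refine ⟨reg_IB a b h1, trivial, fun c r h => h.1, ?_, ?_, ?_⟩
    · intro c r h
      unfold n12
      split_ifs with hc
      · exact h
      · exact ⟨h, hc⟩
    · rintro u v h r hr
      simp only [Set.mem_singleton_iff, Prod.mk.injEq] at h
      obtain ⟨rfl, rfl⟩ := h
      change n12 a b a (n12 a b b (n12 a b a r)) = n12 a b b (n12 a b a r)
      have e : ∀ r, n12 a b b r = b :: r := by intro r; simp [n12, h1]
      have e2 : tB a b (n12 a b a r) := by
        unfold n12
        split_ifs with hc
        · exact hc.2.1
        · simp [tB]
      rw [e]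
      generalize n12 a b a r = w at e2
      simp [n12, tB, h1, e2]
    · intro c r h
      simp only [actW, n12]
      exact if_neg h.2
  refine mkPA' id [(a, ⟨[([b], [b])], [([b], [b])], [([a], [a])]⟩)] nf (by simp) ?_ ?_ ?_
  · simp only [List.mem_singleton, forall_eq]
    rintro r r' ⟨s, t, p, q, b', c, z, h1, h2, h3, rfl, rfl⟩
    obtain ⟨n, rfl, rfl⟩ := h2.single
    simp at h1 h3
    obtain ⟨rfl, rfl⟩ := h1
    obtain ⟨rfl, rfl⟩ := h3
    simp only [ev_append, ev_replicate, ev_cons, ev_nil]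
    apply WordEq.of_monoid
    simp
    intro M _ f h
    have : ∀ n, f a * (f b ^ n * (f b * f a)) = f a * (f b ^ n * f b) := by
      intro n
      induction n with
      | zero => simpa using h
      | succ n ih =>
        calc f a * (f b ^ (n + 1) * (f b * f a)) = (f a * f b) * (f b ^ n * (f b * f a)) := by
              simp only [pow_succ', mul_assoc]
          _ = (f a * (f b * f a)) * (f b ^ n * (f b * f a)) := by rw [h]
          _ = f a * (f b * (f a * (f b ^ n * (f b * f a)))) := by simp only [mul_assoc]
          _ = f a * (f b * f a) * (f b ^ n * f b) := by rw [ih]; simp only [mul_assoc]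
          _ = _ := by rw [h]; simp only [pow_succ', mul_assoc]
    simp [this]
  · simp [Fm.Uni, Fm.Bi]
  · intro c r h
    unfold n12
    split_ifs with hc
    · right
      obtain ⟨rfl, h2, h3⟩ := hc
      refine ⟨_, by simp; rfl, ?_⟩
      obtain ⟨n, z, rfl⟩ := tB_split h2
      rcases n with _ | n
      · simp at h3
      · exact Fm.rel_rep b n [b] [b] [c] [c] z (by simp) (by simp) (by simp [List.replicate_succ])
          (by simp [List.replicate_succ])
    · simp

/-! ### `ccc = dc` -/

def n9t {α : Type} (c d : α) : List α → Prop
  | x :: y :: r => (x = c ∧ y = c) ∨ (x = d ∧ n9t c d (y :: r))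
  | [_] => False
  | [] => False

open Classical in
noncomputable def n9r2 {α : Type} (c d : α) : List α → List α
  | x :: y :: r => if x = c then d :: r else x :: n9r2 c d (y :: r)
  | [x] => [x]
  | [] => []

open Classical in
noncomputable def n9r1 {α : Type} (c : α) : List α → List α
  | x :: r => if x = c then r else x :: n9r1 c r
  | [] => []

open Classical in
noncomputable def n9 {α : Type} (c d x : α) (r : List α) : List α :=
  if x = c then
    if n9t c d r then c :: n9r2 c d r else if tB c d r then c :: c :: n9r1 c r else c :: r
  else x :: r

theorem n9t_split {α : Type} {c d : α} {r : List α} (h : n9t c d r) :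
    ∃ n z, r = List.replicate n d ++ c :: c :: z := by
  fun_induction n9t c d r
  · next x y r ih =>
    rcases h with ⟨rfl, rfl⟩ | ⟨rfl, h⟩
    · exact ⟨0, r, rfl⟩
    · obtain ⟨n, z, h⟩ := ih h
      exact ⟨n + 1, z, by simp [h, List.replicate_succ]⟩
  all_goals exact h.elim

theorem n9t_d {α : Type} {c d : α} (h : d ≠ c) (n : ℕ) (z : List α) :
    n9t c d (List.replicate n d ++ z) ↔ n9t c d z := by
  induction n with
  | zero => simp
  | succ n ih =>
    rw [List.replicate_succ, List.cons_append, ← ih]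
    rcases List.replicate n d ++ z with _ | ⟨y, r⟩ <;> simp [n9t, h]

theorem tB_d {α : Type} {c d : α} (h : d ≠ c) (n : ℕ) (z : List α) :
    tB c d (List.replicate n d ++ z) ↔ tB c d z := by
  induction n with
  | zero => simp
  | succ n ih => simp [List.replicate_succ, tB, h, ih]

theorem IB_d {α : Type} {c d : α} (h : d ≠ c) (n : ℕ) (z : List α) :
    IB c d (List.replicate n d ++ z) ↔ IB c d z := by
  induction n with
  | zero => simp
  | succ n ih => simp [List.replicate_succ, IB, h, ih]

theorem irr_d {α : Type} {c d : α} (h : d ≠ c) (n : ℕ) (z : List α) :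
    Irr [[c, c, c]] (List.replicate n d ++ z) ↔ Irr [[c, c, c]] z := by
  induction n with
  | zero => simp
  | succ n ih => simp [List.replicate_succ, irr_cons, h.symm, ih]

theorem n9r2_d {α : Type} {c d : α} (h : d ≠ c) (n : ℕ) (z : List α) :
    n9r2 c d (List.replicate n d ++ c :: c :: z) = List.replicate n d ++ d :: z := by
  induction n with
  | zero => simp [n9r2]
  | succ n ih =>
    rw [List.replicate_succ, List.cons_append, List.cons_append, ← ih]
    rcases n with _ | n <;> simp [List.replicate_succ, n9r2, h]

theorem n9r1_d {α : Type} {c d : α} (h : d ≠ c) (n : ℕ) (z : List α) :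
    n9r1 c (List.replicate n d ++ c :: z) = List.replicate n d ++ z := by
  induction n with
  | zero => simp [n9r1]
  | succ n ih => simp [List.replicate_succ, n9r1, h, ih]

/-- The three cases. -/
theorem n9_cases {α : Type} (c d : α) (h : d ≠ c) (r : List α) :
    (∃ n z, r = List.replicate n d ++ c :: c :: z ∧ n9 c d c r = c :: (List.replicate n d ++ d :: z)) ∨
    (∃ n z, r = List.replicate n d ++ c :: z ∧ z.head? ≠ some c ∧
      n9 c d c r = c :: c :: (List.replicate n d ++ z)) ∨
    (¬ tB c d r ∧ n9 c d c r = c :: r) := by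
  by_cases h2 : n9t c d r
  · obtain ⟨n, z, rfl⟩ := n9t_split h2
    refine .inl ⟨n, z, rfl, ?_⟩
    simp [n9, h2, n9r2_d h]
  · by_cases h1 : tB c d r
    · obtain ⟨n, z, rfl⟩ := tB_split h1
      refine .inr (.inl ⟨n, z, rfl, ?_, ?_⟩)
      · rw [n9t_d h] at h2
        rcases z with _ | ⟨y, z⟩
        · simp
        · simp [n9t] at h2
          simp [h2.1]
      · simp [n9, h2, n9r1_d h, h1]
    · refine .inr (.inr ⟨h1, by simp [n9, h1, h2]⟩)

theorem n9_d {α : Type} (c d : α) (h : d ≠ c) (r : List α) : n9 c d d r = d :: r := by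
  simp [n9, h]

theorem n9_eval2 {α : Type} (c d : α) (h : d ≠ c) (n : ℕ) (z : List α) :
    n9 c d c (List.replicate n d ++ c :: c :: z) = c :: (List.replicate n d ++ d :: z) := by
  simp [n9, n9t_d h, n9t, n9r2_d h]

theorem n9_eval1 {α : Type} (c d : α) (h : d ≠ c) (n : ℕ) (z : List α) (hz : z.head? ≠ some c) :
    n9 c d c (List.replicate n d ++ c :: z) = c :: c :: (List.replicate n d ++ z) := by
  have : ¬ n9t c d (c :: z) := by
    rcases z with _ | ⟨y, z⟩
    · simp [n9t]
    · simp at hz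
      simp [n9t, hz, h.symm]
  simp [n9, n9t_d h, this, tB_d h, tB, n9r1_d h]

theorem n9_eval0 {α : Type} (c d : α) (z : List α) (hz : ¬ tB c d z) :
    n9 c d c z = c :: z := by
  have : ¬ n9t c d z := by
    intro h
    fun_induction n9t c d z
    · next ih => grind [tB]
    all_goals exact h
  simp [n9, this, hz]

theorem head_d {α : Type} {c d : α} (h : d ≠ c) (n : ℕ) {z : List α} (hz : z.head? ≠ some c) :
    (List.replicate n d ++ z).head? ≠ some c := by
  cases n
  · simpa using hz
  · simpa [List.replicate_succ] using h

theorem n9_nf {α : Type} [Fintype α] (c d : α) (h : d ≠ c) :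
    NF {([c, c, c], [d, c])} (fun c => [c]) (fun r => IB c d r ∧ Irr [[c, c, c]] r) (n9 c d) := by
  refine ⟨(reg_IB c d h).and (.irr _), ⟨trivial, irr_nil (by simp)⟩,
    fun x r h => ⟨h.1.1, (irr_cons.1 h.2).2⟩, ?_, ?_, ?_⟩
  · intro x r ⟨hr1, hr2⟩
    by_cases hx : x = c
    · subst hx
      rcases n9_cases x d h r with ⟨n, z, rfl, e⟩ | ⟨n, z, rfl, hz, e⟩ | ⟨ht, e⟩ <;> rw [e]
      · rw [IB_d h] at hr1
        rw [irr_d h] at hr2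
        have hz : ¬ tB x d z := by
          rcases z with _ | ⟨y, z⟩
          · simp [tB]
          · simp [IB] at hr1
            simp [irr_cons] at hr2
            grind
        have e2 : List.replicate n d ++ d :: z = List.replicate (n + 1) d ++ z := by
          simp [List.replicate_succ']
        rw [e2, IB, irr_cons, irr_d h, IB_d h, tB_d h]
        refine ⟨⟨hr1.1.1, by simp [hz]⟩, ?_, (irr_cons.1 (irr_cons.1 hr2).2).2⟩
        simp [List.replicate_succ, h.symm]
      · rw [IB_d h] at hr1
        rw [irr_d h] at hr2
        have hz' : ¬ tB x d z := by
          intro ht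
          exact hr1.2 ⟨rfl, ht, hz⟩
        rw [IB, IB, irr_cons, irr_cons, irr_d h, IB_d h, tB_d h]
        have := head_d h n hz
        refine ⟨⟨⟨hr1.1, by simp [hz']⟩, by simp⟩, ?_, ?_, (irr_cons.1 hr2).2⟩ <;>
          generalize List.replicate n d ++ z = w at this <;>
          rcases w with _ | ⟨y, r⟩ <;> simp <;> simp at this <;> grind
      · rw [IB, irr_cons]
        refine ⟨⟨hr1, by simp [ht]⟩, ?_, hr2⟩
        rcases r with _ | ⟨y, r⟩
        · simp
        · simp [tB] at ht
          grind
    · simp [n9, hx, IB, hr1, irr_cons, hr2]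
      grind
  · rintro u v hh r hr
    simp only [Set.mem_singleton_iff, Prod.mk.injEq] at hh
    obtain ⟨rfl, rfl⟩ := hh
    change n9 c d c (n9 c d c (n9 c d c r)) = n9 c d c (n9 c d d r)
    rw [n9_d c d h]
    have hs : ∀ (n : ℕ) (z : List α), d :: (List.replicate n d ++ z) = List.replicate (n + 1) d ++ z :=
      fun n z => by simp [List.replicate_succ]
    have E2 := n9_eval2 c d h
    have E1 := n9_eval1 c d h
    rcases n9_cases c d h r with ⟨n, z, rfl, e⟩ | ⟨n, z, rfl, hz, e⟩ | ⟨ht, e⟩ <;> rw [e]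
    · have e2 : List.replicate n d ++ d :: z = List.replicate (n + 1) d ++ z := by
        simp [List.replicate_succ']
      have e3 := E1 0 (List.replicate n d ++ d :: z)
        (by rw [e2]; simpa [List.replicate_succ] using h)
      simp only [List.replicate_zero, List.nil_append] at e3
      rw [e3, hs, E2 (n + 1)]
      have e4 := E2 0 (List.replicate n d ++ d :: z)
      simp only [List.replicate_zero, List.nil_append] at e4
      rw [e4]
      rfl
    · have e4 := E2 0 (List.replicate n d ++ z)
      simp only [List.replicate_zero, List.nil_append] at e4
      rw [e4]
      have e3 := E1 0 (d :: (List.replicate n d ++ z)) (by simpa using h)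
      simp only [List.replicate_zero, List.nil_append] at e3
      rw [e3, hs, hs, E1 _ _ hz]
    · have e3 := E1 0 r (by rcases r with _ | ⟨y, r⟩ <;> simp [tB] at ht ⊢; exact ht.1)
      have e4 := E2 0 r
      simp only [List.replicate_zero, List.nil_append] at e4 e3
      rw [e3, e4, n9_eval0]
      simpa [tB, h] using ht
  · intro x r hr
    change n9 c d x r = x :: r
    by_cases hx : x = c
    · subst hx
      rcases n9_cases x d h r with ⟨n, z, rfl, e⟩ | ⟨n, z, rfl, hz, e⟩ | ⟨ht, e⟩
      · exfalso
        have h1 := hr.1.2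
        rw [tB_d h] at h1
        rcases n with _ | n
        · have h2 := hr.2
          simp [irr_cons] at h2
        · simp [tB, List.replicate_succ, h] at h1
      · have h1 := hr.1.2
        rw [tB_d h] at h1
        rcases n with _ | n
        · simpa using e
        · simp [tB, List.replicate_succ, h] at h1
      · exact e
    · simp [n9, hx]

theorem n9_pa {α : Type} [Fintype α] (c d : α) (h : d ≠ c) :
    MonPrefixAutomatic {([c, c, c], [d, c])} := by
  refine mkPA' id [(c, ⟨[([], [c])], [([d], [d])], [([c, c], [d])]⟩),
    (c, ⟨[([], [c, c])], [([d], [d])], [([c], [])]⟩)] (n9_nf c d h) (by simp) ?_ ?_ ?_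
  · have key : ∀ (M : Type) [Monoid M] (f : α → M), f c * (f c * f c) = f d * f c →
        ∀ n, f d ^ n * f c = f c ^ (2 * n + 1) := by
      intro M _ f hf n
      induction n with
      | zero => simp
      | succ n ih =>
        rw [pow_succ, mul_assoc, ← hf, ← mul_assoc, ih, ← pow_two, ← pow_add]
        congr 1
    simp only [List.mem_cons, List.not_mem_nil, or_false, forall_eq_or_imp, forall_eq]
    constructor
    · rintro r r' ⟨s, t, p, q, b', c, z, h1, h2, h3, rfl, rfl⟩
      obtain ⟨n, rfl, rfl⟩ := h2.single
      simp at h1 h3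
      obtain ⟨rfl, rfl⟩ := h1
      obtain ⟨rfl, rfl⟩ := h3
      simp only [ev_append, ev_replicate, ev_cons, ev_nil]
      apply WordEq.of_monoid
      simp
      intro M _ f hf
      rw [key M f hf, pow_succ', ← mul_assoc (f d), ← hf]
      simp only [mul_assoc]
    · rintro r r' ⟨s, t, p, q, b', c, z, h1, h2, h3, rfl, rfl⟩
      obtain ⟨n, rfl, rfl⟩ := h2.single
      simp at h1 h3
      obtain ⟨rfl, rfl⟩ := h1
      obtain ⟨rfl, rfl⟩ := h3
      simp only [ev_append, ev_replicate, ev_cons, ev_nil]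
      apply WordEq.of_monoid
      simp
      intro M _ f hf
      rw [key M f hf, ← mul_assoc (f d ^ n), key M f hf, ← pow_succ', ← pow_succ]
  · simp [Fm.Uni, Fm.Bi]
  · intro x r _
    by_cases hx : x = c
    · subst hx
      rcases n9_cases x d h r with ⟨n, z, rfl, e⟩ | ⟨n, z, rfl, hz, e⟩ | ⟨ht, e⟩
      · right
        refine ⟨_, by simp; exact .inl rfl, ?_⟩
        exact Fm.rel_rep d n [] [x] [x, x] [d] z (by simp) (by simp) (by simp) (by simp [e])
      · right
        refine ⟨_, by simp; exact .inr rfl, ?_⟩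
        exact Fm.rel_rep d n [] [x, x] [x] [] z (by simp) (by simp) (by simp) (by simp [e])
      · exact .inl e
    · simp [n9, hx]

/-! ### `aba = 1` -/

open Classical in
noncomputable def n6A {α : Type} (a : α) : List (Option α) → List (Option α)
  | none :: r => r
  | some x :: r => some a :: some x :: r
  | [] => [some a]

open Classical in
noncomputable def n6B {α : Type} (a : α) : List (Option α) → List (Option α)
  | none :: r => none :: none :: none :: r
  | some x :: some y :: r =>
    if x = a then (if y = a then r else none :: some y :: r) else none :: none :: some x :: some y :: r
  | some x :: none :: r => if x = a then none :: none :: r else none :: none :: some x :: none :: r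
  | [some x] => if x = a then [none] else [none, none, some x]
  | [] => [none, none]

open Classical in
noncomputable def n6 {α : Type} (a b c : α) (r : List (Option α)) : List (Option α) :=
  if c = a then n6A a r else if c = b then n6B a r else some c :: r

def n6K {α : Type} (a b : α) : List (List (Option α)) :=
  [[some b], [none, some a], [some a, none]]

theorem n6_nf {α : Type} [Fintype α] (a b : α) (h1 : a ≠ b) :
    NF {([a, b, a], [])} (gE [a, b]) (Irr (n6K a b)) (n6 a b) := by
  have hA : ∀ r, Irr (n6K a b) r → Irr (n6K a b) (n6A a r) := by
    intro r
    unfold n6K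
    fun_cases n6A a r <;> simp [irr_cons, irr_nil] <;> grind [List.cons_prefix_cons]
  have hB : ∀ r, Irr (n6K a b) r → Irr (n6K a b) (n6B a r) := by
    intro r
    unfold n6K
    fun_cases n6B a r <;> simp [irr_cons, irr_nil] <;> grind [List.cons_prefix_cons]
  have hR : ∀ r, Irr (n6K a b) r → n6A a (n6B a (n6A a r)) = r := by
    intro r
    unfold n6K
    rcases r with _ | ⟨_ | x, _ | ⟨_ | y, _ | ⟨_ | z, r⟩⟩⟩ <;> simp [n6A, n6B, irr_cons] <;>
      grind [n6A, n6B]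
  have hN : ∀ r, Irr (n6K a b) (none :: r) → n6B a (n6A a r) = none :: r := by
    intro r
    unfold n6K
    rcases r with _ | ⟨_ | x, _ | ⟨_ | y, _ | ⟨_ | z, r⟩⟩⟩ <;> simp [n6A, n6B, irr_cons] <;>
      grind [n6A, n6B]
  refine mkNF (by simp [n6K]) ?_ ?_ ?_
  · intro c r h
    unfold n6
    split_ifs with hc hq
    · exact hA r h
    · exact hB r h
    · simp [irr_cons, h]; simp [n6K]; grind
  · intro r hr
    simp [actW, n6, h1.symm, hR r hr]
  · intro c r h
    rcases c with _ | c
    · simp [gE, actW, n6, h1.symm, hN r h]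
    · simp [actW, n6, gE]
      split_ifs with hc hq
      · subst hc
        rcases r with _ | ⟨_ | x, r⟩ <;> simp [n6A]
        simp [n6K, irr_cons] at h
      · subst hq
        simp [n6K, irr_cons] at h
      · rfl

theorem n6_ba {α : Type} [Fintype α] (a b : α) (h1 : a ≠ b) :
    MonPrefixAutomatic {([a, b, a], [])} ∧ MonBiautomatic {([a, b, a], [])} := by
  have key : ∀ (M : Type) [Monoid M] (f : α → M), f a * (f b * f a) = 1 →
        f a * f b = f b * f a ∧ f a * (f a * f b) = 1 ∧ f b * (f a * f a) = 1 := by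
    intro M _ f h
    have e : f a * f b = f b * f a := by
      calc f a * f b = f a * f b * (f a * (f b * f a)) := by rw [h, mul_one]
        _ = f a * (f b * f a) * (f b * f a) := by simp only [mul_assoc]
        _ = _ := by rw [h, one_mul]
    refine ⟨e, by rw [e, h], ?_⟩
    rw [← mul_assoc, ← e, mul_assoc, h]
  have hc : ∀ c r, Irr (n6K a b) r → n6 a b c r = some c :: r ∨ ∃ f, (c, f) ∈
      [(a, (⟨[([], [])], [], [([none], [])]⟩ : Fm (Option α))),
       (b, ⟨[([], [])], [], [([], [none, none]), ([some a], [none]), ([some a, some a], [])]⟩)] ∧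
        f.rel r (n6 a b c r) := by
    intro c r h
    unfold n6
    split_ifs with hc hq
    · fun_cases n6A a r
      · right
        refine ⟨_, by simp [hc]; exact .inl rfl, ?_⟩
        exact Fm.rel_base [] [] [none] [] _ (by simp) (by simp) rfl rfl
      · simp [hc]
      · simp [hc]
    · right
      refine ⟨_, by simp [hq]; exact .inr rfl, ?_⟩
      fun_cases n6B a r
      · exact Fm.rel_base [] [] [] [none, none] _ (by simp) (by simp) rfl rfl
      · exact Fm.rel_base [] [] [_, _] [] _ (by simp) (by simp) rfl rfl
      · exact Fm.rel_base [] [] [_] [none] _ (by simp) (by simp) rfl rfl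
      · exact Fm.rel_base [] [] [] [none, none] _ (by simp) (by simp) rfl rfl
      · exact Fm.rel_base [] [] [_] [none] _ (by simp) (by simp) rfl rfl
      · exact Fm.rel_base [] [] [] [none, none] _ (by simp) (by simp) rfl rfl
      · exact Fm.rel_base [] [] [_] [none] _ (by simp) (by simp) rfl rfl
      all_goals exact Fm.rel_base [] [] [] [none, none] _ (by simp) (by simp) rfl rfl
    · simp
  have hK : ∀ r, Irr ((n6K a b).map List.reverse) r ↔ Irr (n6K a b) r := by
    intro r
    simp [n6K, Irr]
    grind
  refine mkBA some _ _ (n6 a b) (n6_nf a b h1) (by simp [gE]) ?_ ?_ hc ?_ ?_ ?_ (fun c r h => hc c r ((hK r).1 h))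
  · simp only [List.mem_cons, forall_eq_or_imp, List.not_mem_nil, false_imp_iff, implies_true,
      and_true]
    refine ⟨⟨[a], ?_⟩, ⟨[b], ?_⟩⟩
    · simp [ev_nil, ev_cons, gE, WordEq.refl]
      exact .of_mem rfl
    · simp [ev_nil, ev_cons, gE, WordEq.refl]
      refine ⟨?_, ?_⟩ <;> apply WordEq.of_monoid <;> simp <;> intro M _ f h <;> have := key M f h <;> grind [mul_assoc, one_mul, mul_one]
  · simp [Fm.Bi]
  · intro c r h
    rw [hK] at h ⊢
    exact (n6_nf a b h1).pres c r h
  · simp only [List.mem_cons, forall_eq_or_imp, List.not_mem_nil, false_imp_iff, implies_true,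
      and_true]
    refine ⟨⟨[a], ?_⟩, ⟨[b], ?_⟩⟩
    · simp [expandW_nil, expandW_cons, gE, WordEq.refl]
      apply WordEq.of_monoid <;> simp <;> intro M _ f h <;> have := key M f h <;> grind [mul_assoc]
    · simp [expandW_nil, expandW_cons, gE, WordEq.refl]
      refine ⟨?_, ?_, ?_⟩ <;> apply WordEq.of_monoid <;> simp <;> intro M _ f h <;> have := key M f h <;> grind [mul_assoc, one_mul, mul_one]
  · simp [Fm.Bi]

open Classical in
/-- Insert `a ^ k` behind the initial block of letters `a` and `b`. -/
noncomputable def insA {α : Type} (a b : α) (k : ℕ) : List α → List α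
  | x :: r => if x = a ∨ x = b then x :: insA a b k r else List.replicate k a ++ x :: r
  | [] => List.replicate k a

theorem insA_rep {α : Type} {a b x : α} (hx : ¬ (x = a ∨ x = b)) (hab : a ≠ b) (r t : List α)
    (ht : ∀ y ∈ t, y = a ∨ y = b) (k : ℕ) : ¬ t ++ [b] <+: List.replicate k a ++ x :: r := by
  induction k generalizing t with
  | zero =>
    rcases t with _ | ⟨z, t⟩
    · simp; grind
    · simp at ht ⊢; grind
  | succ k ih =>
    rcases t with _ | ⟨z, t⟩
    · simp [List.replicate_succ]; grind
    · simp [List.replicate_succ] at ht ⊢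
      intro _
      exact ih t ht.2

theorem insA_pre {α : Type} {a b : α} (hab : a ≠ b) (k : ℕ) (r t : List α)
    (ht : ∀ y ∈ t, y = a ∨ y = b) (h : t ++ [b] <+: insA a b k r) : t ++ [b] <+: r := by
  fun_induction insA a b k r generalizing t
  · next x r hx ih =>
    rcases t with _ | ⟨z, t⟩
    · simpa using h
    · simp at h ht ⊢
      exact ⟨h.1, ih t ht.2 h.2⟩
  · next x r hx => exact (insA_rep hx hab r t ht k h).elim
  · have := h.subset (a := b) (by simp)
    simp at this
    exact (hab this.2.symm).elim

theorem irr_insA {α : Type} {a b : α} (hab : a ≠ b) (k : ℕ) {K : List (List α)}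
    (hK : ∀ f ∈ K, ∃ t, f = t ++ [b] ∧ ∀ y ∈ t, y = a ∨ y = b) (s r : List α)
    (h : Irr K (s ++ r)) : Irr K (s ++ insA a b k r) := by
  induction s with
  | nil =>
    simp only [List.nil_append] at h ⊢
    fun_induction insA a b k r
    · next x r hx ih =>
      rw [irr_cons] at h ⊢
      refine ⟨?_, ih h.2⟩
      intro f hf hh
      obtain ⟨t, rfl, ht⟩ := hK f hf
      refine h.1 _ hf (insA_pre hab k _ t ht ?_)
      simpa [insA, hx] using hh
    · rename_i r hx
      induction k with
      | zero => exact h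
      | succ k ih =>
        rw [List.replicate_succ, List.cons_append, irr_cons]
        refine ⟨?_, ih⟩
        intro f hf
        obtain ⟨t, rfl, ht⟩ := hK f hf
        exact insA_rep hx hab _ t ht (k + 1)
    · intro f hf hh
      obtain ⟨t, rfl, ht⟩ := hK f hf
      have := hh.subset (a := b) (by simp)
      simp at this
      exact hab this.2.symm
  | cons c s ih =>
    rw [List.cons_append, irr_cons] at h ⊢
    refine ⟨?_, ih h.2⟩
    intro f hf hh
    obtain ⟨t, rfl, ht⟩ := hK f hf
    refine h.1 _ hf ?_
    clear h ih hf
    rw [← List.cons_append] at hh ⊢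
    generalize c :: s = s' at hh
    induction s' generalizing t with
    | nil => exact insA_pre hab k r t ht hh
    | cons d s ih =>
      rcases t with _ | ⟨z, t⟩
      · simpa using hh
      · simp at hh ht ⊢
        exact ⟨hh.1, ih t ht.2 hh.2⟩

theorem insA_rel {α : Type} {a b : α} {k : ℕ} {T : List (List α × List α)} (s t r : List α)
    (h : (s, t) ∈ T) : Fm.rel ⟨T, [([a], [a]), ([b], [b])], [([], List.replicate k a)]⟩ (s ++ r)
      (t ++ insA a b k r) := by
  have : ∃ p q z, PS [([a], [a]), ([b], [b])] p q ∧ r = p ++ z ∧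
      insA a b k r = q ++ (List.replicate k a ++ z) := by
    clear h
    fun_induction insA a b k r
    · next x r hx ih =>
      obtain ⟨p, q, z, h1, h2, h3⟩ := ih
      refine ⟨[x] ++ p, [x] ++ q, z, .step ?_ h1, by simp [h2], by simp [h3]⟩
      rcases hx with rfl | rfl <;> simp
    · next x r hx => exact ⟨[], [], _, .nil, rfl, rfl⟩
    · exact ⟨[], [], [], .nil, rfl, by simp⟩
  obtain ⟨p, q, z, h1, h2, h3⟩ := this
  exact ⟨s, t, p, q, [], List.replicate k a, z, h, h1, by simp, by simp [h2], by simp [h3]⟩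

/-! ### `aaa = bbb` -/

open Classical in
noncomputable def n14B {α : Type} (a b : α) : List α → List α
  | x :: y :: z :: r =>
    if x = a ∧ y = a ∧ z = a then a :: a :: a :: n14B a b r
    else if x = b ∧ y = b then a :: a :: a :: z :: r else b :: x :: y :: z :: r
  | [x, y] => if x = b ∧ y = b then [a, a, a] else [b, x, y]
  | [x] => [b, x]
  | [] => [b]

open Classical in
noncomputable def n14 {α : Type} (a b c : α) (r : List α) : List α :=
  if c = b then n14B a b r else c :: r

theorem n14_nf {α : Type} [Fintype α] (a b : α) (h1 : a ≠ b) :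
    NF {([a, a, a], [b, b, b])} (fun c => [c]) (Irr [[b, b, b], [b, a, a, a]]) (n14 a b) := by
  have hA : ∀ r, Irr [[b, b, b], [b, a, a, a]] r → Irr [[b, b, b], [b, a, a, a]] (n14B a b r) := by
    intro r
    fun_induction n14B a b r <;> simp [irr_cons, irr_nil] <;> grind
  have hP : ∀ r, Irr [[b, b, b], [b, a, a, a]] (b :: r) → n14B a b r = b :: r := by
    intro r
    fun_cases n14B a b r <;> simp_all [irr_cons]
  have hS : ∀ y r, y ≠ a → y ≠ b → n14B a b (y :: r) = b :: y :: r := by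
    intro y r hy hy'
    rcases r with _ | ⟨z, _ | ⟨w, r⟩⟩ <;> simp [n14B, hy, hy']
  have hDD : ∀ r, Irr [[b, b, b], [b, a, a, a]] r →
      n14B a b (n14B a b (n14B a b r)) = a :: a :: a :: r := by
    intro r
    fun_induction n14B a b r <;> intro h
    · grind [irr_cons, n14B]
    · next x y z r hn hx =>
      obtain ⟨rfl, rfl⟩ := hx
      have e1 := hP _ h
      have e2 := hP _ (irr_cons.1 h).2
      simp [n14B, e1, e2]
    · grind [irr_cons, n14B]
    · grind [irr_cons, n14B]
    · grind [irr_cons, n14B]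
    · grind [irr_cons, n14B]
    · grind [irr_cons, n14B]
  refine mkNF (by simp) ?_ ?_ ?_
  · intro c r h
    unfold n14
    split_ifs with hc
    · exact hA r h
    · simp [irr_cons, h]; grind
  · intro r hr
    simp [actW, n14, h1, hDD r hr]
  · intro c r h
    simp [actW, n14]
    grind

open Classical in
noncomputable def n14L {α : Type} (a b c : α) (r : List α) : List α :=
  if c = a ∧ [a, a, b] <+: r then b :: insA a b 3 (r.drop 3)
  else if c = b ∧ [b, b] <+: r then insA a b 3 (r.drop 2) else c :: r

theorem n14_ba {α : Type} [Fintype α] (a b : α) (h1 : a ≠ b) :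
    MonPrefixAutomatic {([a, a, a], [b, b, b])} ∧ MonBiautomatic {([a, a, a], [b, b, b])} := by
  have key : ∀ (M : Type) [Monoid M] (f : α → M), f a * (f a * f a) = f b * (f b * f b) →
      f a * (f a * (f a * f b)) = f b * (f a * (f a * f a)) := by
    intro M _ f h
    rw [h]
    have := congrArg (· * f b) h
    simpa only [mul_assoc] using this
  refine mkBA id [(b, ⟨[([], [])], [([a, a, a], [a, a, a])], [([], [b]), ([b, b], [a, a, a])]⟩)]
    [(a, ⟨[([a, a, b], [b])], [([a], [a]), ([b], [b])], [([], List.replicate 3 a)]⟩),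
     (b, ⟨[([b, b], [])], [([a], [a]), ([b], [b])], [([], List.replicate 3 a)]⟩)] (n14L a b)
    (n14_nf a b h1) (by simp) ?_ ?_ ?_ ?_ ?_ ?_ ?_
  · simp only [List.mem_singleton, forall_eq]
    refine ⟨[b], ?_⟩
    simp [ev_nil, ev_cons, WordEq.refl]
    refine ⟨?_, ?_⟩ <;> apply WordEq.of_monoid <;> simp <;> intro M _ f h <;>
      have := key M f h <;> grind [mul_assoc]
  · simp [Fm.Bi]
  · intro c r h
    unfold n14
    split_ifs with hc
    · right
      simp [hc]
      fun_induction n14B a b r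
      · next x y z r hx ih =>
        obtain ⟨rfl, rfl, rfl⟩ := hx
        exact Fm.rel_step [_, _, _] [_, _, _] (by simp) (by grind [irr_cons])
      · next x y z r hn hx =>
        obtain ⟨rfl, rfl⟩ := hx
        exact Fm.rel_base [] [] [_, _] [a, a, a] _ (by simp) (by simp) rfl rfl
      · exact Fm.rel_base [] [] [] [b] _ (by simp) (by simp) rfl rfl
      · next x y hx =>
        obtain ⟨rfl, rfl⟩ := hx
        exact Fm.rel_base [] [] [_, _] [a, a, a] [] (by simp) (by simp) rfl rfl
      all_goals exact Fm.rel_base [] [] [] [b] _ (by simp) (by simp) rfl rfl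
    · simp
  · intro c r h
    have hK : ∀ f ∈ List.map List.reverse [[b, b, b], [b, a, a, a]],
        ∃ t, f = t ++ [b] ∧ ∀ y ∈ t, y = a ∨ y = b := by
      simp
      refine ⟨⟨[b, b], by simp⟩, ⟨[a, a, a], by simp⟩⟩
    unfold n14L
    split_ifs with hc hc
    · obtain ⟨rfl, s, rfl⟩ := hc
      refine irr_insA h1 3 hK [b] _ ?_
      exact (irr_cons.1 (irr_cons.1 h).2).2
    · obtain ⟨rfl, s, rfl⟩ := hc
      refine irr_insA h1 3 hK [] _ ?_
      exact (irr_cons.1 (irr_cons.1 h).2).2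
    · rw [irr_cons]
      refine ⟨?_, h⟩
      simp
      grind
  · simp only [List.mem_cons, forall_eq_or_imp, List.not_mem_nil, false_imp_iff, implies_true,
      and_true]
    refine ⟨⟨[a, a, a], ?_⟩, ⟨[a, a, a], ?_⟩⟩
    all_goals
      simp [expandW_nil, expandW_cons, WordEq.refl]
      try refine ⟨?_, ?_⟩
      all_goals
        apply WordEq.of_monoid <;> simp <;> intro M _ f h <;> have := key M f h <;> grind [mul_assoc]
  · simp [Fm.Bi]
    rintro _ _ (⟨rfl, rfl⟩ | ⟨rfl, rfl⟩) <;> simp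
  · intro c r h
    unfold n14L
    split_ifs with hc hc
    · right
      obtain ⟨rfl, s, rfl⟩ := hc
      refine ⟨_, List.mem_cons_self, ?_⟩
      exact insA_rel [c, c, b] [b] s (by simp)
    · right
      obtain ⟨rfl, s, rfl⟩ := hc
      refine ⟨_, List.mem_cons_of_mem _ List.mem_cons_self, ?_⟩
      exact insA_rel [c, c] [] s (by simp)
    · simp

/-! ### `aaa = bab` -/

open Classical in
noncomputable def n18B {α : Type} (a b : α) : List α → List α
  | x :: y :: z :: w :: r =>
    if x = a ∧ y = a ∧ z = a ∧ w = a then a :: a :: a :: a :: n18B a b r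
    else if x = a ∧ y = b then a :: a :: a :: z :: w :: r else b :: x :: y :: z :: w :: r
  | [x, y, z] => if x = a ∧ y = b then [a, a, a, z] else [b, x, y, z]
  | [x, y] => if x = a ∧ y = b then [a, a, a] else [b, x, y]
  | [x] => [b, x]
  | [] => [b]

open Classical in
noncomputable def n18 {α : Type} (a b c : α) (r : List α) : List α :=
  if c = b then n18B a b r else c :: r

theorem n18_nf {α : Type} [Fintype α] (a b : α) (h1 : a ≠ b) :
    NF {([a, a, a], [b, a, b])} (fun c => [c]) (Irr [[b, a, b], [b, a, a, a, a]]) (n18 a b) := by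
  have hA : ∀ r, Irr [[b, a, b], [b, a, a, a, a]] r → Irr [[b, a, b], [b, a, a, a, a]] (n18B a b r) := by
    intro r
    fun_induction n18B a b r <;> simp [irr_cons, irr_nil] <;> grind
  have hP : ∀ r, Irr [[b, a, b], [b, a, a, a, a]] (b :: r) → n18B a b r = b :: r := by
    intro r
    fun_cases n18B a b r <;> simp_all [irr_cons]
  have hAB : ∀ r, n18B a b (a :: b :: r) = a :: a :: a :: r := by
    intro r
    rcases r with _ | ⟨x, _ | ⟨y, r⟩⟩ <;> simp [n18B, h1.symm]
  have hQ : ∀ r, n18B a b (a :: a :: a :: a :: r) = a :: a :: a :: a :: n18B a b r := by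
    intro r
    simp [n18B]
  have hDD : ∀ r, Irr [[b, a, b], [b, a, a, a, a]] r →
      n18B a b (a :: n18B a b r) = a :: a :: a :: r := by
    intro r
    fun_induction n18B a b r <;> intro h
    · next x y z w r hx ih =>
      obtain ⟨rfl, rfl, rfl, rfl⟩ := hx
      rw [hQ, ih]
      exact (irr_cons.1 (irr_cons.1 (irr_cons.1 (irr_cons.1 h).2).2).2).2
    · next x y z w r hn hx =>
      obtain ⟨rfl, rfl⟩ := hx
      rw [hQ, hP]
      exact (irr_cons.1 h).2
    · rw [hAB]
    · next x y z hx =>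
      obtain ⟨rfl, rfl⟩ := hx
      rw [hQ, hP]
      exact (irr_cons.1 h).2
    · rw [hAB]
    · next x y hx =>
      obtain ⟨rfl, rfl⟩ := hx
      rw [hQ, hP]
      exact (irr_cons.1 h).2
    · rw [hAB]
    · rw [hAB]
    · rw [hAB]
  refine mkNF (by simp) ?_ ?_ ?_
  · intro c r h
    unfold n18
    split_ifs with hc
    · exact hA r h
    · simp [irr_cons, h]; grind
  · intro r hr
    simp [actW, n18, h1, hDD r hr]
  · intro c r h
    simp [actW, n18]
    grind

open Classical in
noncomputable def n18L {α : Type} (a b c : α) (r : List α) : List α :=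
  if c = a ∧ [a, a, a, b] <+: r then b :: insA a b 4 (r.drop 4)
  else if c = b ∧ [a, b, a, a, b] <+: r then a :: b :: insA a b 4 (r.drop 5)
  else if c = b ∧ [a, b, a, a, a, b] <+: r then a :: a :: b :: insA a b 4 (r.drop 6)
  else if c = b ∧ [a, b] <+: r then a :: a :: a :: r.drop 2
  else c :: r

theorem n18_ba {α : Type} [Fintype α] (a b : α) (h1 : a ≠ b) :
    MonPrefixAutomatic {([a, a, a], [b, a, b])} ∧ MonBiautomatic {([a, a, a], [b, a, b])} := by
  have key : ∀ (M : Type) [Monoid M] (f : α → M), f a * (f a * f a) = f b * (f a * f b) →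
      f a * (f a * (f a * (f a * f b))) = f b * (f a * (f a * (f a * f a))) := by
    intro M _ f h
    calc f a * (f a * (f a * (f a * f b))) = (f a * (f a * f a)) * (f a * f b) := by
          simp only [mul_assoc]
      _ = f b * (f a * (f b * (f a * f b))) := by rw [h]; simp only [mul_assoc]
      _ = _ := by rw [← h]
  refine mkBA id [(b, ⟨[([], [])], [([a, a, a, a], [a, a, a, a])], [([], [b]), ([a, b], [a, a, a])]⟩)]
    [(a, ⟨[([a, a, a, b], [b])], [([a], [a]), ([b], [b])], [([], List.replicate 4 a)]⟩),
     (b, ⟨[([a, b, a, a, b], [a, b]), ([a, b, a, a, a, b], [a, a, b])], [([a], [a]), ([b], [b])],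
        [([], List.replicate 4 a)]⟩),
     (b, ⟨[([a, b], [a, a, a])], [], [([], [])]⟩)] (n18L a b)
    (n18_nf a b h1) (by simp) ?_ ?_ ?_ ?_ ?_ ?_ ?_
  · simp only [List.mem_singleton, forall_eq]
    refine ⟨[b], ?_⟩
    simp [ev_nil, ev_cons, WordEq.refl]
    refine ⟨?_, ?_⟩ <;> apply WordEq.of_monoid <;> simp <;> intro M _ f h <;>
      have := key M f h <;> grind [mul_assoc]
  · simp [Fm.Bi]
  · intro c r h
    unfold n18
    split_ifs with hc
    · right
      simp [hc]
      fun_induction n18B a b r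
      · next x y z w r hx ih =>
        obtain ⟨rfl, rfl, rfl, rfl⟩ := hx
        exact Fm.rel_step [_, _, _, _] [_, _, _, _] (by simp) (by grind [irr_cons])
      · next x y z w r hn hx =>
        obtain ⟨rfl, rfl⟩ := hx
        exact Fm.rel_base [] [] [_, _] [_, _, _] _ (by simp) (by simp) rfl rfl
      · exact Fm.rel_base [] [] [] [b] _ (by simp) (by simp) rfl rfl
      · next x y z hx =>
        obtain ⟨rfl, rfl⟩ := hx
        exact Fm.rel_base [] [] [_, _] [_, _, _] [z] (by simp) (by simp) rfl rfl
      · exact Fm.rel_base [] [] [] [b] _ (by simp) (by simp) rfl rfl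
      · next x y hx =>
        obtain ⟨rfl, rfl⟩ := hx
        exact Fm.rel_base [] [] [_, _] [_, _, _] [] (by simp) (by simp) rfl rfl
      all_goals exact Fm.rel_base [] [] [] [b] _ (by simp) (by simp) rfl rfl
    · simp
  · intro c r h
    have hK : ∀ f ∈ List.map List.reverse [[b, a, b], [b, a, a, a, a]],
        ∃ t, f = t ++ [b] ∧ ∀ y ∈ t, y = a ∨ y = b := by
      simp
      refine ⟨⟨[b, a], by simp⟩, ⟨[a, a, a, a], by simp⟩⟩
    unfold n18L
    split_ifs with hc hc hc hc
    · obtain ⟨rfl, s, rfl⟩ := hc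
      refine irr_insA h1 4 hK [b] _ ?_
      exact (irr_cons.1 (irr_cons.1 (irr_cons.1 h).2).2).2
    · obtain ⟨rfl, s, rfl⟩ := hc
      refine irr_insA h1 4 hK [a, c] _ ?_
      exact (irr_cons.1 (irr_cons.1 (irr_cons.1 h).2).2).2
    · obtain ⟨rfl, s, rfl⟩ := hc
      refine irr_insA h1 4 hK [a, a, c] _ ?_
      exact (irr_cons.1 (irr_cons.1 (irr_cons.1 h).2).2).2
    · obtain ⟨rfl, s, rfl⟩ := hc
      simp [irr_cons] at *
      grind [List.cons_prefix_cons]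
    · rw [irr_cons]
      refine ⟨?_, h⟩
      simp
      grind
  · simp only [List.mem_cons, forall_eq_or_imp, List.not_mem_nil, false_imp_iff, implies_true,
      and_true]
    refine ⟨⟨[a, a, a, a], ?_⟩, ⟨[a, a, a, a], ?_⟩, ⟨[], ?_⟩⟩
    all_goals
      simp [expandW_nil, expandW_cons, WordEq.refl]
    · apply WordEq.of_monoid <;> simp <;> intro M _ f h <;> have := key M f h <;> grind [mul_assoc]
    · refine ⟨⟨?_, ?_⟩, ?_⟩
      · apply WordEq.of_monoid <;> simp <;> intro M _ f h <;> have := key M f h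
        calc _ = f b * (f a * f b) * (f a * (f a * f b)) := by simp only [mul_assoc]
          _ = f a * (f a * (f a * (f a * (f a * f b)))) := by rw [← h]; simp only [mul_assoc]
          _ = _ := by rw [this]
      · apply WordEq.of_monoid <;> simp <;> intro M _ f h <;> have := key M f h
        calc _ = f b * (f a * f b) * (f a * (f a * (f a * f b))) := by simp only [mul_assoc]
          _ = f a * (f a * (f a * (f a * (f a * (f a * f b))))) := by rw [← h]; simp only [mul_assoc]
          _ = _ := by rw [this]
      · apply WordEq.of_monoid <;> simp <;> intro M _ f h <;> have := key M f h <;> grind [mul_assoc]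
    · exact .symm (.of_mem rfl)
  · simp [Fm.Bi]
    rintro _ _ (⟨rfl, rfl⟩ | ⟨rfl, rfl⟩) <;> simp
  · intro c r h
    unfold n18L
    split_ifs with hc hc hc hc
    · right
      obtain ⟨rfl, s, rfl⟩ := hc
      refine ⟨_, List.mem_cons_self, ?_⟩
      exact insA_rel [c, c, c, b] [b] s (by simp)
    · right
      obtain ⟨rfl, s, rfl⟩ := hc
      refine ⟨_, List.mem_cons_of_mem _ List.mem_cons_self, ?_⟩
      exact insA_rel [a, c, a, a, c] [a, c] s (by simp)
    · right
      obtain ⟨rfl, s, rfl⟩ := hc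
      refine ⟨_, List.mem_cons_of_mem _ List.mem_cons_self, ?_⟩
      exact insA_rel [a, c, a, a, a, c] [a, a, c] s (by simp)
    · right
      obtain ⟨rfl, s, rfl⟩ := hc
      refine ⟨_, List.mem_cons_of_mem _ (List.mem_cons_of_mem _ List.mem_cons_self), ?_⟩
      exact Fm.rel_base [a, c] [a, a, a] [] [] s (by simp) (by simp) rfl rfl
    · simp

/-! ### `aba = bab` -/

open Classical in
noncomputable def n15R {α : Type} (a b : α) : List (Option α) → List (Option α)
  | none :: r => none :: n15R b a r
  | some x :: some y :: r =>
    if x = b ∧ y = a then none :: r else some a :: some x :: some y :: r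
  | some x :: none :: r => some a :: some x :: none :: r
  | [some x] => [some a, some x]
  | [] => [some a]

def n15K {α : Type} (a b : α) : List (List (Option α)) :=
  [[some a, some b, some a], [some b, some a, some b], [some a, none], [some b, none]]

theorem n15K_swap {α : Type} (a b : α) (r : List (Option α)) :
    Irr (n15K a b) r ↔ Irr (n15K b a) r := by
  simp [n15K, Irr]
  grind

open Classical in
noncomputable def n15 {α : Type} (a b c : α) (r : List (Option α)) : List (Option α) :=
  if c = a then n15R a b r else if c = b then n15R b a r else some c :: r

theorem n15R_push {α : Type} (a b : α) (h1 : a ≠ b) (r : List (Option α))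
    (h : Irr (n15K a b) (some a :: r)) : n15R a b r = some a :: r := by
  unfold n15K at h
  rcases r with _ | ⟨_ | x, _ | ⟨_ | y, r⟩⟩ <;> simp_all [irr_cons, n15R]
  grind

theorem n15R_irr {α : Type} (a b : α) (h1 : a ≠ b) (r : List (Option α))
    (h : Irr (n15K a b) r) : Irr (n15K a b) (n15R a b r) := by
  fun_induction n15R a b r
  · next a b r ih =>
    have ih := (n15K_swap _ _ _).1 (ih h1.symm ((n15K_swap _ _ _).1 (irr_cons.1 h).2))
    rw [irr_cons]
    refine ⟨?_, ih⟩
    simp [n15K]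
  all_goals
    revert h
    simp [irr_cons, n15K, irr_nil] <;> grind [List.cons_prefix_cons]

theorem n15R_D {α : Type} (a b : α) (h1 : a ≠ b) (r : List (Option α))
    (h : Irr (n15K a b) r) : n15R a b (n15R b a (n15R a b r)) = none :: r := by
  have hS : ∀ a b y : α, ∀ r, y ≠ b → n15R a b (some y :: r) = some a :: some y :: r := by
    intro a b y r hy
    rcases r with _ | ⟨_ | z, r⟩ <;> simp [n15R, hy]
  fun_induction n15R a b r
  · next a b r ih =>
    simp only [n15R]
    rw [ih h1.symm ((n15K_swap _ _ _).1 (irr_cons.1 h).2)]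
  · next a b x y r hx =>
    obtain ⟨rfl, rfl⟩ := hx
    simp only [n15R]
    rw [n15R_push _ _ h1 r (irr_cons.1 h).2, n15R_push _ _ h1.symm _ ((n15K_swap _ _ _).1 h)]
  · next a b x y r hx =>
    by_cases hb : x = b
    · subst hb
      have e := n15R_push x a h1.symm _ ((n15K_swap _ _ _).1 h)
      simp [n15R, e]
    · simp [n15R, hb]
  · next a b x r =>
    by_cases hb : x = b
    · subst hb
      simp [irr_cons, n15K] at h
    · simp [n15R, hb]
  · next a b x =>
    by_cases hb : x = b
    · subst hb
      simp [n15R]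
    · simp [n15R, hb]
  · simp [n15R]

theorem n15_nf {α : Type} [Fintype α] (a b : α) (h1 : a ≠ b) :
    NF {([a, b, a], [b, a, b])} (gE [a, b, a]) (Irr (n15K a b)) (n15 a b) := by
  refine mkNF (by simp [n15K]) ?_ ?_ ?_
  · intro x r h
    unfold n15
    split_ifs with hc hq
    · exact n15R_irr a b h1 r h
    · exact (n15K_swap _ _ _).1 (n15R_irr b a h1.symm r ((n15K_swap _ _ _).1 h))
    · simp [irr_cons, h]; simp [n15K]; grind
  · intro r hr
    simp [actW, n15, h1.symm, n15R_D a b h1 r hr, n15R_D b a h1.symm r ((n15K_swap _ _ _).1 hr)]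
  · intro x r h
    rcases x with _ | x
    · simp [gE, actW, n15, h1.symm, n15R_D a b h1 r (irr_cons.1 h).2]
    · simp [actW, n15, gE]
      split_ifs with hc hq
      · subst hc; exact n15R_push _ _ h1 r h
      · subst hq; exact n15R_push _ _ h1.symm r ((n15K_swap _ _ _).1 h)
      · rfl

open Classical in
noncomputable def n15I {α : Type} (a b : α) : List (Option α) → List (Option α)
  | none :: r => none :: n15I a b r
  | some x :: r =>
    if x = a then some b :: n15I a b r else if x = b then some a :: n15I a b r
    else none :: some x :: r
  | [] => [none]

open Classical in
noncomputable def n15L {α : Type} (a b c : α) (r : List (Option α)) : List (Option α) :=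
  if c = a ∧ [some b, some a] <+: r then n15I a b (r.drop 2)
  else if c = b ∧ [some a, some b] <+: r then n15I a b (r.drop 2) else some c :: r

def n15F0 {α : Type} (a b : α) : Fm (Option α) :=
  ⟨[([], [])], [([none, none], [none, none])], [([], [some a]), ([some b, some a], [none])]⟩

def n15F1 {α : Type} (a b : α) : Fm (Option α) :=
  ⟨[([none], [none])], [([none, none], [none, none])], [([], [some b]), ([some a, some b], [none])]⟩

theorem n15R_rel {α : Type} (a b : α) (r : List (Option α)) :
    (n15F0 a b).rel r (n15R a b r) ∨ (n15F1 a b).rel r (n15R a b r) := by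
  fun_induction n15R a b r
  · next a b r ih =>
    rcases ih with ih | ih
    · right
      obtain ⟨s, t, p, q, b', c, z, h1, h2, h3, e1, e2⟩ := ih
      simp [n15F0] at h1 h2 h3
      obtain ⟨rfl, rfl⟩ := h1
      exact ⟨[none], [none], p, q, b', c, z, by simp [n15F1], h2, by simpa [n15F1] using h3, by simp [e1],
        by simp [e2]⟩
    · left
      obtain ⟨s, t, p, q, b', c, z, h1, h2, h3, e1, e2⟩ := ih
      simp [n15F1] at h1 h2 h3
      obtain ⟨rfl, rfl⟩ := h1
      exact ⟨[], [], [none, none] ++ p, [none, none] ++ q, b', c, z, by simp [n15F0],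
        .step (by simp [n15F0]) h2, by simpa [n15F0] using h3, by simp [e1], by simp [e2]⟩
  · next x y r hx =>
    left
    obtain ⟨rfl, rfl⟩ := hx
    exact Fm.rel_base [] [] [_, _] [none] _ (by simp) (by simp) rfl rfl
  all_goals
    left
    exact Fm.rel_base [] [] [] [some _] _ (by simp) (.head _) rfl rfl

theorem n15I_rel {α : Type} (a b : α) (s r : List (Option α)) :
    Fm.rel ⟨[(s, [])], [([some a], [some b]), ([some b], [some a]), ([none], [none])],
      [([], [none])]⟩ (s ++ r) (n15I a b r) := by
  have : ∃ p q z, PS [([some a], [some b]), ([some b], [some a]), ([none], [none])] p q ∧ r = p ++ z ∧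
      n15I a b r = q ++ ([none] ++ z) := by
    fun_induction n15I a b r
    · next r ih =>
      obtain ⟨p, q, z, h1, h2, h3⟩ := ih
      exact ⟨[none] ++ p, [none] ++ q, z, .step (by simp) h1, by simp [h2], by simp [h3]⟩
    · next r ih =>
      obtain ⟨p, q, z, h1, h2, h3⟩ := ih
      exact ⟨[some a] ++ p, [some b] ++ q, z, .step (by simp) h1, by simp [h2], by simp [h3]⟩
    · next r _ ih =>
      obtain ⟨p, q, z, h1, h2, h3⟩ := ih
      exact ⟨[some b] ++ p, [some a] ++ q, z, .step (by simp) h1, by simp [h2], by simp [h3]⟩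
    · exact ⟨[], [], _, .nil, rfl, rfl⟩
    · exact ⟨[], [], [], .nil, rfl, by simp⟩
  obtain ⟨p, q, z, h1, h2, h3⟩ := this
  exact ⟨s, [], p, q, [], [none], z, by simp, h1, by simp, by simp [h2], by simp [h3]⟩

theorem n15I_irr {α : Type} (a b : α) (h1 : a ≠ b) (r : List (Option α))
    (h : Irr ((n15K a b).map List.reverse) r) :
    Irr ((n15K a b).map List.reverse) (n15I a b r) := by
  have e1 : ∀ r, [some a] <+: n15I a b r ↔ [some b] <+: r := by
    intro r
    rcases r with _ | ⟨_ | x, r⟩ <;> simp [n15I] <;> grind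
  have e2 : ∀ r, [some b] <+: n15I a b r ↔ [some a] <+: r := by
    intro r
    rcases r with _ | ⟨_ | x, r⟩ <;> simp [n15I] <;> grind
  have e3 : ∀ r, [some a, some b] <+: n15I a b r ↔ [some b, some a] <+: r := by
    intro r
    rcases r with _ | ⟨_ | x, r⟩ <;> simp [n15I] <;> grind
  have e4 : ∀ r, [some b, some a] <+: n15I a b r ↔ [some a, some b] <+: r := by
    intro r
    rcases r with _ | ⟨_ | x, r⟩ <;> simp [n15I] <;> grind
  simp only [n15K, List.map_cons, List.map_nil, List.reverse_cons, List.reverse_nil,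
    List.nil_append, List.cons_append] at h ⊢
  fun_induction n15I a b r
  all_goals
    simp_all [irr_cons, irr_nil]
  all_goals grind

theorem n15_ba {α : Type} [Fintype α] (a b : α) (h1 : a ≠ b) :
    MonPrefixAutomatic {([a, b, a], [b, a, b])} ∧ MonBiautomatic {([a, b, a], [b, a, b])} := by
  have key : ∀ (M : Type) [Monoid M] (f : α → M), f a * (f b * f a) = f b * (f a * f b) →
      f a * (f b * (f a * f a)) = f b * (f a * (f b * f a)) ∧
      f a * (f b * (f a * f b)) = f a * (f a * (f b * f a)) ∧
      f a * (f b * (f a * (f a * (f b * (f a * f a))))) =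
        f a * (f a * (f b * (f a * (f a * (f b * f a))))) ∧
      f a * (f b * (f a * (f a * (f b * (f a * f b))))) =
        f b * (f a * (f b * (f a * (f a * (f b * f a))))) := by
    intro M _ f h
    have k1 : f a * (f b * f a) * f a = f b * (f a * (f b * f a)) := by
      rw [h]; simp only [mul_assoc]; rw [← h]
    have k2 : f a * (f b * f a) * f b = f a * (f a * (f b * f a)) := by
      simp only [mul_assoc]; rw [← h]
    generalize hD : f a * (f b * f a) = D at k1 k2
    have k3 : D * (D * f a) = f a * (D * D) := by
      rw [k1, ← mul_assoc, k2, mul_assoc]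
    have k4 : D * (D * f b) = f b * (D * D) := by
      rw [k2, ← mul_assoc, k1, mul_assoc]
    subst hD
    simp only [mul_assoc] at k1 k2 k3 k4
    exact ⟨k1, k2, k3, k4⟩
  refine mkBA some [(a, n15F0 a b), (a, n15F1 a b), (b, n15F0 b a), (b, n15F1 b a)]
    [(a, ⟨[([some b, some a], [])], [([some a], [some b]), ([some b], [some a]), ([none], [none])],
      [([], [none])]⟩),
     (b, ⟨[([some a, some b], [])], [([some a], [some b]), ([some b], [some a]), ([none], [none])],
      [([], [none])]⟩)] (n15L a b)
    (n15_nf a b h1) (by simp [gE]) ?_ ?_ ?_ ?_ ?_ ?_ ?_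
  · simp only [List.mem_cons, forall_eq_or_imp, List.not_mem_nil, false_imp_iff, implies_true,
      and_true]
    refine ⟨⟨[a], ?_⟩, ⟨[b], ?_⟩, ⟨[b], ?_⟩, ⟨[a], ?_⟩⟩
    all_goals
      simp [ev_nil, ev_cons, gE, WordEq.refl, n15F0, n15F1]
    all_goals
      try refine ⟨?_, ?_⟩
    all_goals
      try refine ⟨?_, ?_⟩
    all_goals
      apply WordEq.of_monoid <;> simp <;> intro M _ f h <;> have := key M f h <;> grind [mul_assoc]
  · simp [Fm.Bi, n15F0, n15F1]
  · intro c r h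
    unfold n15
    split_ifs with hc hq
    · right
      subst hc
      rcases n15R_rel c b r with h | h
      · exact ⟨_, by simp, h⟩
      · exact ⟨_, by simp, h⟩
    · right
      subst hq
      rcases n15R_rel c a r with h | h
      · exact ⟨_, by simp, h⟩
      · exact ⟨_, by simp, h⟩
    · simp
  · intro c r h
    unfold n15L
    split_ifs with hc hc
    · obtain ⟨rfl, s, rfl⟩ := hc
      exact n15I_irr c b h1 _ (irr_cons.1 (irr_cons.1 h).2).2
    · obtain ⟨rfl, s, rfl⟩ := hc
      exact n15I_irr a c h1 _ (irr_cons.1 (irr_cons.1 h).2).2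
    · rw [irr_cons]
      refine ⟨?_, h⟩
      simp [n15K]
      grind
  · simp only [List.mem_cons, forall_eq_or_imp, List.not_mem_nil, false_imp_iff, implies_true,
      and_true]
    refine ⟨⟨[a, b, a], ?_⟩, ⟨[a, b, a], ?_⟩⟩
    all_goals
      simp [expandW_nil, expandW_cons, WordEq.refl, gE]
    all_goals
      try refine ⟨?_, ?_⟩
    all_goals
      try refine ⟨?_, ?_⟩
    all_goals
      apply WordEq.of_monoid <;> simp <;> intro M _ f h <;> have := key M f h <;> grind [mul_assoc]
  · simp [Fm.Bi]
    rintro _ _ (⟨rfl, rfl⟩ | ⟨rfl, rfl⟩ | ⟨rfl, rfl⟩) <;> simp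
  · intro c r h
    unfold n15L
    split_ifs with hc hc
    · right
      obtain ⟨rfl, s, rfl⟩ := hc
      exact ⟨_, List.mem_cons_self, n15I_rel _ _ _ s⟩
    · right
      obtain ⟨rfl, s, rfl⟩ := hc
      exact ⟨_, List.mem_cons_of_mem _ List.mem_cons_self, n15I_rel _ _ _ s⟩
    · simp

/-! ### `xyx = sts` -/

open Classical in
noncomputable def n16R {α : Type} (s t : α) : List (Option α) → List (Option α)
  | some z :: none :: r =>
    if z = t then none :: some t :: n16R s t r else some s :: some z :: none :: r
  | some z :: some w :: r =>
    if z = t ∧ w = s then none :: r else some s :: some z :: some w :: r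
  | [some z] => [some s, some z]
  | none :: r => some s :: none :: r
  | [] => [some s]

def n16K {α : Type} (x y s t : α) : List (List (Option α)) :=
  [[some s, some t, some s], [some s, some t, none], [some x, some y, some x],
    [some x, some y, none]]

theorem n16K_swap {α : Type} (x y s t : α) (r : List (Option α)) :
    Irr (n16K x y s t) r ↔ Irr (n16K s t x y) r := by
  simp [n16K, Irr]
  grind

open Classical in
noncomputable def n16 {α : Type} (x y s t c : α) (r : List (Option α)) : List (Option α) :=
  if c = x then n16R x y r else if c = s then n16R s t r else some c :: r

theorem n16R_push {α : Type} (s t : α) (K : List (List (Option α)))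
    (h1 : [some s, some t, some s] ∈ K) (h2 : [some s, some t, none] ∈ K) (r : List (Option α))
    (h : Irr K (some s :: r)) : n16R s t r = some s :: r := by
  have k1 := (irr_cons.1 h).1 _ h1
  have k2 := (irr_cons.1 h).1 _ h2
  fun_cases n16R s t r <;> simp_all

theorem n16R_head {α : Type} (s t : α) (r : List (Option α)) :
    ∃ r', n16R s t r = none :: r' ∨ n16R s t r = some s :: r' := by
  fun_cases n16R s t r <;> simp

theorem n16R_irr {α : Type} (x y s t : α) (h1 : x ≠ y) (h2 : s ≠ t) (h3 : s ≠ x)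
    (h4 : ¬ (t = x ∧ s = y)) (r : List (Option α))
    (h : Irr (n16K x y s t) r) : Irr (n16K x y s t) (n16R s t r) := by
  fun_induction n16R s t r
  · next r ih =>
    have ih := ih (irr_cons.1 (irr_cons.1 h).2).2
    obtain ⟨r', e | e⟩ := n16R_head s t r <;> rw [e] at ih ⊢ <;> simp [irr_cons, n16K] at ih ⊢ <;>
      grind
  all_goals
    revert h
    simp [irr_cons, n16K, irr_nil] <;> grind [List.cons_prefix_cons]

/-- Pushing `t` on a stack starting with `none` or `s`. -/
theorem n16R_mid {α : Type} (x y s t : α) (h1 : x ≠ y) (h2 : s ≠ t)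
    (h4 : ¬ (t = x ∧ s = y)) (r : List (Option α)) :
    n16 x y s t t (n16R s t r) = some t :: n16R s t r := by
  obtain ⟨r', e | e⟩ := n16R_head s t r <;> rw [e] <;> unfold n16 <;> split_ifs with hc
  · simp [n16R, hc]
  · rename_i hq; exact (h2 hq.symm).elim
  · rfl
  · subst hc
    have : s ≠ y := by grind
    rcases r' with _ | ⟨_ | z, r'⟩ <;> simp [n16R, this]
  · rename_i hq; exact (h2 hq.symm).elim
  · rfl

theorem n16R_D {α : Type} (s t : α) (h2 : s ≠ t) (K : List (List (Option α)))
    (h1 : [some s, some t, some s] ∈ K) (h3 : [some s, some t, none] ∈ K) (r : List (Option α))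
    (h : Irr K r) : n16R s t (some t :: n16R s t r) = none :: r := by
  fun_induction n16R s t r
  · next r ih =>
    simp [n16R, ih (irr_cons.1 (irr_cons.1 h).2).2]
  · simp [n16R]
  · next z w r hx =>
    obtain ⟨rfl, rfl⟩ := hx
    simp [n16R, n16R_push _ _ K h1 h3 r (irr_cons.1 h).2]
  all_goals simp [n16R]

theorem n16_nf {α : Type} [Fintype α] (x y s t : α) (h1 : x ≠ y) (h2 : s ≠ t) (h3 : s ≠ x)
    (h4 : ¬ (t = x ∧ s = y)) :
    NF {([x, y, x], [s, t, s])} (gE [x, y, x]) (Irr (n16K x y s t)) (n16 x y s t) := by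
  have hx : ∀ r, n16 x y s t x r = n16R x y r := by simp [n16]
  have hs : ∀ r, n16 x y s t s r = n16R s t r := by simp [n16, h3]
  have ht := n16R_mid x y s t h1 h2 h4
  have hy : ∀ r, n16 x y s t y (n16R x y r) = some y :: n16R x y r := by
    intro r
    rw [← n16R_mid s t x y h2 h1 (by grind) r]
    unfold n16
    grind
  have hDx : ∀ r, Irr (n16K x y s t) r → n16R x y (some y :: n16R x y r) = none :: r :=
    n16R_D x y h1 _ (by simp [n16K]) (by simp [n16K])
  have hDs : ∀ r, Irr (n16K x y s t) r → n16R s t (some t :: n16R s t r) = none :: r :=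
    n16R_D s t h2 _ (by simp [n16K]) (by simp [n16K])
  refine mkNF (by simp [n16K]) ?_ ?_ ?_
  · intro c r h
    unfold n16
    split_ifs with hc hq
    · exact (n16K_swap _ _ _ _ _).1 (n16R_irr s t x y h2 h1 h3.symm (by grind) r
        ((n16K_swap _ _ _ _ _).1 h))
    · exact n16R_irr x y s t h1 h2 h3 h4 r h
    · simp [irr_cons, h]; simp [n16K]; grind
  · intro r hr
    simp [actW, hx, hs, hy, ht, hDx r hr, hDs r hr]
  · intro c r h
    rcases c with _ | c
    · simp [gE, actW, hx, hy, hDx r (irr_cons.1 h).2]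
    · simp [actW, n16, gE]
      split_ifs with hc hq
      · subst hc; exact n16R_push _ _ _ (by simp [n16K]) (by simp [n16K]) r h
      · subst hq; exact n16R_push _ _ _ (by simp [n16K]) (by simp [n16K]) r h
      · rfl

def n16F {α : Type} (s t : α) : Fm (Option α) :=
  ⟨[([], [])], [([some t, none], [none, some t])], [([], [some s]), ([some t, some s], [none])]⟩

theorem n16R_rel {α : Type} (s t : α) (r : List (Option α)) :
    (n16F s t).rel r (n16R s t r) := by
  unfold n16F
  fun_induction n16R s t r
  · next r ih =>
    exact Fm.rel_step [_, _] [_, _] (by simp) ih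
  · next z r hx =>
    exact Fm.rel_base [] [] [] [some s] _ (by simp) (.head _) rfl rfl
  · next z w r hx =>
    obtain ⟨rfl, rfl⟩ := hx
    exact Fm.rel_base [] [] [_, _] [none] _ (by simp) (by simp) rfl rfl
  all_goals
    exact Fm.rel_base [] [] [] [some s] _ (by simp) (.head _) rfl rfl

open Classical in
noncomputable def n16I {α : Type} (x y s t : α) : List (Option α) → List (Option α)
  | p :: q :: r =>
    if p = some t ∧ q = some s then some s :: some t :: n16I x y s t r
    else if p = some y ∧ q = some x then some x :: some y :: n16I x y s t r
    else none :: p :: q :: r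
  | [p] => [none, p]
  | [] => [none]

open Classical in
noncomputable def n16L {α : Type} (x y s t c : α) (r : List (Option α)) : List (Option α) :=
  if c = x ∧ [some y, some x] <+: r then n16I x y s t (r.drop 2)
  else if c = s ∧ [some t, some s] <+: r then n16I x y s t (r.drop 2) else some c :: r

theorem n16I_rel {α : Type} (x y s t : α) (k r : List (Option α)) :
    Fm.rel ⟨[(k, [])], [([some t, some s], [some s, some t]), ([some y, some x], [some x, some y])],
      [([], [none])]⟩ (k ++ r) (n16I x y s t r) := by
  have : ∃ p q z, PS [([some t, some s], [some s, some t]), ([some y, some x], [some x, some y])]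
      p q ∧ r = p ++ z ∧ n16I x y s t r = q ++ ([none] ++ z) := by
    fun_induction n16I x y s t r
    · next p q r hx ih =>
      obtain ⟨rfl, rfl⟩ := hx
      obtain ⟨p, q, z, h1, h2, h3⟩ := ih
      exact ⟨[_, _] ++ p, [_, _] ++ q, z, .step (.head _) h1, by simp [h2], by simp [h3]⟩
    · next p q r _ hx ih =>
      obtain ⟨rfl, rfl⟩ := hx
      obtain ⟨p, q, z, h1, h2, h3⟩ := ih
      exact ⟨[_, _] ++ p, [_, _] ++ q, z, .step (.tail _ (.head _)) h1, by simp [h2], by simp [h3]⟩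
    · exact ⟨[], [], _, .nil, rfl, rfl⟩
    · exact ⟨[], [], _, .nil, rfl, rfl⟩
    · exact ⟨[], [], [], .nil, rfl, by simp⟩
  obtain ⟨p, q, z, h1, h2, h3⟩ := this
  exact ⟨k, [], p, q, [], [none], z, by simp, h1, by simp, by simp [h2], by simp [h3]⟩

theorem n16I_irr {α : Type} (x y s t : α) (h1 : x ≠ y) (h2 : s ≠ t) (h3 : s ≠ x)
    (h4 : ¬ (t = x ∧ s = y)) (r : List (Option α))
    (h : Irr ((n16K x y s t).map List.reverse) r) :
    Irr ((n16K x y s t).map List.reverse) (n16I x y s t r) := by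
  have e0 : ∀ r c, [some c] <+: n16I x y s t r →
      (c = s ∧ [some t, some s] <+: r) ∨ (c = x ∧ [some y, some x] <+: r) := by
    intro r c
    rcases r with _ | ⟨p, _ | ⟨q, r⟩⟩ <;> simp [n16I]
    grind
  simp only [n16K, List.map_cons, List.map_nil, List.reverse_cons, List.reverse_nil,
    List.nil_append, List.cons_append] at h ⊢
  fun_induction n16I x y s t r
  · next p q r hx ih =>
    obtain ⟨rfl, rfl⟩ := hx
    have ih := ih (irr_cons.1 (irr_cons.1 h).2).2
    have k1 := e0 r s
    have k2 := e0 r y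
    have k4 : ∀ c, [some y, some c] <+: n16I x y s t r → [some y] <+: n16I x y s t r :=
      fun c h => List.IsPrefix.trans (by simp) h
    have k3 := k4 x
    simp [irr_cons] at h ⊢
    grind
  · next p q r _ hx ih =>
    obtain ⟨rfl, rfl⟩ := hx
    have ih := ih (irr_cons.1 (irr_cons.1 h).2).2
    have k1 := e0 r x
    have k2 := e0 r t
    have k4 : ∀ c, [some t, some c] <+: n16I x y s t r → [some t] <+: n16I x y s t r :=
      fun c h => List.IsPrefix.trans (by simp) h
    have k3 := k4 s
    simp [irr_cons] at h ⊢
    grind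
  all_goals
    simp [irr_cons, irr_nil] at *
  all_goals grind

theorem n16_ba {α : Type} [Fintype α] (x y s t : α) (h1 : x ≠ y) (h2 : s ≠ t) (h3 : s ≠ x)
    (h4 : ¬ (t = x ∧ s = y)) :
    MonPrefixAutomatic {([x, y, x], [s, t, s])} ∧ MonBiautomatic {([x, y, x], [s, t, s])} := by
  have key : ∀ (M : Type) [Monoid M] (f : α → M), f x * (f y * f x) = f s * (f t * f s) →
      f s * (f t * (f x * (f y * f x))) = f x * (f y * (f x * (f t * f s))) := by
    intro M _ f h
    rw [h, ← mul_assoc (f y), ← mul_assoc (f x), h]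
    simp only [mul_assoc]
  refine mkBA some [(x, n16F x y), (s, n16F s t)]
    [(x, ⟨[([some y, some x], [])],
      [([some t, some s], [some s, some t]), ([some y, some x], [some x, some y])],
      [([], [none])]⟩),
     (s, ⟨[([some t, some s], [])],
      [([some t, some s], [some s, some t]), ([some y, some x], [some x, some y])],
      [([], [none])]⟩)] (n16L x y s t)
    (n16_nf x y s t h1 h2 h3 h4) (by simp [gE]) ?_ ?_ ?_ ?_ ?_ ?_ ?_
  · simp only [List.mem_cons, forall_eq_or_imp, List.not_mem_nil, false_imp_iff, implies_true,
      and_true]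
    refine ⟨⟨[x], ?_⟩, ⟨[s], ?_⟩⟩
    all_goals
      simp [ev_nil, ev_cons, gE, WordEq.refl, n16F]
    all_goals
      try refine ⟨?_, ?_⟩
    all_goals
      apply WordEq.of_monoid <;> simp <;> intro M _ f h <;> have := key M f h <;> grind [mul_assoc]
  · simp [Fm.Bi, n16F]
  · intro c r h
    unfold n16
    split_ifs with hc hq
    · right
      subst hc
      exact ⟨_, List.mem_cons_self, n16R_rel _ _ r⟩
    · right
      subst hq
      exact ⟨_, List.mem_cons_of_mem _ List.mem_cons_self, n16R_rel _ _ r⟩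
    · simp
  · intro c r h
    unfold n16L
    split_ifs with hc hc
    · obtain ⟨rfl, k, rfl⟩ := hc
      exact n16I_irr _ _ _ _ h1 h2 h3 h4 _ (irr_cons.1 (irr_cons.1 h).2).2
    · obtain ⟨rfl, k, rfl⟩ := hc
      exact n16I_irr _ _ _ _ h1 h2 h3 h4 _ (irr_cons.1 (irr_cons.1 h).2).2
    · rw [irr_cons]
      refine ⟨?_, h⟩
      simp [n16K]
      grind
  · simp only [List.mem_cons, forall_eq_or_imp, List.not_mem_nil, false_imp_iff, implies_true,
      and_true]
    refine ⟨⟨[x, y, x], ?_⟩, ⟨[x, y, x], ?_⟩⟩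
    all_goals
      simp [expandW_nil, expandW_cons, WordEq.refl, gE]
    all_goals
      try refine ⟨?_, ?_⟩
    all_goals
      apply WordEq.of_monoid <;> simp <;> intro M _ f h <;> have := key M f h <;> grind [mul_assoc]
  · simp [Fm.Bi]
    rintro _ _ (⟨rfl, rfl⟩ | ⟨rfl, rfl⟩) <;> simp
  · intro c r h
    unfold n16L
    split_ifs with hc hc
    · right
      obtain ⟨rfl, k, rfl⟩ := hc
      exact ⟨_, List.mem_cons_self, n16I_rel _ _ _ _ _ k⟩
    · right
      obtain ⟨rfl, k, rfl⟩ := hc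
      exact ⟨_, List.mem_cons_of_mem _ List.mem_cons_self, n16I_rel _ _ _ _ _ k⟩
    · simp

/-! ### `xxx = sts` -/

open Classical in
noncomputable def n17X {α : Type} (x : α) : List (Option α) → List (Option α)
  | none :: r => none :: n17X x r
  | some p :: some q :: r =>
    if p = x ∧ q = x then none :: r else some x :: some p :: some q :: r
  | some p :: none :: r => some x :: some p :: none :: r
  | [some p] => [some x, some p]
  | [] => [some x]

def n17K {α : Type} (x s t : α) : List (List (Option α)) :=
  [[some s, some t, some s], [some s, some t, none], [some x, some x, some x],
    [some x, none]]

open Classical in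
noncomputable def n17 {α : Type} (x s t c : α) (r : List (Option α)) : List (Option α) :=
  if c = x then n17X x r else if c = s then n16R s t r else some c :: r

theorem n17X_push {α : Type} (x s t : α) (r : List (Option α))
    (h : Irr (n17K x s t) (some x :: r)) : n17X x r = some x :: r := by
  unfold n17K at h
  fun_cases n17X x r <;> simp_all [irr_cons]

theorem n17X_irr {α : Type} (x s t : α) (h1 : s ≠ x) (r : List (Option α))
    (h : Irr (n17K x s t) r) : Irr (n17K x s t) (n17X x r) := by
  fun_induction n17X x r
  · next r ih =>
    rw [irr_cons]
    exact ⟨by simp [n17K], ih (irr_cons.1 h).2⟩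
  all_goals
    revert h
    simp [irr_cons, n17K, irr_nil] <;> grind [List.cons_prefix_cons]

theorem n17R_irr {α : Type} (x s t : α) (h1 : s ≠ x) (h2 : t ≠ x) (h3 : s ≠ t)
    (r : List (Option α))
    (h : Irr (n17K x s t) r) : Irr (n17K x s t) (n16R s t r) := by
  fun_induction n16R s t r
  · next r ih =>
    have ih := ih (irr_cons.1 (irr_cons.1 h).2).2
    rw [irr_cons, irr_cons]
    refine ⟨by simp [n17K], ?_, ih⟩
    simp [n17K]
    grind
  all_goals
    revert h
    simp [irr_cons, n17K, irr_nil] <;> grind [List.cons_prefix_cons]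

theorem n17X_D {α : Type} (x s t : α) (r : List (Option α))
    (h : Irr (n17K x s t) r) : n17X x (n17X x (n17X x r)) = none :: r := by
  fun_induction n17X x r
  · next r ih =>
    simp [n17X, ih (irr_cons.1 h).2]
  · next p q r hx =>
    obtain ⟨rfl, rfl⟩ := hx
    simp only [n17X]
    rw [n17X_push q s t r (irr_cons.1 h).2, n17X_push q s t _ h]
  · next p q r hx =>
    by_cases hb : p = x
    · subst hb
      have e := n17X_push p s t _ h
      simp [n17X, e]
    · simp [n17X, hb]
  · next p r =>
    by_cases hb : p = x
    · subst hb
      simp [irr_cons, n17K] at h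
    · simp [n17X, hb]
  · next p =>
    by_cases hb : p = x
    · subst hb
      simp [n17X]
    · simp [n17X, hb]
  · simp [n17X]

theorem n17_nf {α : Type} [Fintype α] (x s t : α) (h1 : s ≠ x) (h2 : t ≠ x) (h3 : s ≠ t) :
    NF {([x, x, x], [s, t, s])} (gE [x, x, x]) (Irr (n17K x s t)) (n17 x s t) := by
  have hx : ∀ r, n17 x s t x r = n17X x r := by simp [n17]
  have hs : ∀ r, n17 x s t s r = n16R s t r := by simp [n17, h1]
  have ht : ∀ r, n17 x s t t r = some t :: r := by simp [n17, h2, h3.symm]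
  have hDs : ∀ r, Irr (n17K x s t) r → n16R s t (some t :: n16R s t r) = none :: r :=
    n16R_D s t h3 _ (by simp [n17K]) (by simp [n17K])
  refine mkNF (by simp [n17K]) ?_ ?_ ?_
  · intro c r h
    unfold n17
    split_ifs with hc hq
    · exact n17X_irr x s t h1 r h
    · exact n17R_irr x s t h1 h2 h3 r h
    · simp [irr_cons, h]; simp [n17K]; grind
  · intro r hr
    simp [actW, hx, hs, ht, n17X_D x s t r hr, hDs r hr]
  · intro c r h
    rcases c with _ | c
    · simp [gE, actW, hx, n17X_D x s t r (irr_cons.1 h).2]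
    · simp [actW, n17, gE]
      split_ifs with hc hq
      · subst hc; exact n17X_push _ s t r h
      · subst hq; exact n16R_push _ _ _ (by simp [n17K]) (by simp [n17K]) r h
      · rfl

def n17F {α : Type} (x : α) : Fm (Option α) :=
  ⟨[([], [])], [([none], [none])], [([], [some x]), ([some x, some x], [none])]⟩

theorem n17X_rel {α : Type} (x : α) (r : List (Option α)) :
    (n17F x).rel r (n17X x r) := by
  unfold n17F
  fun_induction n17X x r
  · next r ih =>
    exact Fm.rel_step [_] [_] (by simp) ih
  · next p q r hx =>
    obtain ⟨rfl, rfl⟩ := hx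
    exact Fm.rel_base [] [] [_, _] [none] _ (by simp) (by simp) rfl rfl
  all_goals
    exact Fm.rel_base [] [] [] [some _] _ (by simp) (.head _) rfl rfl

open Classical in
noncomputable def n17I {α : Type} (x s t : α) : List (Option α) → List (Option α)
  | p :: q :: r =>
    if p = some x then some x :: n17I x s t (q :: r)
    else if p = some t ∧ q = some s then some s :: some t :: n17I x s t r
    else none :: p :: q :: r
  | [p] => if p = some x then [some x, none] else [none, p]
  | [] => [none]

open Classical in
noncomputable def n17L {α : Type} (x s t c : α) (r : List (Option α)) : List (Option α) :=
  if c = x ∧ [some x, some x] <+: r then n17I x s t (r.drop 2)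
  else if c = s ∧ [some t, some s] <+: r then n17I x s t (r.drop 2) else some c :: r

theorem n17I_rel {α : Type} (x s t : α) (k r : List (Option α)) :
    Fm.rel ⟨[(k, [])], [([some t, some s], [some s, some t]), ([some x], [some x])],
      [([], [none])]⟩ (k ++ r) (n17I x s t r) := by
  have : ∃ p q z, PS [([some t, some s], [some s, some t]), ([some x], [some x])]
      p q ∧ r = p ++ z ∧ n17I x s t r = q ++ ([none] ++ z) := by
    fun_induction n17I x s t r
    · next q r ih =>
      obtain ⟨p, q, z, h1, h2, h3⟩ := ih
      exact ⟨[_] ++ p, [_] ++ q, z, .step (.tail _ (.head _)) h1, by simp [h2], by simp [h3]⟩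
    · next p q r _ hx ih =>
      obtain ⟨rfl, rfl⟩ := hx
      obtain ⟨p, q, z, h1, h2, h3⟩ := ih
      exact ⟨[_, _] ++ p, [_, _] ++ q, z, .step (.head _) h1, by simp [h2], by simp [h3]⟩
    · exact ⟨[], [], _, .nil, rfl, rfl⟩
    · exact ⟨[_] ++ [], [_] ++ [], [], .step (.tail _ (.head _)) .nil, rfl, rfl⟩
    · exact ⟨[], [], _, .nil, rfl, rfl⟩
    · exact ⟨[], [], [], .nil, rfl, by simp⟩
  obtain ⟨p, q, z, h1, h2, h3⟩ := this
  exact ⟨k, [], p, q, [], [none], z, by simp, h1, by simp, by simp [h2], by simp [h3]⟩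

theorem n17I_irr {α : Type} (x s t : α) (h1 : s ≠ x) (h2 : t ≠ x) (h3 : s ≠ t)
    (r : List (Option α))
    (h : Irr ((n17K x s t).map List.reverse) r) :
    Irr ((n17K x s t).map List.reverse) (n17I x s t r) := by
  have e1 : ∀ r, [some x] <+: n17I x s t r → [some x] <+: r := by
    intro r
    rcases r with _ | ⟨p, _ | ⟨q, r⟩⟩ <;> simp [n17I] <;> grind
  have e2 : ∀ r, [some x, some x] <+: n17I x s t r → [some x, some x] <+: r := by
    intro r
    rcases r with _ | ⟨p, _ | ⟨q, r⟩⟩ <;> simp [n17I]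
    · grind
    · have := e1 (q :: r)
      grind [List.cons_prefix_cons]
  have e3 : ∀ r, [some s] <+: n17I x s t r → [some t, some s] <+: r := by
    intro r
    rcases r with _ | ⟨p, _ | ⟨q, r⟩⟩ <;> simp [n17I] <;> grind [List.cons_prefix_cons]
  have e4 : ∀ r, ¬ [some t] <+: n17I x s t r := by
    intro r
    rcases r with _ | ⟨p, _ | ⟨q, r⟩⟩ <;> simp [n17I] <;> grind [List.cons_prefix_cons]
  have e5 : ∀ r c, [some t, some c] <+: n17I x s t r → [some t] <+: n17I x s t r :=
      fun r c h => List.IsPrefix.trans (by simp) h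
  simp only [n17K, List.map_cons, List.map_nil, List.reverse_cons, List.reverse_nil,
    List.nil_append, List.cons_append] at h ⊢
  fun_induction n17I x s t r
  · next q r ih =>
    have ih := ih (irr_cons.1 h).2
    have k2 := e2 (q :: r)
    rw [irr_cons] at h ⊢
    refine ⟨?_, ih⟩
    simp at h ⊢
    grind
  · next p q r _ hx ih =>
    obtain ⟨rfl, rfl⟩ := hx
    have ih := ih (irr_cons.1 (irr_cons.1 h).2).2
    have k1 := e3 r
    have k2 := e4 r
    have k3 := e5 r s
    simp [irr_cons] at h ⊢
    grind
  all_goals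
    simp [irr_cons, irr_nil] at *
  all_goals grind

theorem n17_ba {α : Type} [Fintype α] (x s t : α) (h1 : s ≠ x) (h2 : t ≠ x) (h3 : s ≠ t) :
    MonPrefixAutomatic {([x, x, x], [s, t, s])} ∧ MonBiautomatic {([x, x, x], [s, t, s])} := by
  have key : ∀ (M : Type) [Monoid M] (f : α → M), f x * (f x * f x) = f s * (f t * f s) →
      f s * (f t * (f x * (f x * f x))) = f x * (f x * (f x * (f t * f s))) := by
    intro M _ f h
    rw [h, ← mul_assoc (f x) (f x) (f t * f s), ← mul_assoc (f x), h]
    simp only [mul_assoc]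
  refine mkBA some [(x, n17F x), (s, n16F s t)]
    [(x, ⟨[([some x, some x], [])],
      [([some t, some s], [some s, some t]), ([some x], [some x])],
      [([], [none])]⟩),
     (s, ⟨[([some t, some s], [])],
      [([some t, some s], [some s, some t]), ([some x], [some x])],
      [([], [none])]⟩)] (n17L x s t)
    (n17_nf x s t h1 h2 h3) (by simp [gE]) ?_ ?_ ?_ ?_ ?_ ?_ ?_
  · simp only [List.mem_cons, forall_eq_or_imp, List.not_mem_nil, false_imp_iff, implies_true,
      and_true]
    refine ⟨⟨[x], ?_⟩, ⟨[s], ?_⟩⟩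
    all_goals
      simp [ev_nil, ev_cons, gE, WordEq.refl, n16F, n17F]
    all_goals
      try refine ⟨?_, ?_⟩
    all_goals
      apply WordEq.of_monoid <;> simp <;> intro M _ f h <;> have := key M f h <;> grind [mul_assoc]
  · simp [Fm.Bi, n16F, n17F]
  · intro c r h
    unfold n17
    split_ifs with hc hq
    · right
      subst hc
      exact ⟨_, List.mem_cons_self, n17X_rel _ r⟩
    · right
      subst hq
      exact ⟨_, List.mem_cons_of_mem _ List.mem_cons_self, n16R_rel _ _ r⟩
    · simp
  · intro c r h
    unfold n17L
    split_ifs with hc hc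
    · obtain ⟨rfl, k, rfl⟩ := hc
      exact n17I_irr _ _ _ h1 h2 h3 _ (irr_cons.1 (irr_cons.1 h).2).2
    · obtain ⟨rfl, k, rfl⟩ := hc
      exact n17I_irr _ _ _ h1 h2 h3 _ (irr_cons.1 (irr_cons.1 h).2).2
    · rw [irr_cons]
      refine ⟨?_, h⟩
      simp [n17K]
      grind
  · simp only [List.mem_cons, forall_eq_or_imp, List.not_mem_nil, false_imp_iff, implies_true,
      and_true]
    refine ⟨⟨[x, x, x], ?_⟩, ⟨[x, x, x], ?_⟩⟩
    all_goals
      simp [expandW_nil, expandW_cons, WordEq.refl, gE]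
    all_goals
      try refine ⟨?_, ?_⟩
    all_goals
      apply WordEq.of_monoid <;> simp <;> intro M _ f h <;> have := key M f h <;> grind [mul_assoc]
  · simp [Fm.Bi]
    rintro _ _ (⟨rfl, rfl⟩ | ⟨rfl, rfl⟩) <;> simp
  · intro c r h
    unfold n17L
    split_ifs with hc hc
    · right
      obtain ⟨rfl, k, rfl⟩ := hc
      exact ⟨_, List.mem_cons_self, n17I_rel _ _ _ _ k⟩
    · right
      obtain ⟨rfl, k, rfl⟩ := hc
      exact ⟨_, List.mem_cons_of_mem _ List.mem_cons_self, n17I_rel _ _ _ _ k⟩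
    · simp

/-! ### Part D: non-automaticity -/

theorem padR_cons_cons {β : Type} (a b : β) (x y : List β) :
    padR (a :: x) (b :: y) = (some a, some b) :: padR x y := by simp [padR]

theorem padR_nil_right {β : Type} (x : List β) : padR x [] = x.map fun c => (some c, none) := by
  induction x with
  | nil => rfl
  | cons a x ih =>
    rw [List.map_cons, ← ih]
    simp [padR, List.replicate_succ]

theorem padR_nil_left {β : Type} (x : List β) : padR [] x = x.map fun c => (none, some c) := by
  induction x with
  | nil => rfl
  | cons a x ih =>
    rw [List.map_cons, ← ih]
    simp [padR, List.replicate_succ]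

theorem padR_append_left {β : Type} (x z y : List β) (h : x.length = y.length) :
    padR (x ++ z) y = padR x y ++ z.map fun c => (some c, none) := by
  induction x generalizing y with
  | nil =>
    obtain rfl : y = [] := by simpa using h.symm
    simp [padR_nil_right]
  | cons a x ih =>
    rcases y with _ | ⟨b, y⟩
    · simp at h
    · simp [padR_cons_cons, ih y (by simpa using h)]

theorem padR_append_right {β : Type} (x z y : List β) (h : x.length = y.length) :
    padR x (y ++ z) = padR x y ++ z.map fun c => (none, some c) := by
  induction x generalizing y with
  | nil =>
    obtain rfl : y = [] := by simpa using h.symm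
    simp [padR_nil_left]
  | cons a x ih =>
    rcases y with _ | ⟨b, y⟩
    · simp at h
    · simp [padR_cons_cons, ih y (by simpa using h)]

theorem padR_fst {β : Type} (x y : List β) :
    (padR x y).filterMap Prod.fst = x ∧ (padR x y).filterMap Prod.snd = y := by
  induction x generalizing y with
  | nil => simp [padR_nil_left, List.filterMap_map, Function.comp_def]
  | cons a x ih =>
    rcases y with _ | ⟨b, y⟩
    · simp [padR_nil_right, List.filterMap_map, Function.comp_def]
    · simp [padR_cons_cons, ih y]

theorem padR_inj {β : Type} {x y x' y' : List β} (h : padR x y = padR x' y') : x = x' ∧ y = y' := by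
  have h1 := padR_fst x y
  have h2 := padR_fst x' y'
  rw [h] at h1
  exact ⟨h1.1.symm.trans h2.1, h1.2.symm.trans h2.2⟩

/-- A DFA for the multiplier relation. -/
theorem mul_dfa {α β : Type} {R : Set (List α × List α)} {g : β → List α} {L : Set (List β)}
    (h : MonAutoStruct R g L) (d : β) :
    ∃ (τ : Type) (_ : Fintype τ) (M : DFA (Option β × Option β) τ), ∀ x y,
      padR x y ∈ M.accepts ↔ x ∈ L ∧ y ∈ L ∧ WordEq R (expandW g x ++ g d) (expandW g y) := by
  obtain ⟨τ, i, M, hM⟩ := Reg.exists_dfa (h.mul_reg d)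
  refine ⟨τ, i, M, fun x y => ?_⟩
  rw [hM]
  constructor
  · rintro ⟨x', hx, y', hy, hw, e⟩
    obtain ⟨rfl, rfl⟩ := padR_inj e
    exact ⟨hx, hy, hw⟩
  · rintro ⟨hx, hy, hw⟩
    exact ⟨x, hx, y, hy, hw, rfl⟩

theorem dfa_short {σ τ : Type} [Fintype τ] (M : DFA σ τ) (s : τ) (w : List σ) :
    ∃ w', w'.length ≤ Fintype.card τ ∧ M.evalFrom s w' = M.evalFrom s w := by
  induction hn : w.length using Nat.strong_induction_on generalizing w with
  | _ n ih =>
    by_cases hl : Fintype.card τ ≤ w.length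
    · obtain ⟨q, a, b, c, rfl, -, hb, h1, h2, h3⟩ := M.evalFrom_split hl rfl
      have : b.length ≠ 0 := by simpa using hb
      obtain ⟨w', h, e⟩ := ih (a ++ c).length (by simp at hn ⊢; omega) (a ++ c) rfl
      refine ⟨w', h, ?_⟩
      rw [e, DFA.evalFrom_of_append, h1, h3]
    · exact ⟨w, by omega, rfl⟩

theorem short_right {β τ : Type} [Fintype τ] (M : DFA (Option β × Option β) τ) (x y : List β)
    (h : padR x y ∈ M.accepts) :
    ∃ y', padR x y' ∈ M.accepts ∧ y'.length ≤ x.length + Fintype.card τ := by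
  by_cases hl : y.length ≤ x.length
  · exact ⟨y, h, by omega⟩
  · have e := padR_append_right x (y.drop x.length) (y.take x.length) (by simp; omega)
    rw [List.take_append_drop] at e
    obtain ⟨w, hw, e'⟩ := dfa_short (M.comap fun c => (none, some c))
      (M.eval (padR x (y.take x.length))) (y.drop x.length)
    refine ⟨y.take x.length ++ w, ?_, by simp; omega⟩
    rw [padR_append_right _ _ _ (by simp; omega)]
    rw [e] at h
    rw [DFA.evalFrom_comap, DFA.evalFrom_comap] at e'
    rw [DFA.mem_accepts, DFA.eval, DFA.evalFrom_of_append] at h ⊢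
    rw [DFA.eval] at e'
    rwa [e']

theorem short_left {β τ : Type} [Fintype τ] (M : DFA (Option β × Option β) τ) (x y : List β)
    (h : padR x y ∈ M.accepts) :
    ∃ x', padR x' y ∈ M.accepts ∧ x'.length ≤ y.length + Fintype.card τ := by
  by_cases hl : x.length ≤ y.length
  · exact ⟨x, h, by omega⟩
  · have e := padR_append_left (x.take y.length) (x.drop y.length) y (by simp; omega)
    rw [List.take_append_drop] at e
    obtain ⟨w, hw, e'⟩ := dfa_short (M.comap fun c => (some c, none))
      (M.eval (padR (x.take y.length) y)) (x.drop y.length)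
    refine ⟨x.take y.length ++ w, ?_, by simp; omega⟩
    rw [padR_append_left _ _ _ (by simp; omega)]
    rw [e] at h
    rw [DFA.evalFrom_comap, DFA.evalFrom_comap] at e'
    rw [DFA.mem_accepts, DFA.eval, DFA.evalFrom_of_append] at h ⊢
    rw [DFA.eval] at e'
    rwa [e']

/-- Words without defining factors are alone in their class. -/
theorem word_alone {α : Type} {u v x w : List α} (h : WordEq {(u, v)} x w) (hu : ¬ u <:+: w)
    (hv : ¬ v <:+: w) : x = w := by
  classical
  have := h.lift (fun z => if u <:+: z ∨ v <:+: z then none else some z) (by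
    rintro p s u' v' h
    simp only [Set.mem_singleton_iff, Prod.mk.injEq] at h
    obtain ⟨rfl, rfl⟩ := h
    have h1 : u' <:+: p ++ u' ++ s := ⟨p, s, rfl⟩
    have h2 : v' <:+: p ++ v' ++ s := ⟨p, s, rfl⟩
    simp only [h1, h2, true_or, or_true, if_true])
  simp only [hu, hv, or_self, if_false] at this
  split_ifs at this
  simpa using this

theorem word_count {α : Type} [DecidableEq α] {u v x w : List α} {b : α}
    (h : WordEq {(u, v)} x w) (e : u.count b = v.count b) : x.count b = w.count b := by
  refine h.lift (fun z => z.count b) ?_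
  rintro p s u' v' h
  simp only [Set.mem_singleton_iff, Prod.mk.injEq] at h
  obtain ⟨rfl, rfl⟩ := h
  simp [e]

theorem exists_gen {α β : Type} {u v : List α} {g : β → List α} {L : Set (List β)}
    (h : MonAutoStruct {(u, v)} g L) (a : α) (hu : 2 ≤ u.length) (hv : 2 ≤ v.length) :
    ∃ d, g d = [a] := by
  obtain ⟨x, -, hx⟩ := h.onto [a]
  have e := word_alone hx (fun hh => by have := hh.length_le; simp at this; omega)
    (fun hh => by have := hh.length_le; simp at this; omega)
  clear hx
  induction x with
  | nil => simp [expandW_nil] at e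
  | cons d x ih =>
    rw [expandW_cons] at e
    rcases hd : g d with _ | ⟨c, l⟩
    · rw [hd] at e
      exact ih e
    · rw [hd] at e
      simp at e
      exact ⟨d, by simp [hd, e]⟩

theorem exists_bound {α β : Type} [Fintype β] (g : β → List α) :
    ∃ G, 0 < G ∧ ∀ x, (expandW g x).length ≤ G * x.length := by
  refine ⟨(∑ c, (g c).length) + 1, by omega, fun x => ?_⟩
  induction x with
  | nil => simp [expandW_nil]
  | cons c x ih =>
    have := Finset.single_le_sum (f := fun c => (g c).length) (fun _ _ => Nat.zero_le _)
      (Finset.mem_univ c)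
    rw [expandW_cons, List.length_append, List.length_cons, Nat.mul_succ]
    omega

/-- The pigeonhole argument for the relations `aba = ba` and `abb = bb`. -/
theorem not_auto {α : Type} {u v : List α} (a b e : α) (hab : a ≠ b) (z y : ℕ → List α)
    [DecidableEq α] (hu : 2 ≤ u.length) (hv : 2 ≤ v.length) (hc : u.count b = v.count b)
    (h1 : ∀ n k, WordEq {(u, v)} (List.replicate n a ++ z k ++ [e]) (y k))
    (h2 : ∀ n k, ¬ u <:+: List.replicate n a ++ z k)
    (h3 : ∀ n k, ¬ v <:+: List.replicate n a ++ z k)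
    (h4 : ∀ i j, (z i).count b = (z j).count b → i = j) : ¬ MonAutomatic {(u, v)} := by
  rintro ⟨β, _, g, L, h⟩
  obtain ⟨d, hd⟩ := exists_gen h e hu hv
  obtain ⟨τ, _, M, hM⟩ := mul_dfa h d
  obtain ⟨G, hG0, hG⟩ := exists_bound g
  choose B hBL hB using fun k => h.onto (y k)
  choose A hAL hA using fun k => h.onto (List.replicate (G * (B k).length) a ++ z k)
  have hA' : ∀ k, expandW g (A k) = List.replicate (G * (B k).length) a ++ z k :=
    fun k => word_alone (hA k) (h2 _ _) (h3 _ _)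
  have hlen : ∀ k, (B k).length ≤ (A k).length := by
    intro k
    have := hG (A k)
    rw [hA' k] at this
    simp at this
    exact Nat.le_of_mul_le_mul_left (by omega) hG0
  have hpre : ∀ k, (expandW g ((A k).take (B k).length)).count b = 0 := by
    intro k
    have e1 := hA' k
    rw [← List.take_append_drop (B k).length (A k), expandW_append] at e1
    have hl : (expandW g ((A k).take (B k).length)).length ≤ G * (B k).length := by
      refine (hG _).trans ?_
      gcongr
      simp
    have : expandW g ((A k).take (B k).length) <+: List.replicate (G * (B k).length) a :=
      List.prefix_of_prefix_length_le ⟨_, e1⟩ ⟨_, rfl⟩ (by simpa using hl)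
    rw [List.count_eq_zero]
    intro hb
    have := this.subset hb
    simp at this
    exact hab this.2.symm
  have hsuf : ∀ k, (expandW g ((A k).drop (B k).length)).count b = (z k).count b := by
    intro k
    have e1 := congrArg (List.count b) (hA' k)
    rw [← List.take_append_drop (B k).length (A k), expandW_append] at e1
    rw [List.count_append, List.count_append, hpre, List.count_replicate] at e1
    simpa [hab] using e1
  obtain ⟨i, j, hij, hq⟩ := Finite.exists_ne_map_eq_of_infinite
    (fun k => M.eval (padR ((A k).take (B k).length) (B k)))
  have hacc : ∀ k, padR ((A k).take (B k).length ++ (A k).drop (B k).length) (B k) ∈ M.accepts := by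
    intro k
    rw [List.take_append_drop, hM]
    refine ⟨hAL k, hBL k, ?_⟩
    rw [hA', hd]
    exact (h1 _ _).trans (hB k).symm
  have hmix : padR ((A i).take (B i).length ++ (A j).drop (B j).length) (B i) ∈ M.accepts := by
    have hj := hacc j
    have := hlen i
    have := hlen j
    rw [padR_append_left _ _ _ (by simp; omega), DFA.mem_accepts, DFA.eval,
      DFA.evalFrom_of_append] at hj ⊢
    simp only [DFA.eval] at hq
    rwa [hq]
  have e1 := word_count ((hM _ _).1 hmix).2.2 hc
  have e2 := word_count (hB i) hc
  have e3 := word_count (h1 0 i) hc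
  refine hij (h4 i j ?_)
  simp [expandW_append, hpre, hsuf, hd] at e1 e2 e3
  omega

theorem not_auto_aba {α : Type} (a b : α) (hab : a ≠ b) :
    ¬ MonAutomatic {([a, b, a], [b, a])} := by
  classical
  have hI : ∀ n k, ¬ [b, a] <:+: List.replicate n a ++ List.replicate (k + 1) b := by
    intro n k
    suffices h : Irr [[b, a]] (List.replicate n a ++ List.replicate (k + 1) b) by
      simpa [Irr] using h
    induction n with
    | zero =>
      simp only [List.replicate_zero, List.nil_append]
      induction k with
      | zero => simp [irr_cons, irr_nil]
      | succ k ih =>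
        rw [List.replicate_succ, irr_cons]
        refine ⟨?_, ih⟩
        simp [List.replicate_succ, hab]
    | succ n ih =>
      rw [List.replicate_succ, List.cons_append, irr_cons]
      refine ⟨?_, ih⟩
      simp [hab.symm]
  refine not_auto a b a hab (fun k => List.replicate (k + 1) b)
    (fun k => List.replicate (k + 1) b ++ [a]) (by simp) (by simp) ?_ ?_ ?_ hI ?_
  · simp [List.count_cons, hab]
  · intro n k
    apply WordEq.of_monoid
    intro M _ f h
    simp at h ⊢
    have h1 : ∀ k, f a * (f b ^ (k + 1) * f a) = f b ^ (k + 1) * f a := by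
      intro k
      induction k with
      | zero => simpa using h
      | succ k ih =>
        calc f a * (f b ^ (k + 1 + 1) * f a) = f a * (f b ^ (k + 1) * (f b * f a)) := by
              rw [pow_succ]; simp only [mul_assoc]
          _ = f a * (f b ^ (k + 1) * f a) * (f b * f a) := by
              conv_lhs => rw [← h]
              simp only [mul_assoc]
          _ = f b ^ (k + 1) * (f a * (f b * f a)) := by rw [ih]; simp only [mul_assoc]
          _ = _ := by rw [h, pow_succ (f b) (k + 1)]; simp only [mul_assoc]
    induction n with
    | zero => simp
    | succ n ih => rw [pow_succ', mul_assoc, ih, h1]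
  · intro n k hh
    exact hI n k (List.IsInfix.trans ⟨[a], [], by simp⟩ hh)
  · intro i j h
    simpa using h

/-- The word `(ab)^(k+1)`. -/
def abW {α : Type} (a b : α) : ℕ → List α
  | 0 => [a, b]
  | k + 1 => a :: b :: abW a b k

theorem not_auto_abb {α : Type} (a b : α) (hab : a ≠ b) :
    ¬ MonAutomatic {([a, b, b], [b, b])} := by
  classical
  have hI : ∀ n k, ¬ [b, b] <:+: List.replicate n a ++ abW a b k := by
    intro n k
    suffices h : Irr [[b, b]] (List.replicate n a ++ abW a b k) by
      simpa [Irr] using h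
    induction n with
    | zero =>
      simp only [List.replicate_zero, List.nil_append]
      induction k with
      | zero => simp [irr_cons, irr_nil, abW, hab.symm]
      | succ k ih =>
        rw [abW, irr_cons, irr_cons]
        refine ⟨?_, ?_, ih⟩
        · simp [hab.symm]
        · cases k <;> simp [abW, hab.symm]
    | succ n ih =>
      rw [List.replicate_succ, List.cons_append, irr_cons]
      refine ⟨?_, ih⟩
      simp [hab.symm]
  refine not_auto a b b hab (abW a b)
    (fun k => List.replicate (k + 2) b) (by simp) (by simp) ?_ ?_ ?_ hI ?_
  · simp [List.count_cons, hab]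
  · intro n k
    apply WordEq.of_monoid
    intro M _ f h
    simp at h ⊢
    have h2 : ∀ k, f a * f b ^ (k + 2) = f b ^ (k + 2) := by
      intro k
      rw [add_comm, pow_add, ← mul_assoc, pow_two, h]
    have h1 : ∀ k, ((abW a b k).map f).prod * f b = f b ^ (k + 2) := by
      intro k
      induction k with
      | zero => simpa [abW, mul_assoc, pow_two] using h
      | succ k ih =>
        simp only [abW, List.map_cons, List.prod_cons, mul_assoc]
        rw [ih, ← pow_succ', h2 (k + 1)]
    rw [h1]
    induction n with
    | zero => simp
    | succ n ih => rw [pow_succ', mul_assoc, ih, h2]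
  · intro n k hh
    exact hI n k (List.IsInfix.trans ⟨[a], [], by simp⟩ hh)
  · have hc : ∀ k, (abW a b k).count b = k + 1 := by
      intro k
      induction k with
      | zero => simp [abW, List.count_cons, hab]
      | succ k ih => simp [abW, List.count_cons, hab, ih]
    intro i j h
    rw [hc, hc] at h
    omega

/-! ### `aab = ba` -/

open Classical in
/-- The second coordinate of the representation in `ℕ × ℕ`. -/
noncomputable def aV {α : Type} (a b : α) : List α → ℕ
  | [] => 0
  | c :: w => if c = a then 1 + aV a b w else if c = b then 2 * aV a b w else aV a b w

theorem aV_append {α : Type} [DecidableEq α] (a b : α) (hab : a ≠ b) (p w : List α) :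
    aV a b (p ++ w) = aV a b p + 2 ^ p.count b * aV a b w := by
  induction p with
  | nil => simp [aV]
  | cons c p ih =>
    rw [List.cons_append, aV, aV, ih, List.count_cons]
    split_ifs with h1 h2 h3 h4 <;> simp_all [pow_succ] <;> ring

theorem aV_eq {α : Type} (a b : α) (hab : a ≠ b) {x y : List α}
    (h : WordEq {([a, a, b], [b, a])} x y) : aV a b x = aV a b y := by
  classical
  refine h.lift (aV a b) ?_
  rintro p s u' v' h
  simp only [Set.mem_singleton_iff, Prod.mk.injEq] at h
  obtain ⟨rfl, rfl⟩ := h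
  simp [aV_append a b hab, aV, hab.symm]
  omega

theorem aV_letters {α : Type} (a b : α) {x y : List α}
    (h : WordEq {([a, a, b], [b, a])} x y) (hx : ∀ c ∈ x, c = a ∨ c = b) :
    ∀ c ∈ y, c = a ∨ c = b := by
  have := h.lift (fun z => ∀ c ∈ z, c = a ∨ c = b) (by
    rintro p s u' v' h
    simp only [Set.mem_singleton_iff, Prod.mk.injEq] at h
    obtain ⟨rfl, rfl⟩ := h
    simp; grind)
  rwa [← this]

/-- Normal form of a word in `a` and `b`. -/
theorem aab_nf {α : Type} [DecidableEq α] (a b : α) (hab : a ≠ b) (x : List α)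
    (hx : ∀ c ∈ x, c = a ∨ c = b) :
    WordEq {([a, a, b], [b, a])} x
      (List.replicate (aV a b x) a ++ List.replicate (x.count b) b) := by
  induction x with
  | nil => simp [aV, WordEq.refl]
  | cons c x ih =>
    have ih := ih fun c hc => hx c (by simp [hc])
    have ih' := ih.ctx [c] []
    simp only [List.append_nil, List.cons_append, List.nil_append] at ih'
    refine ih'.trans ?_
    rcases hx c (by simp) with rfl | rfl
    · simp [aV, List.count_cons, hab, Nat.add_comm 1, List.replicate_succ, WordEq.refl]
    · apply WordEq.of_monoid
      intro M _ f h
      have h1 : ∀ n, f c * f a ^ n = f a ^ (2 * n) * f c := by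
        intro n
        induction n with
        | zero => simp
        | succ n ih =>
          rw [pow_succ, ← mul_assoc, ih, mul_add, pow_add]
          simp at h
          simp [pow_two, mul_assoc, h]
      simp [aV, hab.symm, pow_succ', ← mul_assoc, h1]

theorem not_auto_aab {α : Type} (a b : α) (hab : a ≠ b) :
    ¬ MonAutomatic {([a, a, b], [b, a])} := by
  classical
  rintro ⟨β, _, g, L, h⟩
  obtain ⟨d, hd⟩ := exists_gen h b (by simp) (by simp)
  obtain ⟨d', hd'⟩ := exists_gen h a (by simp) (by simp)
  obtain ⟨τ, _, M, hM⟩ := mul_dfa h d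
  obtain ⟨τ', _, M', hM'⟩ := mul_dfa h d'
  obtain ⟨G, hG0, hG⟩ := exists_bound g
  obtain ⟨x0, hx0, hx0'⟩ := h.onto []
  have hc : [a, a, b].count b = [b, a].count b := by simp [List.count_cons, hab]
  -- representatives of `b^m`
  have s1 : ∀ m, ∃ x ∈ L, WordEq {([a, a, b], [b, a])} (expandW g x) (List.replicate m b) ∧
      x.length ≤ x0.length + m * Fintype.card τ := by
    intro m
    induction m with
    | zero => exact ⟨x0, hx0, by simpa using hx0', by simp⟩
    | succ m ih =>
      obtain ⟨x, hx, he, hl⟩ := ih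
      obtain ⟨y, hy, hy'⟩ := h.onto (expandW g x ++ [b])
      obtain ⟨y', h1, h2⟩ := short_right M x y ((hM _ _).2 ⟨hx, hy, by rw [hd]; exact hy'.symm⟩)
      obtain ⟨-, h3, h4⟩ := (hM _ _).1 h1
      refine ⟨y', h3, h4.symm.trans ?_, ?_⟩
      · rw [hd, List.replicate_succ']
        exact he.append (.refl _)
      · rw [Nat.succ_mul]; omega
  -- representatives of `b^m a`
  have s2 : ∀ m, ∃ x ∈ L, WordEq {([a, a, b], [b, a])} (expandW g x) (List.replicate m b ++ [a]) ∧
      x.length ≤ x0.length + m * Fintype.card τ + Fintype.card τ' := by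
    intro m
    obtain ⟨x, hx, he, hl⟩ := s1 m
    obtain ⟨y, hy, hy'⟩ := h.onto (expandW g x ++ [a])
    obtain ⟨y', h1, h2⟩ := short_right M' x y ((hM' _ _).2 ⟨hx, hy, by rw [hd']; exact hy'.symm⟩)
    obtain ⟨-, h3, h4⟩ := (hM' _ _).1 h1
    refine ⟨y', h3, h4.symm.trans ?_, by omega⟩
    rw [hd']
    exact he.append (.refl _)
  -- dividing by `b`
  have s3 : ∀ V j, ∀ x ∈ L, (∀ c ∈ expandW g x, c = a ∨ c = b) → aV a b (expandW g x) = V →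
      (expandW g x).count b = j → ∃ y ∈ L, (∀ c ∈ expandW g y, c = a ∨ c = b) ∧
        aV a b (expandW g y) = V ∧ (expandW g y).count b = 0 ∧
        y.length ≤ x.length + j * Fintype.card τ := by
    intro V j
    induction j with
    | zero => intro x hx h1 h2 h3; exact ⟨x, hx, h1, h2, h3, by simp⟩
    | succ j ih =>
      intro x hx h1 h2 h3
      have hn := aab_nf a b hab _ h1
      rw [h2, h3] at hn
      obtain ⟨z, hz, hz'⟩ := h.onto (List.replicate V a ++ List.replicate j b)
      obtain ⟨z', k1, k2⟩ := short_left M z x ((hM _ _).2 ⟨hz, hx, by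
        rw [hd]
        refine (hz'.append (.refl [b])).trans ?_
        rw [List.append_assoc, ← List.replicate_succ']
        exact hn.symm⟩)
      obtain ⟨k3, -, k4⟩ := (hM _ _).1 k1
      rw [hd] at k4
      have c1 := aV_letters a b k4.symm h1
      have c2 := aV_eq a b hab k4
      have c3 := word_count k4 hc
      rw [aV_append a b hab, h2] at c2
      rw [List.count_append, h3] at c3
      obtain ⟨y, hy, e1, e2, e3, e4⟩ := ih z' k3 (fun c hc => c1 c (by simp [hc]))
        (by simpa [aV, hab.symm] using c2) (by simpa using c3)
      exact ⟨y, hy, e1, e2, e3, by rw [Nat.succ_mul]; omega⟩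
  have s4 : ∀ w : List α, (∀ c ∈ w, c = a ∨ c = b) → w.count b = 0 → aV a b w = w.length := by
    intro w h1 h2
    induction w with
    | nil => simp [aV]
    | cons c w ih =>
      have := ih (fun c hc => h1 c (by simp [hc]))
      rcases h1 c (by simp) with rfl | rfl
      · simp_all [aV, List.count_cons]; omega
      · simp at h2
  have s5 : ∀ m, 2 ^ m ≤ G * (x0.length + m * Fintype.card τ + Fintype.card τ' +
      m * Fintype.card τ) := by
    intro m
    obtain ⟨x, hx, he, hl⟩ := s2 m
    have hr : ∀ m, aV a b (List.replicate m b) = 0 := by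
      intro m
      induction m with
      | zero => simp [aV]
      | succ m ih => simp [List.replicate_succ, aV, ih, hab.symm]
    have hV : aV a b (expandW g x) = 2 ^ m := by
      rw [aV_eq a b hab he, aV_append a b hab]
      simp [aV, hr]
    have hC : (expandW g x).count b = m := by
      rw [word_count he hc]
      simp [hab]
    obtain ⟨y, hy, e1, e2, e3, e4⟩ := s3 (2 ^ m) m x hx
      (aV_letters a b he.symm (by simp; grind)) hV hC
    rw [← e2, s4 _ e1 e3]
    refine (hG y).trans ?_
    gcongr
    omega
  generalize x0.length = A at s5
  generalize Fintype.card τ = N at s5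
  generalize Fintype.card τ' = N' at s5
  have s6 := s5 (2 * (G * (A + N') + 4 * (G * N)))
  generalize hk : G * (A + N') + 4 * (G * N) = k at s6
  have h1 : k + 1 ≤ 2 ^ k := Nat.lt_two_pow_self
  rw [two_mul, pow_add] at s6
  have h2 : (k + 1) * (k + 1) ≤ 2 ^ k * 2 ^ k := Nat.mul_le_mul h1 h1
  have h3 : G * (A + (k + k) * N + N' + (k + k) * N) = G * (A + N') + 4 * (G * N) * k := by ring
  rw [h3] at s6
  have h4 : 4 * (G * N) ≤ k := by omega
  have h5 : 4 * (G * N) * k ≤ k * k := Nat.mul_le_mul_right k h4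
  have h6 : G * (A + N') ≤ k := by omega
  nlinarith

/-! ### Part E: the case analysis -/

theorem case_zero {α : Type} [Fintype α] (p q c : α) :
    MonPrefixAutomatic {([p, q, c], [])} ∧ MonBiautomatic {([p, q, c], [])} := by
  by_cases hpc : p = c
  · subst hpc
    by_cases hq : p = q
    · subst hq
      exact ⟨(n2_aaa p).pa, (n2_aaa p).ba (by simp) (by simp)⟩
    · exact n6_ba p q hq
  · exact ⟨n1_pa p q c [] hpc (by simp) (by simp) (by simp),
      n1_ba p q c [] hpc (by simp) (by simp)⟩

theorem case_one {α : Type} [Fintype α] (p q c d : α) :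
    MonPrefixAutomatic {([p, q, c], [d])} := by
  by_cases hpc : p = c
  · subst hpc
    by_cases hd : d = p
    · subst hd
      exact n2_xyx_x d q
    · by_cases hq : d = q
      · subst hq
        exact n8_pa p d (Ne.symm hd)
      · exact n2_one d [p, q, p] (by simp [hd, hq])
  · exact n1_pa p q c [d] hpc (by simp) (by simp) (by simp)

theorem case_two {α : Type} [Fintype α] (p q c v1 v2 : α)
    (h : ¬ ∃ a b : α, a ≠ b ∧
        (([p, q, c] = [a, b, a] ∧ [v1, v2] = [b, a]) ∨ ([p, q, c] = [a, a, b] ∧ [v1, v2] = [b, a]) ∨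
          ([p, q, c] = [a, b, b] ∧ [v1, v2] = [b, b]))) :
    MonPrefixAutomatic {([p, q, c], [v1, v2])} := by
  by_cases hpc : p = c
  · subst hpc
    by_cases h12 : v1 = v2
    · subst h12
      by_cases hx : v1 = p
      · subst hx
        exact n2_xyx_xx v1 q
      · by_cases hy : v1 = q
        · subst hy
          exact n13_pa p v1 (Ne.symm hx)
        · exact n11_pa p q v1 hx hy
    · by_cases hx : v2 = p
      · subst hx
        by_cases hy : v1 = q
        · subst hy
          exact (h ⟨v2, v1, Ne.symm h12, by simp⟩).elim
        · by_cases hq : q = v2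
          · subst hq
            exact n9_pa q v1 h12
          · exact n10_pa v2 q v1 hq h12 hy
      · by_cases hxy : p = v1 ∧ q = v2
        · obtain ⟨rfl, rfl⟩ := hxy
          exact n12_pa p q hx
        · exact n2_two p q p v1 v2 h12 (Ne.symm hx) hxy (by grind)
  · by_cases h1 : v1 = c
    · subst h1
      by_cases h2 : v2 = v1
      · subst h2
        by_cases hq : q = v2
        · subst hq
          exact (h ⟨p, q, hpc, by simp⟩).elim
        · by_cases hpq : p = q
          · subst hpq
            exact n4_pa p v2 hpc
          · exact n3_pa p q v2 v2 hpq hpc hq (.inl rfl)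
      · by_cases h3 : v2 = p
        · subst h3
          by_cases hq : q = v2
          · subst hq
            exact (h ⟨q, v1, hpc, by simp⟩).elim
          · by_cases hqc : q = v1
            · subst hqc
              exact n3b_pa v2 q hpc
            · exact n3_pa v2 q v1 v2 (Ne.symm hq) hpc hqc (.inr rfl)
        · exact n2_two p q v1 v1 v2 (Ne.symm h2) (Ne.symm h3) (by grind) (by grind)
    · exact n1_pa p q c [v1, v2] hpc (by simp) (by simp) (by grind)

theorem both_swap {α : Type} [Fintype α] {u v : List α}
    (h : MonPrefixAutomatic {(v, u)} ∧ MonBiautomatic {(v, u)}) :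
    MonPrefixAutomatic {(u, v)} ∧ MonBiautomatic {(u, v)} :=
  ⟨prefixAutomatic_swap h.1, biautomatic_swap h.2⟩

theorem case_xtx {α : Type} [Fintype α] (x t y : α) (h1 : t ≠ x) (h2 : t ≠ y) :
    MonPrefixAutomatic {([x, t, x], [x, y, x])} ∧ MonBiautomatic {([x, t, x], [x, y, x])} :=
  ⟨(n2_xtx x t y h1 h2).pa, (n2_xtx x t y h1 h2).ba (by simp) (by simp)⟩

theorem case_n1 {α : Type} [Fintype α] (p q c : α) (v : List α) (hpc : p ≠ c)
    (hv : v.length = 3) (huv : v ≠ [p, q, c]) :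
    MonPrefixAutomatic {([p, q, c], v)} ∧ MonBiautomatic {([p, q, c], v)} :=
  ⟨n1_pa p q c v hpc (by omega) huv (by rintro x y rfl; simp at hv),
    n1_ba p q c v hpc (.inr hv) huv⟩

theorem case_three {α : Type} [Fintype α] (p q c v1 v2 v3 : α) (h : [p, q, c] ≠ [v1, v2, v3]) :
    MonPrefixAutomatic {([p, q, c], [v1, v2, v3])} ∧ MonBiautomatic {([p, q, c], [v1, v2, v3])} := by
  by_cases hpc : p = c
  swap
  · exact case_n1 p q c _ hpc rfl h.symm
  by_cases h13 : v1 = v3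
  swap
  · exact both_swap (case_n1 v1 v2 v3 _ h13 rfl h)
  subst hpc h13
  by_cases hs : v1 = p
  · subst hs
    have hne : q ≠ v2 := by grind
    by_cases hq : q = v1
    · exact both_swap (case_xtx v1 v2 q (by grind) hne.symm)
    · exact case_xtx v1 q v2 hq hne
  · by_cases hst : v1 = v2
    · subst hst
      by_cases hxy : p = q
      · subst hxy
        exact n14_ba p v1 (Ne.symm hs)
      · by_cases hys : q = v1
        · subst hys
          exact both_swap (n18_ba q p hs)
        · exact both_swap (n17_ba v1 p q (Ne.symm hs) hys hxy)
    · by_cases hxy : p = q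
      · subst hxy
        by_cases ht : v2 = p
        · subst ht
          exact n18_ba v2 v1 (Ne.symm hs)
        · exact n17_ba p v1 v2 hs ht hst
      · by_cases hh : v2 = p ∧ v1 = q
        · obtain ⟨rfl, rfl⟩ := hh
          exact n15_ba v2 v1 (Ne.symm hs)
        · exact n16_ba p q v1 v2 hxy hst hs hh

/-- let `S = sgp⟨α ∣ u = v⟩` be a one-relator monoid with
`|v| ≤ |u| = 3` and `u ≠ v`.  Then (i) if the relation is of the form
`aba = ba`, `aab = ba` or `abb = bb` for distinct letters `a, b`, `S` is not
automatic; (ii) otherwise `S` is prefix-automatic; (iii) if `|v| = 0` or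
`|v| = 3`, `S` is biautomatic. -/
theorem statement_17 {α : Type} [Fintype α] (u v : List α)
    (hvu : v.length ≤ u.length) (hu3 : u.length = 3) (huv : u ≠ v)
    (R : Set (List α × List α)) (hRdef : R = {(u, v)}) :
    ((∃ a b : α, a ≠ b ∧
        ((u = [a, b, a] ∧ v = [b, a]) ∨ (u = [a, a, b] ∧ v = [b, a]) ∨
          (u = [a, b, b] ∧ v = [b, b]))) → ¬ MonAutomatic R) ∧
    ((¬ ∃ a b : α, a ≠ b ∧
        ((u = [a, b, a] ∧ v = [b, a]) ∨ (u = [a, a, b] ∧ v = [b, a]) ∨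
          (u = [a, b, b] ∧ v = [b, b]))) → MonPrefixAutomatic R) ∧
    ((v.length = 0 ∨ v.length = 3) → MonBiautomatic R) := by
  subst hRdef
  refine ⟨?_, ?_, ?_⟩
  · rintro ⟨a, b, hab, ⟨rfl, rfl⟩ | ⟨rfl, rfl⟩ | ⟨rfl, rfl⟩⟩
    · exact not_auto_aba a b hab
    · exact not_auto_aab a b hab
    · exact not_auto_abb a b hab
  · intro h
    obtain ⟨p, q, c, rfl⟩ := List.length_eq_three.1 hu3
    rcases v with _ | ⟨v1, _ | ⟨v2, _ | ⟨v3, _ | ⟨v4, v⟩⟩⟩⟩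
    · exact (case_zero p q c).1
    · exact case_one p q c v1
    · exact case_two p q c v1 v2 h
    · exact (case_three p q c v1 v2 v3 huv).1
    · simp at hvu; omega
  · intro h
    obtain ⟨p, q, c, rfl⟩ := List.length_eq_three.1 hu3
    rcases v with _ | ⟨v1, _ | ⟨v2, _ | ⟨v3, _ | ⟨v4, v⟩⟩⟩⟩
    · exact (case_zero p q c).2
    · simp at h
    · simp at h
    · exact (case_three p q c v1 v2 v3 huv).2
    · simp at hvu; omega
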